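/- Let B ⊆ (0,1] be a Borel set whose topological boundary has Lebesgue measure zero. For all x > y in ℝ and all integers 0 ≤ k₁ ≤ k₃ and 0 ≤ k₂ ≤ k₄, lim_{n→∞} P( Ñ_n^x(B) = k₁, N̂_n^x(B) = k₂, Ñ_n^y(B) = k₃, N̂_n^y(B) = k₄ ) = E ∫_{−∞}^{+∞} { (λ m(B) g(x,z))^{k₁}/k₁! · (λ m(B)(g(y,z) − g(x,z)))^{k₃−k₁}/(k₃−k₁)! · exp(−λ m(B) g(y,z)) · ((1−λ) m(B) g(x,z))^{k₂}/k₂! · ((1−λ) m(B)(g(y,z) − g(x,z)))^{k₄−k₂}/(k₄−k₂)! · exp(−(1−λ) m(B) g(y,z)) } dΦ(z). -/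

import Mathlib

open MeasureTheory ProbabilityTheory Filter Real
open scoped Classical NNReal ENNReal

/-- The normalizing levels `u_n(x) = x/a_n + b_n` with `a_n = (2 ln n)^{1/2}` and
`b_n = a_n - (ln ln n + ln (4π))/(2 a_n)`. -/
noncomputable def un (n : ℕ) (x : ℝ) : ℝ :=
  x / Real.sqrt (2 * Real.log n) +
    (Real.sqrt (2 * Real.log n) -
      (Real.log (Real.log n) + Real.log (4 * Real.pi)) / (2 * Real.sqrt (2 * Real.log n)))

/-- `g(x,z) = exp(-x - γ + √(2γ) z)`. -/
noncomputable def g (γ x z : ℝ) : ℝ := Real.exp (-x - γ + Real.sqrt (2 * γ) * z)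

/-! ### Gaussian integration by parts -/

lemma hasDerivAt_gaussianPDFReal_std (x : ℝ) :
    HasDerivAt (gaussianPDFReal 0 1) (-(x * gaussianPDFReal 0 1 x)) x := by
  have h : HasDerivAt (fun x : ℝ => -(x - 0) ^ 2 / (2 * ((1 : ℝ≥0) : ℝ))) (-x) x := by
    have := ((((hasDerivAt_id x).sub_const 0).pow 2).neg).div_const (2 * ((1 : ℝ≥0) : ℝ))
    refine this.congr_deriv ?_
    simp
    ring
  refine (h.exp.const_mul _).congr_deriv ?_
  simp only [gaussianPDFReal]
  ring

lemma integrable_mul_gaussianPDFReal_std :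
    Integrable (fun x : ℝ => x * gaussianPDFReal 0 1 x) := by
  have h := integrable_mul_exp_neg_mul_sq (b := (1 / 2 : ℝ)) (by norm_num)
  refine (h.const_mul (√(2 * π * (1 : ℝ≥0)))⁻¹).congr (ae_of_all _ fun x => ?_)
  simp only [gaussianPDFReal, sub_zero, NNReal.coe_one, mul_one]
  rw [show -(1 / 2 : ℝ) * x ^ 2 = -x ^ 2 / 2 by ring]
  ring

/-- Stein's identity for the standard normal law. -/
lemma integral_id_mul_gaussianReal_std {f f' : ℝ → ℝ} {C C' : ℝ}
    (hf : ∀ x, HasDerivAt f (f' x) x) (hC : ∀ x, |f x| ≤ C) (hC' : ∀ x, |f' x| ≤ C') :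
    ∫ x, x * f x ∂(gaussianReal 0 1) = ∫ x, f' x ∂(gaussianReal 0 1) := by
  have hfm : Measurable f :=
    (continuous_iff_continuousAt.2 fun x => (hf x).continuousAt).measurable
  have hf'm : Measurable f' := by
    have : f' = deriv f := funext fun x => (hf x).deriv.symm
    rw [this]
    exact measurable_deriv f
  have h1 : Integrable (f * fun x => -(x * gaussianPDFReal 0 1 x)) :=
    integrable_mul_gaussianPDFReal_std.neg.bdd_mul hfm.aestronglyMeasurable
      (ae_of_all _ fun x => by simpa using hC x)
  have h2 : Integrable (f' * gaussianPDFReal 0 1) :=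
    (integrable_gaussianPDFReal 0 1).bdd_mul hf'm.aestronglyMeasurable
      (ae_of_all _ fun x => by simpa using hC' x)
  have h3 : Integrable (f * gaussianPDFReal 0 1) :=
    (integrable_gaussianPDFReal 0 1).bdd_mul hfm.aestronglyMeasurable
      (ae_of_all _ fun x => by simpa using hC x)
  have key := integral_mul_deriv_eq_deriv_mul_of_integrable (fun x _ => hf x)
    (fun x _ => hasDerivAt_gaussianPDFReal_std x) h1 h2 h3
  rw [integral_gaussianReal_eq_integral_smul one_ne_zero,
    integral_gaussianReal_eq_integral_smul one_ne_zero]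
  have e1 : ∫ x, gaussianPDFReal 0 1 x • (x * f x)
      = -∫ x, f x * -(x * gaussianPDFReal 0 1 x) := by
    rw [← integral_neg]
    congr 1 with x
    simp only [smul_eq_mul]
    ring
  rw [e1, key, neg_neg]
  congr 1 with x
  simp only [smul_eq_mul]
  ring

section Vector

variable {Ω ι : Type*} [MeasurableSpace Ω] [Fintype ι] {P : Measure Ω}

lemma hasFDerivAt_line {H : (ι → ℝ) → ℝ} {H1 : ι → (ι → ℝ) → ℝ}
    (hH : ∀ z, HasFDerivAt H
      (∑ j, H1 j z • (ContinuousLinearMap.proj j : (ι → ℝ) →L[ℝ] ℝ)) z)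
    {φ φ' : ℝ → ι → ℝ} {t : ℝ} (hφ : ∀ i, HasDerivAt (fun s => φ s i) (φ' t i) t) :
    HasDerivAt (fun s => H (φ s)) (∑ j, φ' t j * H1 j (φ t)) t := by
  have := (hH (φ t)).comp_hasDerivAt t (hasDerivAt_pi.2 hφ)
  refine this.congr_deriv ?_
  simp [mul_comm]

/-- Gaussian integration by parts for a standard normal variable `V` jointly Gaussian with a
vector `Z`. -/
lemma gaussian_integration_by_parts {V : Ω → ℝ} {Z : ι → Ω → ℝ}
    (hVZ : HasGaussianLaw (fun ω => (V ω, fun i => Z i ω)) P)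
    (hV : P.map V = gaussianReal 0 1)
    {H : (ι → ℝ) → ℝ} {H1 : ι → (ι → ℝ) → ℝ} {C : ℝ}
    (hH : ∀ z, HasFDerivAt H
      (∑ j, H1 j z • (ContinuousLinearMap.proj j : (ι → ℝ) →L[ℝ] ℝ)) z)
    (hHC : ∀ z, |H z| ≤ C) (hH1C : ∀ j z, |H1 j z| ≤ C) (hH1 : ∀ j, Continuous (H1 j)) :
    ∫ ω, V ω * H (fun i => Z i ω) ∂P
      = ∑ j, cov[V, Z j; P] * ∫ ω, H1 j (fun i => Z i ω) ∂P := by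
  have hP : IsProbabilityMeasure P := hVZ.isProbabilityMeasure
  have hVg : HasGaussianLaw V P := hVZ.fst
  have hZg : ∀ i, HasGaussianLaw (Z i) P := fun i => hVZ.snd.eval i
  have hVm : AEMeasurable V P := hVg.aemeasurable
  have hVar : Var[V; P] = 1 := by
    have := variance_id_gaussianReal (μ := 0) (v := 1)
    rw [← hV, variance_map aemeasurable_id hVm] at this
    simpa using this
  set c : ι → ℝ := fun j => cov[V, Z j; P] with hc
  set R : ι → Ω → ℝ := fun i ω => Z i ω - c i * V ω with hR
  have hHcont : Continuous H := continuous_iff_continuousAt.2 fun z => (hH z).continuousAt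
  have hVR : HasGaussianLaw (fun ω => (fun _ : Unit => V ω, fun i => R i ω)) P := by
    let L : (ℝ × (ι → ℝ)) →L[ℝ] ((Unit → ℝ) × (ι → ℝ)) :=
      ContinuousLinearMap.prod
        (ContinuousLinearMap.pi fun _ => ContinuousLinearMap.fst ℝ ℝ (ι → ℝ))
        (ContinuousLinearMap.pi fun i =>
          (ContinuousLinearMap.proj i).comp (ContinuousLinearMap.snd ℝ ℝ (ι → ℝ))
            - c i • ContinuousLinearMap.fst ℝ ℝ (ι → ℝ))
    exact hVZ.map_fun L
  have hind : IndepFun V (fun ω i => R i ω) P := by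
    have := HasGaussianLaw.indepFun_of_covariance_eval (X := fun _ : Unit => V) (Y := R) hVR ?_
    · exact this.comp (φ := fun f : Unit → ℝ => f ()) (ψ := id) (by fun_prop) measurable_id
    · intro _ j
      have : R j = Z j - fun ω => c j * V ω := by ext; simp [hR]
      rw [this, covariance_sub_right hVg.memLp_two (hZg j).memLp_two
        (hVg.memLp_two.const_mul _), covariance_const_mul_right, covariance_self hVm, hVar]
      simp [hc]
  have hRm : AEMeasurable (fun ω i => R i ω) P := hVR.snd.aemeasurable
  have hmap := (indepFun_iff_map_prod_eq_prod_map_map hVm hRm).1 hind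
  have hpm : AEMeasurable (fun ω => (V ω, fun i => R i ω)) P := hVm.prodMk hRm
  have hZR : ∀ ω, (fun i => Z i ω) = fun i => R i ω + c i * V ω := by
    intro ω; ext i; simp [hR]
  have hcont : ∀ {K : (ι → ℝ) → ℝ}, Continuous K →
      Continuous (fun p : ℝ × (ι → ℝ) => K (fun i => p.2 i + c i * p.1)) := by
    intro K hK; fun_prop
  have : IsProbabilityMeasure (P.map (fun ω i => R i ω)) := Measure.isProbabilityMeasure_map hRm
  have hVi : Integrable (fun v : ℝ => v) (gaussianReal 0 1) :=
    memLp_one_iff_integrable.1 (memLp_id_gaussianReal 1)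
  have transfer : ∀ {F : ℝ × (ι → ℝ) → ℝ}, Continuous F →
      Integrable F ((gaussianReal 0 1).prod (P.map (fun ω i => R i ω))) →
      ∫ ω, F (V ω, fun i => R i ω) ∂P
        = ∫ r, ∫ v, F (v, r) ∂(gaussianReal 0 1) ∂(P.map (fun ω i => R i ω)) := by
    intro F hF hFi
    rw [← integral_map (φ := fun ω => (V ω, fun i => R i ω)) hpm
      hF.measurable.aestronglyMeasurable, hmap, hV, integral_prod_symm _ hFi]
  have hbdd : ∀ {K : (ι → ℝ) → ℝ}, Continuous K → (∀ z, |K z| ≤ C) →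
      Integrable (fun p : ℝ × (ι → ℝ) => K (fun i => p.2 i + c i * p.1))
        ((gaussianReal 0 1).prod (P.map (fun ω i => R i ω))) := by
    intro K hK hKC
    exact Integrable.of_bound (hcont hK).aestronglyMeasurable C
      (ae_of_all _ fun p => by simpa using hKC _)
  have hint1 : Integrable (fun p : ℝ × (ι → ℝ) => p.1 * H (fun i => p.2 i + c i * p.1))
      ((gaussianReal 0 1).prod (P.map (fun ω i => R i ω))) := by
    have hfst : Integrable (fun p : ℝ × (ι → ℝ) => p.1)
        ((gaussianReal 0 1).prod (P.map (fun ω i => R i ω))) := hVi.comp_fst _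
    have := hfst.bdd_mul (c := C) (hcont hHcont).aestronglyMeasurable
      (ae_of_all _ fun p => by simpa using hHC _)
    simpa only [mul_comm] using this
  have hcontx : Continuous (fun p : ℝ × (ι → ℝ) => p.1 * H (fun i => p.2 i + c i * p.1)) :=
    continuous_fst.mul (hcont hHcont)
  simp_rw [hZR]
  rw [transfer (F := fun p => p.1 * H (fun i => p.2 i + c i * p.1)) hcontx hint1]
  have hstein : ∀ r : ι → ℝ, ∫ v, v * H (fun i => r i + c i * v) ∂(gaussianReal 0 1)
      = ∫ v, ∑ j, c j * H1 j (fun i => r i + c i * v) ∂(gaussianReal 0 1) := by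
    intro r
    refine integral_id_mul_gaussianReal_std (C := C) (C' := ∑ j, |c j| * C)
      (fun v => hasFDerivAt_line (φ := fun v i => r i + c i * v) (φ' := fun _ => c) hH
        fun i => ?_) (fun v => hHC _) (fun v => ?_)
    · simpa using ((hasDerivAt_id v).const_mul (c i)).const_add (r i)
    · refine (Finset.abs_sum_le_sum_abs _ _).trans (Finset.sum_le_sum fun j _ => ?_)
      rw [abs_mul]
      exact mul_le_mul_of_nonneg_left (hH1C _ _) (abs_nonneg _)
  simp_rw [hstein]
  have hsumint : Integrable (fun p : ℝ × (ι → ℝ) => ∑ j, c j * H1 j (fun i => p.2 i + c i * p.1))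
      ((gaussianReal 0 1).prod (P.map (fun ω i => R i ω))) :=
    integrable_finsetSum _ fun j _ => (hbdd (hH1 j) (hH1C j)).const_mul _
  rw [← transfer (F := fun p => ∑ j, c j * H1 j (fun i => p.2 i + c i * p.1))
    (continuous_finsetSum _ fun j _ => continuous_const.mul (hcont (hH1 j))) hsumint]
  have hmint : ∀ j, Integrable (fun ω => H1 j (fun i => R i ω + c i * V ω)) P := by
    intro j
    have := hbdd (hH1 j) (hH1C j)
    rw [← hV, ← hmap] at this
    exact (integrable_map_measure (hcont (hH1 j)).aestronglyMeasurable hpm).1 this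
  rw [integral_finsetSum _ fun j _ => (hmint j).const_mul _]
  simp_rw [integral_const_mul]
  rfl

end Vector

/-! ### Gaussian interpolation -/

section Interpolation

variable {Ω ι : Type*} [MeasurableSpace Ω] [Fintype ι] {P : Measure Ω}

/-- The path `sin θ X + cos θ Y` between two Gaussian vectors. -/
noncomputable def gaussPath (X Y : ι → Ω → ℝ) (θ : ℝ) (i : ι) (ω : Ω) : ℝ :=
  Real.sin θ * X i ω + Real.cos θ * Y i ω

/-- Independent Gaussian vectors `X`, `Y` with standard normal coordinates. -/
structure IsStdGaussPair (X Y : ι → Ω → ℝ) (P : Measure Ω) : Prop where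
  gauss : HasGaussianLaw (fun ω => (fun i => X i ω, fun i => Y i ω)) P
  cross : ∀ i j, cov[X i, Y j; P] = 0
  meanX : ∀ i, P[X i] = 0
  meanY : ∀ i, P[Y i] = 0
  varX : ∀ i, cov[X i, X i; P] = 1
  varY : ∀ i, cov[Y i, Y i; P] = 1

variable {X Y : ι → Ω → ℝ}

namespace IsStdGaussPair

lemma gaussX (h : IsStdGaussPair X Y P) (i : ι) : HasGaussianLaw (X i) P := h.gauss.fst.eval i

lemma gaussY (h : IsStdGaussPair X Y P) (i : ι) : HasGaussianLaw (Y i) P := h.gauss.snd.eval i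

lemma covariance_comb (h : IsStdGaussPair X Y P) (a b c d : ℝ) (i j : ι) :
    cov[fun ω => a * X i ω + b * Y i ω, fun ω => c * X j ω + d * Y j ω; P]
      = a * c * cov[X i, X j; P] + b * d * cov[Y i, Y j; P] := by
  have := h.gauss.isProbabilityMeasure
  have hX := fun i => (h.gaussX i).memLp_two
  have hY := fun i => (h.gaussY i).memLp_two
  have e1 : (fun ω => a * X i ω + b * Y i ω) = (fun ω => a * X i ω) + fun ω => b * Y i ω := rfl
  have e2 : (fun ω => c * X j ω + d * Y j ω) = (fun ω => c * X j ω) + fun ω => d * Y j ω := rfl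
  rw [e1, e2, covariance_add_left ((hX i).const_mul a) ((hY i).const_mul b)
      (((hX j).const_mul c).add ((hY j).const_mul d)),
    covariance_add_right ((hX i).const_mul a) ((hX j).const_mul c) ((hY j).const_mul d),
    covariance_add_right ((hY i).const_mul b) ((hX j).const_mul c) ((hY j).const_mul d)]
  simp only [covariance_const_mul_left, covariance_const_mul_right, h.cross,
    covariance_comm (Y i) (X j)]
  ring

lemma mean_comb (h : IsStdGaussPair X Y P) (a b : ℝ) (i : ι) :
    ∫ ω, (a * X i ω + b * Y i ω) ∂P = 0 := by
  rw [integral_add ((h.gaussX i).integrable.const_mul a) ((h.gaussY i).integrable.const_mul b),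
    integral_const_mul, integral_const_mul, h.meanX, h.meanY]
  simp

lemma hasGaussianLaw_comb (h : IsStdGaussPair X Y P) (a b c d : ℝ) (i : ι) :
    HasGaussianLaw
      (fun ω => (a * X i ω + b * Y i ω, fun j => c * X j ω + d * Y j ω)) P := by
  let L : ((ι → ℝ) × (ι → ℝ)) →L[ℝ] (ℝ × (ι → ℝ)) :=
    ContinuousLinearMap.prod
      (a • (ContinuousLinearMap.proj i).comp (ContinuousLinearMap.fst ℝ (ι → ℝ) (ι → ℝ))
        + b • (ContinuousLinearMap.proj i).comp (ContinuousLinearMap.snd ℝ (ι → ℝ) (ι → ℝ)))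
      (c • ContinuousLinearMap.fst ℝ (ι → ℝ) (ι → ℝ)
        + d • ContinuousLinearMap.snd ℝ (ι → ℝ) (ι → ℝ))
  exact h.gauss.map_fun L

lemma map_comb (h : IsStdGaussPair X Y P) {a b : ℝ} (hab : a ^ 2 + b ^ 2 = 1) (i : ι) :
    P.map (fun ω => a * X i ω + b * Y i ω) = gaussianReal 0 1 := by
  have hg := (h.hasGaussianLaw_comb a b a b i).fst
  rw [hg.map_eq_gaussianReal, h.mean_comb, ← covariance_self hg.aemeasurable,
    h.covariance_comb, h.varX, h.varY]
  have : a * a * 1 + b * b * 1 = 1 := by nlinarith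
  rw [this]
  simp

lemma hasDerivAt_integral_path (h : IsStdGaussPair X Y P)
    {G : (ι → ℝ) → ℝ} {G1 : ι → (ι → ℝ) → ℝ} {C : ℝ}
    (hG : ∀ z, HasFDerivAt G
      (∑ j, G1 j z • (ContinuousLinearMap.proj j : (ι → ℝ) →L[ℝ] ℝ)) z)
    (hGC : ∀ z, |G z| ≤ C) (hG1C : ∀ j z, |G1 j z| ≤ C) (hG1 : ∀ j, Continuous (G1 j)) (θ : ℝ) :
    HasDerivAt (fun t => ∫ ω, G (fun i => gaussPath X Y t i ω) ∂P)
      (∫ ω, ∑ i, (Real.cos θ * X i ω + (-Real.sin θ) * Y i ω)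
        * G1 i (fun i => gaussPath X Y θ i ω) ∂P) θ := by
  have := h.gauss.isProbabilityMeasure
  have hXm := fun i => (h.gaussX i).aemeasurable
  have hYm := fun i => (h.gaussY i).aemeasurable
  have hpath : ∀ t, AEMeasurable (fun ω i => gaussPath X Y t i ω) P := fun t =>
    aemeasurable_pi_lambda _ fun i => ((hXm i).const_mul _).add ((hYm i).const_mul _)
  have hGcont : Continuous G := continuous_iff_continuousAt.2 fun z => (hG z).continuousAt
  refine (hasDerivAt_integral_of_dominated_loc_of_deriv_le (s := Set.univ)
    (bound := fun ω => ∑ i, (|X i ω| + |Y i ω|) * C)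
    (F' := fun t ω => ∑ i, (Real.cos t * X i ω + (-Real.sin t) * Y i ω)
        * G1 i (fun i => gaussPath X Y t i ω)) Filter.univ_mem ?_ ?_ ?_ ?_ ?_ ?_).2
  · exact Eventually.of_forall fun t =>
      (hGcont.measurable.comp_aemeasurable (hpath t)).aestronglyMeasurable
  · exact Integrable.of_bound
      (hGcont.measurable.comp_aemeasurable (hpath θ)).aestronglyMeasurable C
      (ae_of_all _ fun ω => hGC _)
  · refine AEMeasurable.aestronglyMeasurable (Finset.aemeasurable_fun_sum _ fun i _ => ?_)
    exact (((hXm i).const_mul _).add ((hYm i).const_mul _)).mul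
      ((hG1 i).measurable.comp_aemeasurable (hpath θ))
  · refine ae_of_all _ fun ω t _ => ?_
    refine (Finset.abs_sum_le_sum_abs _ _).trans (Finset.sum_le_sum fun i _ => ?_)
    rw [abs_mul]
    refine mul_le_mul ?_ (hG1C _ _) (abs_nonneg _) (by positivity)
    refine (abs_add_le _ _).trans ?_
    rw [abs_mul, abs_mul, abs_neg]
    gcongr
    · exact mul_le_of_le_one_left (abs_nonneg _) (abs_cos_le_one t)
    · exact mul_le_of_le_one_left (abs_nonneg _) (abs_sin_le_one t)
  · exact integrable_finsetSum _ fun i _ =>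
      (((h.gaussX i).integrable.abs).add (h.gaussY i).integrable.abs).mul_const C
  · refine ae_of_all _ fun ω t _ => ?_
    refine hasFDerivAt_line (φ := fun t i => gaussPath X Y t i ω)
      (φ' := fun t i => Real.cos t * X i ω + (-Real.sin t) * Y i ω) hG fun i => ?_
    exact ((hasDerivAt_sin t).mul_const _).add ((hasDerivAt_cos t).mul_const _)

/-- Comparison of two Gaussian vectors with unit variances, by interpolation. -/
lemma abs_integral_sub_le (h : IsStdGaussPair X Y P)
    {G : (ι → ℝ) → ℝ} {G1 : ι → (ι → ℝ) → ℝ} {G2 : ι → ι → (ι → ℝ) → ℝ} {C : ℝ}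
    (hG : ∀ z, HasFDerivAt G
      (∑ j, G1 j z • (ContinuousLinearMap.proj j : (ι → ℝ) →L[ℝ] ℝ)) z)
    (hG1 : ∀ i z, HasFDerivAt (G1 i)
      (∑ j, G2 i j z • (ContinuousLinearMap.proj j : (ι → ℝ) →L[ℝ] ℝ)) z)
    (hGC : ∀ z, |G z| ≤ C) (hG1C : ∀ j z, |G1 j z| ≤ C) (hG2C : ∀ i j z, |G2 i j z| ≤ C)
    (hG2 : ∀ i j, Continuous (G2 i j)) {K : ι → ι → ℝ}
    (hK : ∀ θ ∈ Set.Icc 0 (π / 2), ∀ i j, i ≠ j →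
      |∫ ω, G2 i j (fun k => gaussPath X Y θ k ω) ∂P| ≤ K i j) :
    |∫ ω, G (fun i => X i ω) ∂P - ∫ ω, G (fun i => Y i ω) ∂P|
      ≤ (∑ i, ∑ j, |cov[X i, X j; P] - cov[Y i, Y j; P]| * K i j) * (π / 2) := by
  have := h.gauss.isProbabilityMeasure
  have hG1cont : ∀ i, Continuous (G1 i) := fun i =>
    continuous_iff_continuousAt.2 fun z => (hG1 i z).continuousAt
  have hderiv := h.hasDerivAt_integral_path hG hGC hG1C hG1cont
  have hbound : ∀ θ ∈ Set.Icc 0 (π / 2),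
      ‖∫ ω, ∑ i, (Real.cos θ * X i ω + (-Real.sin θ) * Y i ω)
        * G1 i (fun i => gaussPath X Y θ i ω) ∂P‖
        ≤ ∑ i, ∑ j, |cov[X i, X j; P] - cov[Y i, Y j; P]| * K i j := by
    intro θ hθ
    have hpath : AEMeasurable (fun ω i => gaussPath X Y θ i ω) P :=
      aemeasurable_pi_lambda _ fun i =>
        ((h.gaussX i).aemeasurable.const_mul _).add ((h.gaussY i).aemeasurable.const_mul _)
    rw [integral_finsetSum]
    · refine (norm_sum_le _ _).trans (Finset.sum_le_sum fun i _ => ?_)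
      have ibp := gaussian_integration_by_parts (Z := gaussPath X Y θ)
        (h.hasGaussianLaw_comb (Real.cos θ) (-Real.sin θ) (Real.sin θ) (Real.cos θ) i)
        (h.map_comb (by rw [neg_sq]; exact cos_sq_add_sin_sq θ) i)
        (hG1 i) (hG1C i) (hG2C i) (hG2 i)
      rw [ibp]
      refine (norm_sum_le _ _).trans (Finset.sum_le_sum fun j _ => ?_)
      have hcov : cov[fun ω => Real.cos θ * X i ω + (-Real.sin θ) * Y i ω,
          gaussPath X Y θ j; P] = Real.cos θ * Real.sin θ
            * (cov[X i, X j; P] - cov[Y i, Y j; P]) := by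
        rw [show gaussPath X Y θ j = fun ω => Real.sin θ * X j ω + Real.cos θ * Y j ω from rfl,
          h.covariance_comb]
        ring
      rw [hcov, norm_mul, norm_mul, norm_mul, Real.norm_eq_abs, Real.norm_eq_abs,
        Real.norm_eq_abs, Real.norm_eq_abs]
      by_cases hij : i = j
      · subst hij
        simp [h.varX, h.varY]
      · refine mul_le_mul ?_ (hK θ hθ i j hij) (abs_nonneg _) (abs_nonneg _)
        refine mul_le_of_le_one_left (abs_nonneg _) ?_
        exact mul_le_one₀ (abs_cos_le_one _) (abs_nonneg _) (abs_sin_le_one _)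
    · intro i _
      have hi : Integrable (fun ω => Real.cos θ * X i ω + (-Real.sin θ) * Y i ω) P :=
        ((h.gaussX i).integrable.const_mul _).add ((h.gaussY i).integrable.const_mul _)
      have := hi.bdd_mul (c := C)
        ((hG1cont i).measurable.comp_aemeasurable hpath).aestronglyMeasurable
        (ae_of_all _ fun ω => hG1C i _)
      simpa only [mul_comm, Function.comp_def] using this
  have hmv := (convex_Icc (0 : ℝ) (π / 2)).norm_image_sub_le_of_norm_hasDerivWithin_le
    (fun θ _ => (hderiv θ).hasDerivWithinAt) hbound
    (Set.left_mem_Icc.2 (by positivity)) (Set.right_mem_Icc.2 (by positivity))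
  simpa [gaussPath, abs_of_pos pi_pos] using hmv

end IsStdGaussPair

end Interpolation

/-! ### A bivariate Gaussian tail bound -/

lemma gaussianPDFReal_mul_le {ρ w u v : ℝ} (hρ : |ρ| < 1) (hw : 0 ≤ w) (hu : w ≤ u) (hv : w ≤ v) :
    gaussianPDFReal 0 1 u * gaussianPDFReal (ρ * u) (1 - ρ ^ 2).toNNReal v
      ≤ (√(1 - ρ ^ 2))⁻¹ * rexp (-w ^ 2 / (1 + |ρ|)) := by
  have hρ2 : 0 < 1 - ρ ^ 2 := by
    have := (sq_lt_one_iff_abs_lt_one ρ).2 hρ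
    linarith
  obtain ⟨h1, h2⟩ := abs_lt.1 hρ
  simp only [gaussianPDFReal, NNReal.coe_one, mul_one, sub_zero, Real.coe_toNNReal _ hρ2.le]
  have e : rexp (-u ^ 2 / 2) * rexp (-(v - ρ * u) ^ 2 / (2 * (1 - ρ ^ 2)))
      ≤ rexp (-w ^ 2 / (1 + |ρ|)) := by
    rw [← Real.exp_add]
    refine Real.exp_le_exp.2 ?_
    have hid : -u ^ 2 / 2 + -(v - ρ * u) ^ 2 / (2 * (1 - ρ ^ 2))
        = -((u - v) ^ 2 / (2 * (1 - ρ ^ 2)) + u * v / (1 + ρ)) := by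
      have : 1 + ρ ≠ 0 := by linarith
      have : (1 - ρ ^ 2) = (1 - ρ) * (1 + ρ) := by ring
      have h3 : 1 - ρ ≠ 0 := by linarith
      rw [this]
      field_simp
      ring
    rw [hid, neg_div]
    refine neg_le_neg ?_
    have h4 : w ^ 2 / (1 + |ρ|) ≤ u * v / (1 + ρ) := by
      have : w ^ 2 ≤ u * v := by nlinarith
      have h5 : 1 + ρ ≤ 1 + |ρ| := by linarith [le_abs_self ρ]
      exact div_le_div₀ (by nlinarith) this (by linarith) h5
    have : 0 ≤ (u - v) ^ 2 / (2 * (1 - ρ ^ 2)) := by positivity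
    linarith
  have hs1 : (√(2 * π))⁻¹ ≤ 1 := by
    refine inv_le_one_of_one_le₀ (Real.one_le_sqrt.2 ?_)
    nlinarith [pi_gt_three]
  have hs2 : (√(2 * π * (1 - ρ ^ 2)))⁻¹ ≤ (√(1 - ρ ^ 2))⁻¹ := by
    refine inv_anti₀ (Real.sqrt_pos.2 hρ2) (Real.sqrt_le_sqrt ?_)
    nlinarith [pi_gt_three]
  calc (√(2 * π))⁻¹ * rexp (-u ^ 2 / 2) *
        ((√(2 * π * (1 - ρ ^ 2)))⁻¹ * rexp (-(v - ρ * u) ^ 2 / (2 * (1 - ρ ^ 2))))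
      = ((√(2 * π))⁻¹ * (√(2 * π * (1 - ρ ^ 2)))⁻¹)
        * (rexp (-u ^ 2 / 2) * rexp (-(v - ρ * u) ^ 2 / (2 * (1 - ρ ^ 2)))) := by ring
    _ ≤ (1 * (√(1 - ρ ^ 2))⁻¹) * rexp (-w ^ 2 / (1 + |ρ|)) := by gcongr
    _ = _ := by ring

lemma lintegral_mul_lintegral_mul_le {φ : ℝ → ℝ≥0∞} {ψ : ℝ → ℝ → ℝ≥0∞} {f₁ f₂ : ℝ → ℝ≥0∞}
    (hψ : ∀ u, Measurable (ψ u)) (hf₁ : Measurable f₁) (hf₂ : Measurable f₂)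
    {w : ℝ} {K : ℝ≥0∞} (h₁ : ∀ t < w, f₁ t = 0) (h₂ : ∀ t < w, f₂ t = 0)
    (hK : ∀ u v, w ≤ u → w ≤ v → φ u * ψ u v ≤ K) :
    ∫⁻ u, (φ * fun u => f₁ u * ∫⁻ v, ψ u v * f₂ v) u ≤ K * ((∫⁻ t, f₁ t) * ∫⁻ t, f₂ t) := by
  have hpt : ∀ u v, φ u * f₁ u * (ψ u v * f₂ v) ≤ K * f₁ u * f₂ v := by
    intro u v
    by_cases hu : u < w
    · simp [h₁ u hu]
    by_cases hv : v < w
    · simp [h₂ v hv]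
    push Not at hu hv
    calc φ u * f₁ u * (ψ u v * f₂ v) = (φ u * ψ u v) * f₁ u * f₂ v := by ring
      _ ≤ K * f₁ u * f₂ v := by
          gcongr
          exact hK u v hu hv
  calc ∫⁻ u, (φ * fun u => f₁ u * ∫⁻ v, ψ u v * f₂ v) u
      ≤ ∫⁻ u, K * f₁ u * ∫⁻ v, f₂ v := by
        refine lintegral_mono fun u => ?_
        simp only [Pi.mul_apply]
        rw [← mul_assoc, ← lintegral_const_mul (f := fun v => ψ u v * f₂ v) _ ((hψ u).mul hf₂), ← lintegral_const_mul _ hf₂]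
        exact lintegral_mono fun v => hpt u v
    _ = K * ((∫⁻ t, f₁ t) * ∫⁻ t, f₂ t) := by
        rw [lintegral_mul_const _ (hf₁.const_mul _), lintegral_const_mul _ hf₁, mul_assoc]

lemma lintegral_mul_bivariate_gaussian_le {Ω : Type*} [MeasurableSpace Ω] {P : Measure Ω}
    {U V : Ω → ℝ} (hUV : HasGaussianLaw (fun ω => (U ω, V ω)) P)
    (hU : P.map U = gaussianReal 0 1) (hV : P.map V = gaussianReal 0 1)
    {ρ : ℝ} (hcov : cov[U, V; P] = ρ) (hρ : |ρ| < 1)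
    {w : ℝ} (hw : 0 ≤ w) {f₁ f₂ : ℝ → ℝ≥0∞} (hf₁ : Measurable f₁) (hf₂ : Measurable f₂)
    (h₁ : ∀ t < w, f₁ t = 0) (h₂ : ∀ t < w, f₂ t = 0) :
    ∫⁻ ω, f₁ (U ω) * f₂ (V ω) ∂P
      ≤ ENNReal.ofReal ((√(1 - ρ ^ 2))⁻¹ * rexp (-w ^ 2 / (1 + |ρ|)))
        * ((∫⁻ t, f₁ t) * ∫⁻ t, f₂ t) := by
  have hP : IsProbabilityMeasure P := hUV.isProbabilityMeasure
  have hUg : HasGaussianLaw U P := hUV.fst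
  have hVg : HasGaussianLaw V P := hUV.snd
  have hUm := hUg.aemeasurable
  have hVm := hVg.aemeasurable
  have hρ2 : 0 < 1 - ρ ^ 2 := by
    have := (sq_lt_one_iff_abs_lt_one ρ).2 hρ
    linarith
  have hmean : ∀ {T : Ω → ℝ}, AEMeasurable T P → P.map T = gaussianReal 0 1 →
      P[T] = 0 ∧ Var[T; P] = 1 := by
    intro T hTm hT
    refine ⟨?_, ?_⟩
    · have := integral_id_gaussianReal (μ := 0) (v := 1)
      rw [← hT, integral_map hTm (by fun_prop)] at this
      exact this
    · have := variance_id_gaussianReal (μ := 0) (v := 1)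
      rw [← hT, variance_map aemeasurable_id hTm] at this
      simpa using this
  obtain ⟨hU0, hU1⟩ := hmean hUm hU
  obtain ⟨hV0, hV1⟩ := hmean hVm hV
  set W : Ω → ℝ := fun ω => V ω - ρ * U ω with hWdef
  have hUW : HasGaussianLaw (fun ω => (U ω, W ω)) P := by
    let L : (ℝ × ℝ) →L[ℝ] (ℝ × ℝ) :=
      ContinuousLinearMap.prod (ContinuousLinearMap.fst ℝ ℝ ℝ)
        (ContinuousLinearMap.snd ℝ ℝ ℝ - ρ • ContinuousLinearMap.fst ℝ ℝ ℝ)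
    exact hUV.map_fun L
  have hWg : HasGaussianLaw W P := hUW.snd
  have hWm := hWg.aemeasurable
  have hWeq : W = V - fun ω => ρ * U ω := rfl
  have hind : IndepFun U W P := by
    refine hUW.indepFun_of_covariance_eq_zero ?_
    rw [hWeq, covariance_sub_right hUg.memLp_two hVg.memLp_two (hUg.memLp_two.const_mul _),
      covariance_const_mul_right, covariance_self hUm, hU1, hcov]
    ring
  have hWlaw : P.map W = gaussianReal 0 (1 - ρ ^ 2).toNNReal := by
    rw [hWg.map_eq_gaussianReal]
    have e1 : P[W] = 0 := by
      have : P[W] = P[V] - ρ * P[U] := by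
        rw [← integral_const_mul, ← integral_sub hVg.integrable (hUg.integrable.const_mul _)]
      rw [this, hU0, hV0]
      simp
    have e2 : Var[W; P] = 1 - ρ ^ 2 := by
      rw [hWeq, variance_sub hVg.memLp_two (hUg.memLp_two.const_mul _),
        covariance_const_mul_right, variance_const_mul, hV1, hU1, covariance_comm, hcov]
      ring
    rw [e1, e2]
  have hmap := (indepFun_iff_map_prod_eq_prod_map_map hUm hWm).1 hind
  rw [hU, hWlaw] at hmap
  have hVW : ∀ ω, V ω = ρ * U ω + W ω := fun ω => by simp [hWdef]
  simp_rw [hVW]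
  have hFm : Measurable (fun p : ℝ × ℝ => f₁ p.1 * f₂ (ρ * p.1 + p.2)) := by fun_prop
  rw [← lintegral_map' (g := fun ω => (U ω, W ω)) (f := fun p : ℝ × ℝ => f₁ p.1 * f₂ (ρ * p.1 + p.2))
    hFm.aemeasurable (hUm.prodMk hWm), hmap, lintegral_prod _ hFm.aemeasurable]
  have hv : (1 - ρ ^ 2).toNNReal ≠ 0 := (Real.toNNReal_pos.2 hρ2).ne'
  have hinner : ∀ u, ∫⁻ t, f₁ u * f₂ (ρ * u + t) ∂(gaussianReal 0 (1 - ρ ^ 2).toNNReal)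
      = f₁ u * ∫⁻ v, gaussianPDF (ρ * u) (1 - ρ ^ 2).toNNReal v * f₂ v := by
    intro u
    rw [lintegral_const_mul _ (by fun_prop),
      ← lintegral_map (f := f₂) (g := fun t => ρ * u + t) hf₂ (by fun_prop),
      gaussianReal_map_const_add, zero_add, gaussianReal_of_var_ne_zero _ hv,
      lintegral_withDensity_eq_lintegral_mul _ (measurable_gaussianPDF _ _) hf₂]
    rfl
  simp only [hinner]
  generalize hv' : (1 - ρ ^ 2).toNNReal = v' at hv
  have hfin := lintegral_mul_lintegral_mul_le (φ := gaussianPDF 0 1)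
    (ψ := fun u v => gaussianPDF (ρ * u) v' v)
    (K := ENNReal.ofReal ((√(1 - ρ ^ 2))⁻¹ * rexp (-w ^ 2 / (1 + |ρ|))))
    (fun u => measurable_gaussianPDF _ _) hf₁ hf₂ h₁ h₂ fun u v hu hv => by
      rw [gaussianPDF, gaussianPDF, ← ENNReal.ofReal_mul (gaussianPDFReal_nonneg _ _ _), ← hv']
      exact ENNReal.ofReal_le_ofReal (gaussianPDFReal_mul_le hρ hw hu hv)
  have hm : Measurable (fun p : ℝ × ℝ => gaussianPDF (ρ * p.1) v' p.2 * f₂ p.2) := by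
    refine Measurable.mul ?_ (by fun_prop)
    simp only [gaussianPDF, gaussianPDFReal]
    fun_prop
  have hm1 : Measurable (fun u => ∫⁻ v, gaussianPDF (ρ * u) v' v * f₂ v) :=
    hm.lintegral_prod_right'
  have hm2 : Measurable (fun u => f₁ u * ∫⁻ v, gaussianPDF (ρ * u) v' v * f₂ v) := hf₁.mul hm1
  rw [gaussianReal_of_var_ne_zero _ one_ne_zero,
    lintegral_withDensity_eq_lintegral_mul _ (measurable_gaussianPDF _ _) hm2]
  exact hfin

/-! ### Functions of the states of the coordinates -/

section StateSum

variable {ι κ : Type*} [Fintype ι] [Fintype κ]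

/-- The sum over state assignments `s` of `F s` times the product of the weights
`q (d k) (s k) (z k)`, where `d k` is the order of differentiation in the `k`-th coordinate. -/
noncomputable def stateSum (F : (ι → κ) → ℝ) (q : ℕ → κ → ℝ → ℝ) (d : ι → ℕ) (z : ι → ℝ) : ℝ :=
  ∑ s : ι → κ, F s * ∏ k, q (d k) (s k) (z k)

variable {F : (ι → κ) → ℝ} {q : ℕ → κ → ℝ → ℝ}

lemma hasFDerivAt_stateSum (hq : ∀ m a t, HasDerivAt (q m a) (q (m + 1) a t) t)
    (d : ι → ℕ) (z : ι → ℝ) :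
    HasFDerivAt (stateSum F q d)
      (∑ j, stateSum F q (d + Pi.single j 1) z •
        (ContinuousLinearMap.proj j : (ι → ℝ) →L[ℝ] ℝ)) z := by
  have h1 : ∀ s : ι → κ, HasFDerivAt (fun z : ι → ℝ => F s * ∏ k, q (d k) (s k) (z k))
      (F s • ∑ i, (∏ j ∈ Finset.univ.erase i, q (d j) (s j) (z j)) •
        (q (d i + 1) (s i) (z i) • (ContinuousLinearMap.proj i : (ι → ℝ) →L[ℝ] ℝ))) z := by
    intro s
    have := HasFDerivAt.finsetProd (u := Finset.univ) (x := z)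
      (g := fun i (z : ι → ℝ) => q (d i) (s i) (z i))
      (g' := fun i => q (d i + 1) (s i) (z i) • (ContinuousLinearMap.proj i : (ι → ℝ) →L[ℝ] ℝ))
      (fun i _ => (hq (d i) (s i) (z i)).comp_hasFDerivAt z
        (ContinuousLinearMap.proj (R := ℝ) (φ := fun _ : ι => ℝ) i).hasFDerivAt)
    exact this.const_mul (F s)
  have h2 := HasFDerivAt.fun_sum (u := Finset.univ) fun s _ => h1 s
  refine h2.congr_fderiv ?_
  simp only [stateSum, Finset.smul_sum, Finset.sum_smul]
  rw [Finset.sum_comm]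
  refine Finset.sum_congr rfl fun j _ => Finset.sum_congr rfl fun s _ => ?_
  rw [smul_smul, smul_smul, ← Finset.mul_prod_erase Finset.univ _ (Finset.mem_univ j)]
  have e : ∏ k ∈ Finset.univ.erase j, q ((d + Pi.single j 1 : ι → ℕ) k) (s k) (z k)
      = ∏ k ∈ Finset.univ.erase j, q (d k) (s k) (z k) :=
    Finset.prod_congr rfl fun k hk => by simp [Finset.ne_of_mem_erase hk]
  rw [e]
  congr 1
  simp only [Pi.add_apply, Pi.single_eq_same]
  ring

lemma abs_stateSum_le_prod (hF : ∀ s, |F s| ≤ 1) (d : ι → ℕ) (z : ι → ℝ) :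
    |stateSum F q d z| ≤ ∏ k, ∑ a, |q (d k) a (z k)| := by
  rw [Finset.prod_univ_sum, Fintype.piFinset_univ]
  refine (Finset.abs_sum_le_sum_abs _ _).trans (Finset.sum_le_sum fun s _ => ?_)
  rw [abs_mul, Finset.abs_prod]
  exact mul_le_of_le_one_left (Finset.prod_nonneg fun _ _ => abs_nonneg _) (hF s)

lemma abs_stateSum_le_one (hF : ∀ s, |F s| ≤ 1) (hq0 : ∀ t, ∑ a, |q 0 a t| ≤ 1) (z : ι → ℝ) :
    |stateSum F q 0 z| ≤ 1 :=
  (abs_stateSum_le_prod hF 0 z).trans <| Finset.prod_le_one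
    (fun _ _ => Finset.sum_nonneg fun _ _ => abs_nonneg _) fun _ _ => hq0 _

lemma abs_stateSum_single_add_single_le (hF : ∀ s, |F s| ≤ 1) (hq0 : ∀ t, ∑ a, |q 0 a t| ≤ 1)
    {i j : ι} (hij : i ≠ j) (z : ι → ℝ) :
    |stateSum F q (Pi.single i 1 + Pi.single j 1) z|
      ≤ (∑ a, |q 1 a (z i)|) * ∑ a, |q 1 a (z j)| := by
  refine (abs_stateSum_le_prod hF _ z).trans ?_
  have hj : j ∈ Finset.univ.erase i := Finset.mem_erase.2 ⟨hij.symm, Finset.mem_univ _⟩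
  rw [← Finset.mul_prod_erase Finset.univ _ (Finset.mem_univ i), ← Finset.mul_prod_erase _ _ hj,
    ← mul_assoc]
  simp only [Pi.add_apply, Pi.single_eq_same, Pi.single_eq_of_ne hij, Pi.single_eq_of_ne hij.symm,
    add_zero, zero_add]
  refine mul_le_of_le_one_right (mul_nonneg (Finset.sum_nonneg fun _ _ => abs_nonneg _)
    (Finset.sum_nonneg fun _ _ => abs_nonneg _)) ?_
  refine Finset.prod_le_one (fun _ _ => Finset.sum_nonneg fun _ _ => abs_nonneg _) fun k hk => ?_
  have hk1 : k ≠ j := Finset.ne_of_mem_erase hk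
  have hk2 : k ≠ i := Finset.ne_of_mem_erase (Finset.mem_of_mem_erase hk)
  simpa [Pi.single_eq_of_ne hk1, Pi.single_eq_of_ne hk2] using hq0 (z k)

lemma abs_stateSum_le_of_le_two (hF : ∀ s, |F s| ≤ 1) {C : ℝ}
    (hC : ∀ m ≤ 2, ∀ a t, |q m a t| ≤ C) {d : ι → ℕ} (hd : ∀ k, d k ≤ 2) (z : ι → ℝ) :
    |stateSum F q d z| ≤ (Fintype.card κ * C) ^ Fintype.card ι := by
  refine (abs_stateSum_le_prod hF d z).trans ?_
  rw [← Finset.card_univ (α := ι), ← Finset.prod_const]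
  refine Finset.prod_le_prod (fun _ _ => Finset.sum_nonneg fun _ _ => abs_nonneg _) fun k _ => ?_
  refine (Finset.sum_le_sum fun a _ => hC _ (hd k) a (z k)).trans ?_
  simp

end StateSum

section Comparison

variable {Ω ι κ : Type*} [MeasurableSpace Ω] [Fintype ι] [Fintype κ] {P : Measure Ω}
  {X Y : ι → Ω → ℝ}

/-- The bound for the contribution of a pair of coordinates with correlation at most `w`
to the difference of two Gaussian probabilities determined by exceedances of the level `u`. -/
noncomputable def pairBound (u w : ℝ) : ℝ := (√(1 - w ^ 2))⁻¹ * rexp (-u ^ 2 / (1 + w))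

lemma pairBound_nonneg (u w : ℝ) : 0 ≤ pairBound u w := by unfold pairBound; positivity

lemma pairBound_mono {u w w' : ℝ} (h0 : 0 ≤ w) (h : w ≤ w') (h1 : w' < 1) :
    pairBound u w ≤ pairBound u w' := by
  unfold pairBound
  have h3 : 0 < 1 - w' ^ 2 := by nlinarith
  gcongr ?_ * rexp ?_
  · gcongr
  · rw [neg_div, neg_div, neg_le_neg_iff]
    gcongr

namespace IsStdGaussPair

lemma abs_integral_stateSum_gaussPath_le (h : IsStdGaussPair X Y P)
    {F : (ι → κ) → ℝ} {q : ℕ → κ → ℝ → ℝ}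
    (hF : ∀ s, |F s| ≤ 1) (hqm : ∀ a, Measurable (q 1 a)) (hq0 : ∀ t, ∑ a, |q 0 a t| ≤ 1)
    {u : ℝ} (hu : 0 ≤ u) (hq1 : ∀ t < u, ∀ a, q 1 a t = 0)
    (hqI : ∫⁻ t, ENNReal.ofReal (∑ a, |q 1 a t|) ≤ 4) {i j : ι} (hij : i ≠ j) {w : ℝ}
    (hXw : |cov[X i, X j; P]| ≤ w) (hYw : |cov[Y i, Y j; P]| ≤ w) (hw : w < 1) (θ : ℝ) :
    |∫ ω, stateSum F q (Pi.single i 1 + Pi.single j 1) (fun k => gaussPath X Y θ k ω) ∂P|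
      ≤ 16 * pairBound u w := by
  have := h.gauss.isProbabilityMeasure
  set D : ℝ → ℝ≥0∞ := fun t => ENNReal.ofReal (∑ a, |q 1 a t|) with hD
  have hDm : Measurable D := by
    refine ENNReal.measurable_ofReal.comp ?_
    exact Finset.measurable_sum _ fun a _ => (hqm a).abs
  have hD0 : ∀ t < u, D t = 0 := fun t ht => by simp [hD, hq1 t ht]
  have hcov : cov[gaussPath X Y θ i, gaussPath X Y θ j; P]
      = sin θ ^ 2 * cov[X i, X j; P] + cos θ ^ 2 * cov[Y i, Y j; P] := by
    have := h.covariance_comb (sin θ) (cos θ) (sin θ) (cos θ) i j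
    rw [← pow_two, ← pow_two] at this
    exact this
  set ρ := cov[gaussPath X Y θ i, gaussPath X Y θ j; P] with hρ
  have hρw : |ρ| ≤ w := by
    rw [hcov]
    calc _ ≤ |sin θ ^ 2 * cov[X i, X j; P]| + |cos θ ^ 2 * cov[Y i, Y j; P]| := abs_add_le _ _
      _ = sin θ ^ 2 * |cov[X i, X j; P]| + cos θ ^ 2 * |cov[Y i, Y j; P]| := by
        rw [abs_mul, abs_mul, abs_of_nonneg (sq_nonneg (sin θ)), abs_of_nonneg (sq_nonneg (cos θ))]
      _ ≤ sin θ ^ 2 * w + cos θ ^ 2 * w := by gcongr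
      _ = w := by rw [← add_mul, sin_sq_add_cos_sq, one_mul]
  have hpair : HasGaussianLaw (fun ω => (gaussPath X Y θ i ω, gaussPath X Y θ j ω)) P := by
    have h1 := h.hasGaussianLaw_comb (sin θ) (cos θ) (sin θ) (cos θ) i
    let L : (ℝ × (ι → ℝ)) →L[ℝ] (ℝ × ℝ) :=
      ContinuousLinearMap.prod (ContinuousLinearMap.fst ℝ ℝ (ι → ℝ))
        ((ContinuousLinearMap.proj j).comp (ContinuousLinearMap.snd ℝ ℝ (ι → ℝ)))
    exact h1.map_fun L
  have hkey := lintegral_mul_bivariate_gaussian_le hpair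
    (h.map_comb (sin_sq_add_cos_sq θ) i) (h.map_comb (sin_sq_add_cos_sq θ) j) hρ.symm
    (hρw.trans_lt hw) hu hDm hDm hD0 hD0
  have hfin : ∫⁻ ω, D (gaussPath X Y θ i ω) * D (gaussPath X Y θ j ω) ∂P
      ≤ ENNReal.ofReal (16 * pairBound u w) := by
    refine hkey.trans ?_
    have e : (√(1 - ρ ^ 2))⁻¹ * rexp (-u ^ 2 / (1 + |ρ|)) = pairBound u |ρ| := by
      rw [pairBound, sq_abs]
    rw [e, mul_comm 16, ENNReal.ofReal_mul (pairBound_nonneg _ _)]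
    refine mul_le_mul' (ENNReal.ofReal_le_ofReal (pairBound_mono (abs_nonneg _) hρw hw)) ?_
    calc _ ≤ (4 : ℝ≥0∞) * 4 := mul_le_mul' hqI hqI
      _ = ENNReal.ofReal 16 := by norm_num
  rw [← Real.norm_eq_abs]
  refine (norm_integral_le_lintegral_norm _).trans ?_
  refine ENNReal.toReal_le_of_le_ofReal (by have := pairBound_nonneg u w; positivity) ?_
  refine le_trans (lintegral_mono fun ω => ?_) hfin
  rw [← ENNReal.ofReal_mul (Finset.sum_nonneg fun _ _ => abs_nonneg _)]
  exact ENNReal.ofReal_le_ofReal (abs_stateSum_single_add_single_le hF hq0 hij _)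

lemma abs_integral_stateSum_sub_le (h : IsStdGaussPair X Y P)
    {F : (ι → κ) → ℝ} {q : ℕ → κ → ℝ → ℝ}
    (hF : ∀ s, |F s| ≤ 1) (hq : ∀ m a t, HasDerivAt (q m a) (q (m + 1) a t) t)
    (hq0 : ∀ t, ∑ a, |q 0 a t| ≤ 1) {C : ℝ} (hC : ∀ m ≤ 2, ∀ a t, |q m a t| ≤ C)
    {u : ℝ} (hu : 0 ≤ u) (hq1 : ∀ t < u, ∀ a, q 1 a t = 0)
    (hqI : ∫⁻ t, ENNReal.ofReal (∑ a, |q 1 a t|) ≤ 4) {w : ι → ι → ℝ}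
    (hXw : ∀ i j, i ≠ j → |cov[X i, X j; P]| ≤ w i j)
    (hYw : ∀ i j, i ≠ j → |cov[Y i, Y j; P]| ≤ w i j) (hw : ∀ i j, i ≠ j → w i j < 1) :
    |∫ ω, stateSum F q 0 (fun i => X i ω) ∂P - ∫ ω, stateSum F q 0 (fun i => Y i ω) ∂P|
      ≤ (∑ i, ∑ j, |cov[X i, X j; P] - cov[Y i, Y j; P]| * (16 * pairBound u (w i j)))
        * (π / 2) := by
  have hle : ∀ i j k : ι, (Pi.single i 1 + Pi.single j 1 : ι → ℕ) k ≤ 2 := by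
    intro i j k
    simp only [Pi.add_apply, Pi.single_apply]
    split_ifs <;> simp
  refine h.abs_integral_sub_le (G1 := fun i => stateSum F q (Pi.single i 1))
    (G2 := fun i j => stateSum F q (Pi.single i 1 + Pi.single j 1))
    (C := (Fintype.card κ * C) ^ Fintype.card ι)
    (fun z => by simpa using hasFDerivAt_stateSum (F := F) hq 0 z)
    (fun i z => hasFDerivAt_stateSum hq _ z)
    (fun z => abs_stateSum_le_of_le_two hF hC (by simp) z)
    (fun j z => abs_stateSum_le_of_le_two hF hC (fun k => ?_) z)
    (fun i j z => abs_stateSum_le_of_le_two hF hC (hle i j) z)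
    (fun i j => continuous_iff_continuousAt.2 fun z =>
      (hasFDerivAt_stateSum hq _ z).continuousAt) ?_
  · exact le_trans (by simp) (hle j j k)
  · intro θ _ i j hij
    exact h.abs_integral_stateSum_gaussPath_le hF
      (fun a => (continuous_iff_continuousAt.2 fun t => (hq 1 a t).continuousAt).measurable)
      hq0 hu hq1 hqI hij (hXw i j hij) (hYw i j hij) (hw i j hij) θ

end IsStdGaussPair

end Comparison

/-! ### Smooth approximation of exceedance indicators -/

lemma hasDerivAt_iteratedDeriv_smoothTransition (n : ℕ) (t : ℝ) :
    HasDerivAt (iteratedDeriv n smoothTransition) (iteratedDeriv (n + 1) smoothTransition t) t := by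
  rw [iteratedDeriv_succ]
  exact (smoothTransition.contDiff (n := ⊤).differentiable_iteratedDeriv n
    (by exact_mod_cast ENat.natCast_lt_top n) t).hasDerivAt

lemma iteratedDeriv_smoothTransition_of_neg (n : ℕ) {t : ℝ} (ht : t < 0) :
    iteratedDeriv n smoothTransition t = 0 := by
  have : smoothTransition =ᶠ[nhds t] fun _ => (0 : ℝ) := by
    filter_upwards [Iio_mem_nhds ht] with s hs using smoothTransition.zero_of_nonpos hs.le
  rw [this.iteratedDeriv_eq]
  simp

lemma iteratedDeriv_smoothTransition_of_one_lt {n : ℕ} (hn : n ≠ 0) {t : ℝ} (ht : 1 < t) :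
    iteratedDeriv n smoothTransition t = 0 := by
  have : smoothTransition =ᶠ[nhds t] fun _ => (1 : ℝ) := by
    filter_upwards [Ioi_mem_nhds ht] with s hs using smoothTransition.one_of_one_le hs.le
  rw [this.iteratedDeriv_eq]
  simp [iteratedDeriv_const, hn]

lemma exists_abs_iteratedDeriv_smoothTransition_le (n : ℕ) :
    ∃ C, ∀ t, |iteratedDeriv n smoothTransition t| ≤ C := by
  rcases eq_or_ne n 0 with rfl | hn
  · refine ⟨1, fun t => ?_⟩
    rw [iteratedDeriv_zero, abs_of_nonneg (smoothTransition.nonneg t)]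
    exact smoothTransition.le_one t
  · have hc : Continuous (iteratedDeriv n smoothTransition) :=
      continuous_iff_continuousAt.2 fun t =>
        (hasDerivAt_iteratedDeriv_smoothTransition n t).continuousAt
    obtain ⟨C, hC⟩ := (isCompact_Icc (a := (0 : ℝ)) (b := 1)).exists_bound_of_continuousOn
      hc.continuousOn
    refine ⟨max C 0, fun t => ?_⟩
    by_cases h0 : t < 0
    · simp [iteratedDeriv_smoothTransition_of_neg n h0]
    by_cases h1 : 1 < t
    · simp [iteratedDeriv_smoothTransition_of_one_lt hn h1]
    · exact (hC t ⟨not_lt.1 h0, not_lt.1 h1⟩).trans (le_max_left _ _)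

/-- The `n`-th derivative of the smooth step `t ↦ smoothTransition (m (t - c))`. -/
noncomputable def smoothStep (m : ℝ) (c : ℝ) (n : ℕ) (t : ℝ) : ℝ :=
  m ^ n * iteratedDeriv n smoothTransition (m * (t - c))

lemma hasDerivAt_smoothStep (m c : ℝ) (n : ℕ) (t : ℝ) :
    HasDerivAt (smoothStep m c n) (smoothStep m c (n + 1) t) t := by
  have h := (hasDerivAt_iteratedDeriv_smoothTransition n (m * (t - c))).comp t
    (((hasDerivAt_id t).sub_const c).const_mul m)
  refine (h.const_mul (m ^ n)).congr_deriv ?_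
  simp only [smoothStep]
  ring

lemma smoothStep_zero (m c t : ℝ) : smoothStep m c 0 t = smoothTransition (m * (t - c)) := by
  simp [smoothStep]

lemma smoothStep_of_lt {m : ℝ} (hm : 0 < m) {c t : ℝ} (h : t < c) (n : ℕ) :
    smoothStep m c n t = 0 := by
  rw [smoothStep, iteratedDeriv_smoothTransition_of_neg n (mul_neg_of_pos_of_neg hm (by linarith)),
    mul_zero]

lemma smoothStep_one_nonneg {m : ℝ} (hm : 0 < m) (c t : ℝ) : 0 ≤ smoothStep m c 1 t := by
  rw [smoothStep, iteratedDeriv_one]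
  exact mul_nonneg (by positivity) smoothTransition.monotone.deriv_nonneg

lemma tendsto_smoothStep_atTop {m : ℝ} (hm : 0 < m) (c : ℝ) :
    Tendsto (smoothStep m c 0) atTop (nhds 1) := by
  refine tendsto_const_nhds.congr' ?_
  filter_upwards [eventually_ge_atTop (c + 1 / m)] with t ht
  rw [smoothStep_zero, smoothTransition.one_of_one_le]
  have : 1 / m ≤ t - c := by linarith
  rwa [div_le_iff₀ hm, mul_comm] at this

lemma lintegral_smoothStep_one {m : ℝ} (hm : 0 < m) (c : ℝ) :
    ∫⁻ t, ENNReal.ofReal (smoothStep m c 1 t) ≤ 1 := by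
  have h1 := integral_Ioi_of_hasDerivAt_of_nonneg' (a := c) (g := smoothStep m c 0)
    (g' := smoothStep m c 1) (fun t _ => hasDerivAt_smoothStep m c 0 t)
    (fun t _ => smoothStep_one_nonneg hm c t) (tendsto_smoothStep_atTop hm c)
  have h2 := integrableOn_Ioi_deriv_of_nonneg' (a := c) (g := smoothStep m c 0)
    (g' := smoothStep m c 1) (fun t _ => hasDerivAt_smoothStep m c 0 t)
    (fun t _ => smoothStep_one_nonneg hm c t) (tendsto_smoothStep_atTop hm c)
  have h3 : ∫⁻ t, ENNReal.ofReal (smoothStep m c 1 t)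
      = ∫⁻ t in Set.Ici c, ENNReal.ofReal (smoothStep m c 1 t) := by
    rw [← lintegral_indicator measurableSet_Ici]
    refine lintegral_congr fun t => ?_
    by_cases ht : t ∈ Set.Ici c
    · simp [Set.indicator_of_mem ht]
    · rw [Set.indicator_of_notMem ht, smoothStep_of_lt hm (not_le.1 ht), ENNReal.ofReal_zero]
  rw [h3, setLIntegral_congr Ioi_ae_eq_Ici.symm,
    ← ofReal_integral_eq_lintegral_ofReal h2
      (Eventually.of_forall fun t => smoothStep_one_nonneg hm c t), h1, smoothStep_zero]
  simp

lemma tendsto_smoothStep (c t : ℝ) :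
    Tendsto (fun m : ℕ => smoothStep (m + 1) c 0 t) atTop (nhds (if c < t then 1 else 0)) := by
  split_ifs with h
  · refine tendsto_const_nhds.congr' ?_
    obtain ⟨M, hM⟩ := exists_nat_ge (1 / (t - c))
    filter_upwards [eventually_ge_atTop M] with m hm
    rw [smoothStep_zero, smoothTransition.one_of_one_le]
    have h1 : (0 : ℝ) < t - c := by linarith
    rw [← div_le_iff₀ h1]
    have : (M : ℝ) ≤ m := by exact_mod_cast hm
    linarith
  · refine tendsto_const_nhds.congr fun m => ?_
    rw [smoothStep_zero, smoothTransition.zero_of_nonpos]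
    exact mul_nonpos_of_nonneg_of_nonpos (by positivity) (by linarith)

/-- The number of the two levels `y ≤ x` which are exceeded by `t`. -/
noncomputable def levelState (y x t : ℝ) : Fin 3 := if x < t then 2 else if y < t then 1 else 0

lemma measurable_levelState (y x : ℝ) : Measurable (levelState y x) :=
  Measurable.ite measurableSet_Ioi measurable_const
    (Measurable.ite measurableSet_Ioi measurable_const measurable_const)

/-- The derivatives of smooth versions of the indicators of the values of `levelState y x`. -/
noncomputable def stepWeight (m y x : ℝ) (n : ℕ) (a : Fin 3) (t : ℝ) : ℝ :=
  ![(if n = 0 then 1 else 0) - smoothStep m y n t, smoothStep m y n t - smoothStep m x n t,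
    smoothStep m x n t] a

lemma hasDerivAt_stepWeight (m y x : ℝ) (n : ℕ) (a : Fin 3) (t : ℝ) :
    HasDerivAt (stepWeight m y x n a) (stepWeight m y x (n + 1) a t) t := by
  have hy := hasDerivAt_smoothStep m y n t
  have hx := hasDerivAt_smoothStep m x n t
  fin_cases a
  · refine ((hasDerivAt_const t (if n = 0 then (1 : ℝ) else 0)).sub hy).congr_deriv ?_
    simp [stepWeight]
  · exact hy.sub hx
  · exact hx

lemma sum_abs_stepWeight_zero {m : ℝ} (hm : 0 < m) {y x : ℝ} (hyx : y ≤ x) (t : ℝ) :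
    ∑ a, |stepWeight m y x 0 a t| ≤ 1 := by
  have h1 : smoothStep m x 0 t ≤ smoothStep m y 0 t := by
    rw [smoothStep_zero, smoothStep_zero]
    exact smoothTransition.monotone (by gcongr)
  have h2 : 0 ≤ smoothStep m x 0 t := by rw [smoothStep_zero]; exact smoothTransition.nonneg _
  have h3 : smoothStep m y 0 t ≤ 1 := by rw [smoothStep_zero]; exact smoothTransition.le_one _
  rw [Fin.sum_univ_three]
  simp only [stepWeight, if_true, Matrix.cons_val]
  rw [abs_of_nonneg (by linarith), abs_of_nonneg (by linarith), abs_of_nonneg h2]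
  linarith

lemma stepWeight_one_of_lt {m : ℝ} (hm : 0 < m) {y x : ℝ} (hyx : y ≤ x) {t : ℝ} (ht : t < y)
    (a : Fin 3) : stepWeight m y x 1 a t = 0 := by
  fin_cases a <;> simp [stepWeight, smoothStep_of_lt hm ht, smoothStep_of_lt hm (ht.trans_le hyx)]

lemma lintegral_sum_abs_stepWeight_one {m : ℝ} (hm : 0 < m) (y x : ℝ) :
    ∫⁻ t, ENNReal.ofReal (∑ a, |stepWeight m y x 1 a t|) ≤ 4 := by
  have hmeas : ∀ c, Measurable (smoothStep m c 1) := fun c =>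
    (continuous_iff_continuousAt.2 fun t => (hasDerivAt_smoothStep m c 1 t).continuousAt).measurable
  calc ∫⁻ t, ENNReal.ofReal (∑ a, |stepWeight m y x 1 a t|)
      ≤ ∫⁻ t, (2 * ENNReal.ofReal (smoothStep m y 1 t)
          + 2 * ENNReal.ofReal (smoothStep m x 1 t)) := by
        refine lintegral_mono fun t => ?_
        have hy := smoothStep_one_nonneg hm y t
        have hx := smoothStep_one_nonneg hm x t
        have : (2 : ℝ≥0∞) = ENNReal.ofReal 2 := by simp
        rw [this, ← ENNReal.ofReal_mul zero_le_two, ← ENNReal.ofReal_mul zero_le_two,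
          ← ENNReal.ofReal_add (by positivity) (by positivity)]
        refine ENNReal.ofReal_le_ofReal ?_
        rw [Fin.sum_univ_three]
        simp only [stepWeight, one_ne_zero, if_false, Matrix.cons_val, zero_sub, abs_neg]
        have h3 := abs_sub (smoothStep m y 1 t) (smoothStep m x 1 t)
        rw [abs_of_nonneg hy, abs_of_nonneg hx] at *
        linarith
    _ ≤ 2 * 1 + 2 * 1 := by
        rw [lintegral_add_left ((hmeas y).ennreal_ofReal.const_mul 2),
          lintegral_const_mul _ (hmeas y).ennreal_ofReal,
          lintegral_const_mul _ (hmeas x).ennreal_ofReal]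
        gcongr
        · exact lintegral_smoothStep_one hm y
        · exact lintegral_smoothStep_one hm x
    _ = 4 := by norm_num

lemma exists_abs_stepWeight_le (m y x : ℝ) :
    ∃ C, ∀ n ≤ 2, ∀ a t, |stepWeight m y x n a t| ≤ C := by
  choose C hC using exists_abs_iteratedDeriv_smoothTransition_le
  have hs : ∀ n ≤ 2, ∀ c t, |smoothStep m c n t| ≤ ∑ k ∈ Finset.range 3, |m| ^ k * |C k| := by
    intro n hn c t
    rw [smoothStep, abs_mul, abs_pow]
    refine le_trans ?_ (Finset.single_le_sum (f := fun k => |m| ^ k * |C k|)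
      (fun _ _ => by positivity) (Finset.mem_range.2 (Nat.lt_succ_of_le hn)))
    have := (hC n (m * (t - c))).trans (le_abs_self _)
    show |m| ^ n * _ ≤ |m| ^ n * |C n|
    gcongr
  set S := ∑ k ∈ Finset.range 3, |m| ^ k * |C k|
  refine ⟨1 + 2 * S, fun n hn a t => ?_⟩
  have h1 := abs_le.1 (hs n hn y t)
  have h2 := abs_le.1 (hs n hn x t)
  fin_cases a
  · change |(if n = 0 then (1 : ℝ) else 0) - smoothStep m y n t| ≤ _
    rw [abs_le]
    constructor <;> split_ifs <;> linarith
  · change |smoothStep m y n t - smoothStep m x n t| ≤ _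
    rw [abs_le]
    constructor <;> linarith
  · change |smoothStep m x n t| ≤ _
    rw [abs_le]
    constructor <;> linarith

lemma tendsto_stepWeight {y x : ℝ} (hyx : y ≤ x) (a : Fin 3) (t : ℝ) :
    Tendsto (fun m : ℕ => stepWeight (m + 1) y x 0 a t) atTop
      (nhds (if levelState y x t = a then 1 else 0)) := by
  have hy := tendsto_smoothStep y t
  have hx := tendsto_smoothStep x t
  by_cases h1 : x < t
  · have h2 : y < t := hyx.trans_lt h1
    simp only [h1, h2, if_true] at hx hy
    fin_cases a
    · simpa [levelState, stepWeight, h1] using hy.const_sub 1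
    · simpa [levelState, stepWeight, h1] using hy.sub hx
    · simpa [levelState, stepWeight, h1] using hx
  by_cases h2 : y < t
  · simp only [h1, h2, if_true, if_false] at hx hy
    fin_cases a
    · simpa [levelState, stepWeight, h1, h2] using hy.const_sub 1
    · simpa [levelState, stepWeight, h1, h2] using hy.sub hx
    · simpa [levelState, stepWeight, h1, h2] using hx
  · simp only [h1, h2, if_false] at hx hy
    fin_cases a
    · simpa [levelState, stepWeight, h1, h2] using hy.const_sub 1
    · simpa [levelState, stepWeight, h1, h2] using hy.sub hx
    · simpa [levelState, stepWeight, h1, h2] using hx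

section LevelComparison

variable {Ω ι : Type*} [MeasurableSpace Ω] [Fintype ι] {P : Measure Ω} {X Y : ι → Ω → ℝ}

lemma tendsto_stateSum_stepWeight {y x : ℝ} (hyx : y ≤ x) (F : (ι → Fin 3) → ℝ) (z : ι → ℝ) :
    Tendsto (fun m : ℕ => stateSum F (stepWeight (m + 1) y x) 0 z) atTop
      (nhds (F fun i => levelState y x (z i))) := by
  have h : Tendsto (fun m : ℕ => stateSum F (stepWeight (m + 1) y x) 0 z) atTop
      (nhds (∑ s : ι → Fin 3, F s * ∏ k, if levelState y x (z k) = s k then (1 : ℝ) else 0)) :=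
    tendsto_finsetSum _ fun s _ => (tendsto_finsetProd _ fun k _ =>
      tendsto_stepWeight hyx (s k) (z k)).const_mul (F s)
  convert h using 2
  rw [Finset.sum_eq_single fun i => levelState y x (z i)]
  · simp
  · intro s _ hs
    obtain ⟨k, hk⟩ := Function.ne_iff.1 hs
    rw [Finset.prod_eq_zero (Finset.mem_univ k) (if_neg fun h => hk h.symm), mul_zero]
  · simp

lemma tendsto_integral_stateSum_stepWeight [IsProbabilityMeasure P] {y x : ℝ} (hyx : y ≤ x)
    {F : (ι → Fin 3) → ℝ} (hF : ∀ s, |F s| ≤ 1) (hX : ∀ i, AEMeasurable (X i) P) :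
    Tendsto (fun m : ℕ => ∫ ω, stateSum F (stepWeight (m + 1) y x) 0 (fun i => X i ω) ∂P) atTop
      (nhds (∫ ω, F (fun i => levelState y x (X i ω)) ∂P)) := by
  refine tendsto_integral_of_dominated_convergence (fun _ => 1) (fun m => ?_)
    (integrable_const 1) (fun m => Eventually.of_forall fun ω => ?_)
    (Eventually.of_forall fun ω => tendsto_stateSum_stepWeight hyx F _)
  · have hc : Continuous (stateSum F (stepWeight (m + 1) y x) 0) :=
      continuous_iff_continuousAt.2 fun z =>
        (hasFDerivAt_stateSum (hasDerivAt_stepWeight _ _ _) _ z).continuousAt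
    exact (hc.measurable.comp_aemeasurable (aemeasurable_pi_lambda _ hX)).aestronglyMeasurable
  · exact abs_stateSum_le_one hF (sum_abs_stepWeight_zero (by positivity) hyx) _

/-- **Comparison of exceedance patterns**: functions of the exceedances of two levels by two
Gaussian vectors have expectations which differ by at most a sum over pairs of coordinates. -/
lemma IsStdGaussPair.abs_integral_levelState_sub_le (h : IsStdGaussPair X Y P)
    {F : (ι → Fin 3) → ℝ} (hF : ∀ s, |F s| ≤ 1) {y x : ℝ} (hy : 0 ≤ y) (hyx : y ≤ x)
    {w : ι → ι → ℝ} (hXw : ∀ i j, i ≠ j → |cov[X i, X j; P]| ≤ w i j)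
    (hYw : ∀ i j, i ≠ j → |cov[Y i, Y j; P]| ≤ w i j) (hw : ∀ i j, i ≠ j → w i j < 1) :
    |∫ ω, F (fun i => levelState y x (X i ω)) ∂P - ∫ ω, F (fun i => levelState y x (Y i ω)) ∂P|
      ≤ (∑ i, ∑ j, |cov[X i, X j; P] - cov[Y i, Y j; P]| * (16 * pairBound y (w i j)))
        * (π / 2) := by
  have := h.gauss.isProbabilityMeasure
  have hX := tendsto_integral_stateSum_stepWeight (P := P) hyx hF fun i => (h.gaussX i).aemeasurable
  have hY := tendsto_integral_stateSum_stepWeight (P := P) hyx hF fun i => (h.gaussY i).aemeasurable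
  refine le_of_tendsto (hX.sub hY).abs (Eventually.of_forall fun m => ?_)
  have hm : (0 : ℝ) < m + 1 := by positivity
  obtain ⟨C, hC⟩ := exists_abs_stepWeight_le (m + 1) y x
  exact h.abs_integral_stateSum_sub_le hF (hasDerivAt_stepWeight _ _ _)
    (sum_abs_stepWeight_zero hm hyx) hC hy (fun t ht a => stepWeight_one_of_lt hm hyx ht a)
    (lintegral_sum_abs_stepWeight_one hm y x) hXw hYw hw

end LevelComparison

/-! ### Asymptotics of the levels -/

/-- The correction term of the level `un n y`, which equals `a + unCorr n y / a` for
`a = √(2 log n)`. -/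
noncomputable def unCorr (n : ℕ) (y : ℝ) : ℝ := y - (log (log n) + log (4 * π)) / 2

lemma tendsto_log_natCast_atTop : Tendsto (fun n : ℕ => log n) atTop atTop :=
  tendsto_log_atTop.comp tendsto_natCast_atTop_atTop

lemma un_eq {n : ℕ} (hn : 2 ≤ n) (y : ℝ) :
    un n y = √(2 * log n) + unCorr n y / √(2 * log n) := by
  have hL : 0 < log n := log_pos (by exact_mod_cast hn)
  have ha : √(2 * log n) ≠ 0 := by positivity
  rw [un, unCorr]
  field_simp
  ring

lemma un_sq {n : ℕ} (hn : 2 ≤ n) (y : ℝ) :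
    un n y ^ 2 = 2 * log n + 2 * unCorr n y + unCorr n y ^ 2 / (2 * log n) := by
  have hL : 0 < log n := log_pos (by exact_mod_cast hn)
  have ha : √(2 * log n) ≠ 0 := by positivity
  have ha2 : √(2 * log n) ^ 2 = 2 * log n := sq_sqrt (by positivity)
  rw [un_eq hn, add_sq, div_pow, ha2]
  field_simp

lemma exp_neg_unCorr {n : ℕ} (hn : 2 ≤ n) (y : ℝ) :
    rexp (-unCorr n y) = rexp (-y) * √(4 * π * log n) := by
  have hL : 0 < log n := log_pos (by exact_mod_cast hn)
  have h4 : 0 < 4 * π := by positivity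
  have e : -unCorr n y = -y + log (4 * π * log n) / 2 := by
    rw [unCorr, log_mul h4.ne' hL.ne']
    ring
  rw [e, exp_add, ← log_sqrt (by positivity), exp_log (by positivity)]

lemma exp_neg_un_sq_le {n : ℕ} (hn : 2 ≤ n) (y : ℝ) :
    rexp (-un n y ^ 2 / 2) ≤ rexp (-y) * √(4 * π * log n) / n := by
  have hL : 0 < log n := log_pos (by exact_mod_cast hn)
  have hn0 : (0 : ℝ) < n := by positivity
  rw [← exp_neg_unCorr hn]
  calc rexp (-un n y ^ 2 / 2) ≤ rexp (-unCorr n y - log n) := by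
        rw [exp_le_exp, un_sq hn]
        have : 0 ≤ unCorr n y ^ 2 / (2 * log n) := by positivity
        linarith
    _ = _ := by rw [exp_sub, exp_log hn0]

lemma tendsto_unCorr_div_log (y : ℝ) :
    Tendsto (fun n : ℕ => unCorr n y / log n) atTop (nhds 0) := by
  have h1 : Tendsto (fun t : ℝ => log t / t) atTop (nhds 0) :=
    isLittleO_log_id_atTop.tendsto_div_nhds_zero
  have h2 : Tendsto (fun t : ℝ => (y - log (4 * π) / 2) * t⁻¹ - (1 / 2) * (log t / t)) atTop
      (nhds ((y - log (4 * π) / 2) * 0 - (1 / 2) * 0)) :=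
    (tendsto_inv_atTop_zero.const_mul _).sub (h1.const_mul _)
  simp only [mul_zero, sub_zero] at h2
  refine (h2.comp tendsto_log_natCast_atTop).congr fun n => ?_
  simp only [Function.comp, unCorr]
  ring

lemma tendsto_unCorr_sq_div_log (y : ℝ) :
    Tendsto (fun n : ℕ => unCorr n y ^ 2 / log n) atTop (nhds 0) := by
  have h1 : Tendsto (fun t : ℝ => log t ^ 2 / t) atTop (nhds 0) :=
    isLittleO_pow_log_id_atTop.tendsto_div_nhds_zero
  have h1' : Tendsto (fun t : ℝ => log t / t) atTop (nhds 0) :=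
    isLittleO_log_id_atTop.tendsto_div_nhds_zero
  set b := y - log (4 * π) / 2 with hb
  have h2 : Tendsto (fun t : ℝ => b ^ 2 * t⁻¹ - b * (log t / t) + (1 / 4) * (log t ^ 2 / t)) atTop
      (nhds (b ^ 2 * 0 - b * 0 + (1 / 4) * 0)) :=
    ((tendsto_inv_atTop_zero.const_mul _).sub (h1'.const_mul _)).add (h1.const_mul _)
  simp only [mul_zero, sub_zero, add_zero] at h2
  refine (h2.comp tendsto_log_natCast_atTop).congr fun n => ?_
  have : unCorr n y = b - log (log n) / 2 := by rw [unCorr, hb]; ring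
  simp only [Function.comp, this]
  ring

lemma tendsto_un_sq_div_log (y : ℝ) :
    Tendsto (fun n : ℕ => un n y ^ 2 / log n) atTop (nhds 2) := by
  have h1 := (tendsto_unCorr_div_log y).const_mul 2
  have h2 := (tendsto_unCorr_div_log y).pow 2
  have h3 := ((tendsto_const_nhds (x := (2 : ℝ))).add h1).add (h2.const_mul (1 / 2))
  norm_num at h3
  refine h3.congr' ?_
  filter_upwards [eventually_ge_atTop 2] with n hn
  have hL : 0 < log n := log_pos (by exact_mod_cast hn)
  rw [un_sq hn]
  field_simp

lemma tendsto_un_div_sqrt_log (y : ℝ) :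
    Tendsto (fun n : ℕ => un n y / √(log n)) atTop (nhds √2) := by
  have h1 := (tendsto_unCorr_div_log y).const_mul (√2)⁻¹
  have h3 := (tendsto_const_nhds (x := √2)).add h1
  simp only [mul_zero, add_zero] at h3
  refine h3.congr' ?_
  filter_upwards [eventually_ge_atTop 2] with n hn
  have hL : 0 < log n := log_pos (by exact_mod_cast hn)
  have hs : √(log n) ^ 2 = log n := sq_sqrt hL.le
  have hs0 : 0 < √(log n) := sqrt_pos.2 hL
  rw [un_eq hn, sqrt_mul zero_le_two]
  field_simp
  rw [hs]
  ring

lemma tendsto_un_atTop (y : ℝ) : Tendsto (fun n : ℕ => un n y) atTop atTop := by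
  have h1 := tendsto_un_div_sqrt_log y
  have h2 : Tendsto (fun n : ℕ => √(log n)) atTop atTop :=
    tendsto_sqrt_atTop.comp tendsto_log_natCast_atTop
  refine (h1.pos_mul_atTop (by positivity) h2).congr' ?_
  filter_upwards [eventually_ge_atTop 2] with n hn
  have hL : 0 < log n := log_pos (by exact_mod_cast hn)
  have hs0 : 0 < √(log n) := sqrt_pos.2 hL
  field_simp

lemma un_le_un {n : ℕ} {y x : ℝ} (h : y ≤ x) : un n y ≤ un n x := by
  unfold un
  gcongr

/-! ### Summation of the pair bounds -/

lemma sum_log_div_le (n : ℕ) : ∑ k ∈ Finset.Icc 1 n, (log n - log k) ≤ n := by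
  rcases Nat.eq_zero_or_pos n with rfl | hn
  · simp
  have hn0 : (0 : ℝ) < n := by positivity
  have hf : (0 : ℝ) < n.factorial := by positivity
  have h1 : ∑ k ∈ Finset.Icc 1 n, log (k : ℝ) = log n.factorial := by
    rw [← Finset.prod_Ico_id_eq_factorial, Finset.Ico_add_one_right_eq_Icc, Nat.cast_prod, log_prod]
    intro k hk
    have := (Finset.mem_Icc.1 hk).1
    positivity
  have h2 := pow_div_factorial_le_exp (n : ℝ) hn0.le n
  have h3 := log_le_log (by positivity) h2
  rw [log_exp, log_div (by positivity) hf.ne', log_pow] at h3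
  rw [Finset.sum_sub_distrib, h1]
  simpa using h3

lemma tendsto_average_Icc {d : ℕ → ℝ} (hd : Tendsto d atTop (nhds 0)) :
    Tendsto (fun n : ℕ => (∑ k ∈ Finset.Icc 1 n, d k) / n) atTop (nhds 0) := by
  have h1 := ((tendsto_add_atTop_iff_nat 1).2 hd).cesaro
  refine h1.congr fun n => ?_
  rw [div_eq_inv_mul, ← Finset.Ico_succ_right_eq_Icc, Order.succ_eq_add_one,
    Finset.sum_Ico_eq_sum_range]
  simp [add_comm]

lemma pairBound_le_of_le {u w δ : ℝ} (h0 : 0 ≤ w) (h : w ≤ δ) (h1 : δ < 1) :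
    pairBound u w ≤ (√(1 - δ ^ 2))⁻¹ * rexp (-u ^ 2 / 2) ^ (2 / (1 + δ)) := by
  refine (pairBound_mono h0 h h1).trans_eq ?_
  have : 1 + δ ≠ 0 := by linarith
  rw [pairBound, ← exp_mul]
  congr 2
  field_simp

lemma pairBound_le_exp {u w δ : ℝ} (h0 : 0 ≤ w) (h : w ≤ δ) (h1 : δ < 1) :
    pairBound u w ≤ (√(1 - δ ^ 2))⁻¹ * (rexp (-u ^ 2 / 2) ^ 2 * rexp (u ^ 2 * w)) := by
  have h3 : 0 < 1 - δ ^ 2 := by nlinarith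
  rw [pairBound]
  gcongr
  rw [← exp_nat_mul, ← exp_add, exp_le_exp, div_le_iff₀ (by positivity)]
  push_cast
  nlinarith [mul_nonneg (sq_nonneg u) (sq_nonneg w)]

lemma tendsto_rpow_mul_sqrt_log_div_rpow {K a β : ℝ} (hK : 0 ≤ K) (h : a < β) :
    Tendsto (fun n : ℕ => (n : ℝ) ^ a * (K * √(log n) / n) ^ β) atTop (nhds 0) := by
  have h1 : Tendsto (fun t : ℝ => log t ^ (1 / 2 * β) / t ^ (β - a)) atTop (nhds 0) :=
    (isLittleO_log_rpow_rpow_atTop _ (sub_pos.2 h)).tendsto_div_nhds_zero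
  have h2 := (h1.comp tendsto_natCast_atTop_atTop).const_mul (K ^ β)
  rw [mul_zero] at h2
  refine h2.congr' ?_
  filter_upwards [eventually_ge_atTop 2] with n hn
  have hL : 0 < log n := log_pos (by exact_mod_cast hn)
  have hn0 : (0 : ℝ) < n := by positivity
  simp only [Function.comp]
  rw [div_rpow (by positivity) hn0.le, mul_rpow hK (by positivity), rpow_sub hn0, sqrt_eq_rpow,
    ← rpow_mul hL.le]
  have : (n : ℝ) ^ β ≠ 0 := by positivity
  have : (n : ℝ) ^ a ≠ 0 := by positivity
  field_simp

lemma card_filter_le_rpow (n : ℕ) (b : ℝ) (hb : 0 ≤ b) :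
    (((Finset.Icc 1 n).filter fun k : ℕ => (k : ℝ) ≤ b).card : ℝ) ≤ b := by
  refine le_trans ?_ (Nat.floor_le hb)
  have : (Finset.Icc 1 n).filter (fun k : ℕ => (k : ℝ) ≤ b) ⊆ Finset.Icc 1 ⌊b⌋₊ := by
    intro k hk
    rw [Finset.mem_filter, Finset.mem_Icc] at hk
    exact Finset.mem_Icc.2 ⟨hk.1.1, Nat.le_floor hk.2⟩
  have := Finset.card_le_card this
  rw [Nat.card_Icc, Nat.add_sub_cancel] at this
  exact_mod_cast this

/-- For large lags, the contribution of a pair of coordinates is controlled by the rate of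
convergence of `r k * log k`. -/
lemma large_lag_bound {L l r γ M α : ℝ} (hα : 0 < α) (hL : 0 < L) (hlL : l ≤ L) (hαl : α * L ≤ l)
    (hγ : 0 ≤ γ) (hγM : γ ≤ M) (hM : |r * l| ≤ M) (hα1 : α ≤ 1) :
    max |r| |γ / L| ≤ M / (α * L) ∧
      |r - γ / L| * L ≤ |r * l - γ| + M / (α * L) * (L - l) := by
  have hl : 0 < l := lt_of_lt_of_le (by positivity) hαl
  have hM0 : 0 ≤ M := hγ.trans hγM
  have hr : |r| ≤ M / (α * L) := by
    rw [abs_mul, abs_of_pos hl] at hM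
    calc |r| ≤ M / l := by rwa [le_div_iff₀ hl]
      _ ≤ M / (α * L) := by gcongr
  refine ⟨max_le hr ?_, ?_⟩
  · rw [abs_of_nonneg (by positivity)]
    calc γ / L ≤ M / L := by gcongr
      _ ≤ M / (α * L) := by
        gcongr
        exact mul_le_of_le_one_left hL.le hα1
  · have e : |r - γ / L| * L = |(r * l - γ) + r * (L - l)| := by
      rw [← abs_of_pos hL, ← abs_mul, abs_of_pos hL]
      congr 1
      field_simp
      ring
    rw [e]
    refine (abs_add_le _ _).trans ?_
    rw [abs_mul, abs_of_nonneg (sub_nonneg.2 hlL)]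
    gcongr

theorem tendsto_sum_pairBound {r : ℕ → ℝ} {γ δ y : ℝ} (hγ : 0 ≤ γ)
    (hr : Tendsto (fun n : ℕ => r n * log n) atTop (nhds γ))
    (hδ0 : 0 < δ) (hδ1 : δ < 1) (hδ : ∀ k ≥ 1, |r k| ≤ δ) :
    Tendsto (fun n : ℕ => (n : ℝ) * ∑ k ∈ Finset.Icc 1 n,
      |r k - γ / log n| * pairBound (un n y) (max |r k| |γ / log n|)) atTop (nhds 0) := by
  obtain ⟨M, hγM, hM⟩ : ∃ M, γ ≤ M ∧ ∀ k, |r k * log k| ≤ M := by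
    obtain ⟨M, hM⟩ := hr.abs.bddAbove_range
    exact ⟨max γ M, le_max_left _ _, fun k => (hM ⟨k, rfl⟩).trans (le_max_right _ _)⟩
  have hM0 : 0 ≤ M := hγ.trans hγM
  set β := 2 / (1 + δ) with hβ
  have hβ1 : 1 < β := by rw [hβ, lt_div_iff₀ (by positivity)]; linarith
  have hβ2 : β < 2 := by rw [hβ, div_lt_iff₀ (by positivity)]; linarith
  set α := (β - 1) / 2 with hα
  have hα0 : 0 < α := by rw [hα]; linarith
  have hα1 : α ≤ 1 := by rw [hα]; linarith
  set c := (√(1 - δ ^ 2))⁻¹ with hc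
  have hc0 : 0 ≤ c := by positivity
  set K := rexp (-y) * √(4 * π) with hK
  have hK0 : 0 ≤ K := by positivity
  set C := c * K ^ 2 * rexp (3 * (M / α)) with hC
  have hC0 : 0 ≤ C := by positivity
  have hexp : ∀ n : ℕ, 2 ≤ n → rexp (-un n y ^ 2 / 2) ≤ K * √(log n) / n := by
    intro n hn
    refine (exp_neg_un_sq_le hn y).trans_eq ?_
    rw [sqrt_mul (by positivity), hK, mul_assoc]
  have hd : Tendsto (fun k : ℕ => |r k * log k - γ|) atTop (nhds 0) := by
    have := (hr.sub_const γ).abs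
    simpa using this
  have hlim : Tendsto (fun n : ℕ => 2 * c * ((n : ℝ) ^ (1 + α) * (K * √(log n) / n) ^ β)
      + C * ((∑ k ∈ Finset.Icc 1 n, |r k * log k - γ|) / n)
      + C * (M / α) * (log n)⁻¹) atTop (nhds 0) := by
    have h1 := (tendsto_rpow_mul_sqrt_log_div_rpow hK0 (show 1 + α < β by rw [hα]; linarith)).const_mul
      (2 * c)
    have h2 := (tendsto_average_Icc hd).const_mul C
    have h3 := (tendsto_inv_atTop_zero.comp tendsto_log_natCast_atTop).const_mul (C * (M / α))
    simpa using (h1.add h2).add h3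
  have hρ : Tendsto (fun n : ℕ => γ / log n) atTop (nhds 0) :=
    tendsto_const_nhds.div_atTop tendsto_log_natCast_atTop
  refine squeeze_zero' (Eventually.of_forall fun n => mul_nonneg (Nat.cast_nonneg _)
    (Finset.sum_nonneg fun k _ => mul_nonneg (abs_nonneg _) (pairBound_nonneg _ _))) ?_ hlim
  have hρ' : ∀ᶠ n : ℕ in atTop, γ / log n < δ := hρ.eventually_lt_const hδ0
  have hu : ∀ᶠ n : ℕ in atTop, un n y ^ 2 / log n < 3 :=
    (tendsto_un_sq_div_log y).eventually_lt_const (by norm_num)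
  filter_upwards [eventually_ge_atTop 2, hρ', hu] with n hn hρn hun
  have hL : 0 < log n := log_pos (by exact_mod_cast hn)
  have hn0 : (0 : ℝ) < n := by positivity
  have hρ0 : 0 ≤ γ / log n := by positivity
  set S := 2 * (c * (K * √(log n) / n) ^ β) with hS
  have hS0 : 0 ≤ S := by positivity
  have hterm : ∀ k ∈ Finset.Icc 1 n,
      |r k - γ / log n| * pairBound (un n y) (max |r k| |γ / log n|)
        ≤ (if (k : ℝ) ≤ (n : ℝ) ^ α then S else 0)
          + C / n ^ 2 * (|r k * log k - γ| + M / (α * log n) * (log n - log k)) := by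
    intro k hk
    obtain ⟨hk1, hkn⟩ := Finset.mem_Icc.1 hk
    have hk0 : (0 : ℝ) < k := by exact_mod_cast hk1
    have hlog : log k ≤ log n := log_le_log hk0 (by exact_mod_cast hkn)
    have hwδ : max |r k| |γ / log n| ≤ δ :=
      max_le (hδ k hk1) (by rw [abs_of_nonneg hρ0]; exact hρn.le)
    have hw0 : 0 ≤ max |r k| |γ / log n| := (abs_nonneg _).trans (le_max_left _ _)
    have hB0 : 0 ≤ C / n ^ 2 * (|r k * log k - γ| + M / (α * log n) * (log n - log k)) := by
      have := sub_nonneg.2 hlog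
      positivity
    split_ifs with h
    · refine le_add_of_le_of_nonneg ?_ hB0
      refine mul_le_mul ?_ ((pairBound_le_of_le hw0 hwδ hδ1).trans ?_) (pairBound_nonneg _ _)
        zero_le_two
      · refine (abs_sub _ _).trans ?_
        have := hδ k hk1
        rw [abs_of_nonneg hρ0]
        linarith
      · gcongr
        exact hexp n hn
    · rw [zero_add]
      have hαl : α * log n ≤ log k := by
        rw [← log_rpow hn0]
        exact log_le_log (by positivity) (not_le.1 h).le
      obtain ⟨h1, h2⟩ := large_lag_bound hα0 hL hlog hαl hγ hγM (hM k) hα1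
      have h3 : pairBound (un n y) (max |r k| |γ / log n|) ≤ C / n ^ 2 * log n := by
        refine (pairBound_le_exp hw0 hwδ hδ1).trans ?_
        have h4 : un n y ^ 2 * max |r k| |γ / log n| ≤ 3 * (M / α) := by
          rw [div_lt_iff₀ hL] at hun
          calc _ ≤ (3 * log n) * (M / (α * log n)) := by gcongr
            _ = 3 * (M / α) := by field_simp
        calc _ ≤ c * ((K * √(log n) / n) ^ 2 * rexp (3 * (M / α))) := by
              gcongr
              exact hexp n hn
          _ = C / n ^ 2 * log n := by
              rw [div_pow, mul_pow, sq_sqrt hL.le, hC]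
              ring
      calc _ ≤ |r k - γ / log n| * (C / n ^ 2 * log n) := by gcongr
        _ = C / n ^ 2 * (|r k - γ / log n| * log n) := by ring
        _ ≤ _ := by gcongr
  calc _ ≤ (n : ℝ) * ∑ k ∈ Finset.Icc 1 n, ((if (k : ℝ) ≤ (n : ℝ) ^ α then S else 0)
          + C / n ^ 2 * (|r k * log k - γ| + M / (α * log n) * (log n - log k))) := by
        gcongr with k hk
        exact hterm k hk
    _ = n * ((((Finset.Icc 1 n).filter fun k : ℕ => (k : ℝ) ≤ (n : ℝ) ^ α).card : ℝ) * S
        + C / n ^ 2 * (∑ k ∈ Finset.Icc 1 n, |r k * log k - γ|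
          + M / (α * log n) * ∑ k ∈ Finset.Icc 1 n, (log n - log k))) := by
        rw [Finset.sum_add_distrib, ← Finset.sum_filter, Finset.sum_const, nsmul_eq_mul,
          ← Finset.mul_sum, Finset.sum_add_distrib, ← Finset.mul_sum]
    _ ≤ n * ((n : ℝ) ^ α * S + C / n ^ 2 * (∑ k ∈ Finset.Icc 1 n, |r k * log k - γ|
          + M / (α * log n) * n)) := by
        gcongr
        · exact card_filter_le_rpow n _ (by positivity)
        · exact sum_log_div_le n
    _ = _ := by
        rw [hS, rpow_add hn0, rpow_one]
        field_simp
        ring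

/-! ### Gaussian tails -/

/-- The upper tail of the standard normal distribution. -/
noncomputable def gaussTail (t : ℝ) : ℝ := (gaussianReal 0 1).real (Set.Ioi t)

lemma gaussTail_eq (t : ℝ) : gaussTail t = ∫ s in Set.Ioi t, gaussianPDFReal 0 1 s := by
  rw [gaussTail, measureReal_def, gaussianReal_apply_eq_integral _ one_ne_zero,
    ENNReal.toReal_ofReal (integral_nonneg fun s => gaussianPDFReal_nonneg _ _ _)]

lemma tendsto_gaussianPDFReal_std_atTop :
    Tendsto (gaussianPDFReal 0 1) atTop (nhds 0) := by
  have h1 : Tendsto (fun t : ℝ => t ^ 2 / 2) atTop atTop :=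
    (tendsto_pow_atTop two_ne_zero).atTop_div_const two_pos
  have h2 := (tendsto_exp_neg_atTop_nhds_zero.comp h1).const_mul (√(2 * π))⁻¹
  rw [mul_zero] at h2
  refine h2.congr fun t => ?_
  simp only [Function.comp, gaussianPDFReal]
  congr 2
  · simp
  · simp; ring

lemma gaussTail_le {v : ℝ} (hv : 0 < v) : gaussTail v ≤ gaussianPDFReal 0 1 v / v := by
  have h1 := integral_Ioi_of_hasDerivAt_of_nonneg' (a := v) (g := fun t => -gaussianPDFReal 0 1 t)
    (g' := fun t => t * gaussianPDFReal 0 1 t) (l := 0)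
    (fun t _ => (hasDerivAt_gaussianPDFReal_std t).neg.congr_deriv (by ring))
    (fun t ht => mul_nonneg (hv.trans ht).le (gaussianPDFReal_nonneg _ _ _))
    (by simpa using tendsto_gaussianPDFReal_std_atTop.neg)
  rw [gaussTail_eq, le_div_iff₀ hv, ← integral_mul_const]
  calc ∫ t in Set.Ioi v, gaussianPDFReal 0 1 t * v
      ≤ ∫ t in Set.Ioi v, t * gaussianPDFReal 0 1 t := by
        refine setIntegral_mono_on ((integrable_gaussianPDFReal 0 1).mul_const v).integrableOn
          integrable_mul_gaussianPDFReal_std.integrableOn measurableSet_Ioi fun t ht => ?_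
        rw [mul_comm]
        exact mul_le_mul_of_nonneg_right (le_of_lt ht) (gaussianPDFReal_nonneg _ _ _)
    _ = _ := by rw [h1]; ring

lemma le_gaussTail {v : ℝ} (hv : 0 < v) :
    gaussianPDFReal 0 1 v / v * (v ^ 2 / (1 + v ^ 2)) ≤ gaussTail v := by
  set f : ℝ → ℝ := fun t => -(t / (1 + t ^ 2)) * gaussianPDFReal 0 1 t with hf
  set f' : ℝ → ℝ := fun t => (1 - 2 / (1 + t ^ 2) ^ 2) * gaussianPDFReal 0 1 t with hf'
  have hderiv : ∀ t, HasDerivAt f (f' t) t := by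
    intro t
    have h0 : 1 + t ^ 2 ≠ 0 := by positivity
    have h1 : HasDerivAt (fun t : ℝ => t / (1 + t ^ 2))
        ((1 * (1 + t ^ 2) - t * (2 * t)) / (1 + t ^ 2) ^ 2) t := by
      exact ((hasDerivAt_id t).div ((hasDerivAt_pow 2 t).const_add 1) h0).congr_deriv (by simp)
    refine (h1.neg.mul (hasDerivAt_gaussianPDFReal_std t)).congr_deriv ?_
    simp only [hf', Pi.neg_apply]
    field_simp
    ring
  have hle : ∀ t, |f' t| ≤ gaussianPDFReal 0 1 t := by
    intro t
    simp only [hf']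
    rw [abs_mul, abs_of_nonneg (gaussianPDFReal_nonneg 0 1 t)]
    refine mul_le_of_le_one_left (gaussianPDFReal_nonneg _ _ _) ?_
    have h1 : 1 ≤ (1 + t ^ 2) ^ 2 := by nlinarith [sq_nonneg t]
    have h2 : 2 / (1 + t ^ 2) ^ 2 ≤ 2 := div_le_self zero_le_two h1
    have h3 : 0 ≤ 2 / (1 + t ^ 2) ^ 2 := by positivity
    rw [abs_le]
    constructor <;> linarith
  have hint : Integrable f' := by
    refine (integrable_gaussianPDFReal 0 1).mono' ?_ (Eventually.of_forall hle)
    have := measurable_gaussianPDFReal 0 1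
    exact Measurable.aestronglyMeasurable (by fun_prop)
  have hlim : Tendsto f atTop (nhds 0) := by
    refine squeeze_zero_norm (fun t => ?_) tendsto_gaussianPDFReal_std_atTop
    simp only [hf]
    rw [norm_mul, norm_neg, Real.norm_eq_abs, Real.norm_eq_abs,
      abs_of_nonneg (gaussianPDFReal_nonneg 0 1 t)]
    refine mul_le_of_le_one_left (gaussianPDFReal_nonneg _ _ _) ?_
    rw [abs_div, abs_of_pos (show 0 < 1 + t ^ 2 by positivity), div_le_one (by positivity), abs_le]
    constructor <;> nlinarith
  have h1 := integral_Ioi_of_hasDerivAt_of_tendsto' (a := v) (fun t _ => hderiv t)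
    hint.integrableOn hlim
  rw [gaussTail_eq]
  calc _ = ∫ t in Set.Ioi v, f' t := by
        rw [h1]
        simp only [hf]
        field_simp
        ring
    _ ≤ _ := setIntegral_mono hint.integrableOn (integrable_gaussianPDFReal 0 1).integrableOn
        fun t => (le_abs_self _).trans (hle t)

lemma tendsto_natCast_mul_gaussTail {v : ℕ → ℝ} {τ : ℝ} (hv : Tendsto v atTop atTop)
    (h : Tendsto (fun n : ℕ => n * (gaussianPDFReal 0 1 (v n) / v n)) atTop (nhds τ)) :
    Tendsto (fun n : ℕ => n * gaussTail (v n)) atTop (nhds τ) := by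
  have h1 : Tendsto (fun t : ℝ => t ^ 2 / (1 + t ^ 2)) atTop (nhds 1) := by
    have h2 : Tendsto (fun t : ℝ => 1 + t ^ 2) atTop atTop :=
      tendsto_atTop_add_const_left _ _ (tendsto_pow_atTop two_ne_zero)
    have h3 := (tendsto_inv_atTop_zero.comp h2).const_sub 1
    rw [sub_zero] at h3
    refine h3.congr fun t => ?_
    have : 1 + t ^ 2 ≠ 0 := by positivity
    simp only [Function.comp]
    field_simp
    ring
  have h4 := h.mul (h1.comp hv)
  rw [mul_one] at h4
  refine tendsto_of_tendsto_of_tendsto_of_le_of_le' h4 h ?_ ?_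
  · filter_upwards [hv.eventually_gt_atTop 0] with n hn
    simp only [Function.comp]
    rw [mul_assoc]
    exact mul_le_mul_of_nonneg_left (le_gaussTail hn) (Nat.cast_nonneg _)
  · filter_upwards [hv.eventually_gt_atTop 0] with n hn
    exact mul_le_mul_of_nonneg_left (gaussTail_le hn) (Nat.cast_nonneg _)

/-- The level `u` seen by `√(1 - ρ) ξ + √ρ z`. -/
noncomputable def shiftedLevel (u ρ z : ℝ) : ℝ := (u - √ρ * z) / √(1 - ρ)

lemma tendsto_shiftedLevel_atTop (γ x z : ℝ) :
    Tendsto (fun n : ℕ => shiftedLevel (un n x) (γ / log n) z / √(log n)) atTop (nhds √2) := by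
  have hρ : Tendsto (fun n : ℕ => γ / log n) atTop (nhds 0) :=
    tendsto_const_nhds.div_atTop tendsto_log_natCast_atTop
  have hs : Tendsto (fun n : ℕ => √(log n)) atTop atTop :=
    tendsto_sqrt_atTop.comp tendsto_log_natCast_atTop
  have h1 : Tendsto (fun n : ℕ => √(γ / log n) * z / √(log n)) atTop (nhds 0) :=
    Tendsto.div_atTop ((hρ.sqrt).mul_const z) hs
  have h2 := ((tendsto_un_div_sqrt_log x).sub h1).div (hρ.const_sub 1).sqrt (by simp)
  simp only [sub_zero, sqrt_one, div_one] at h2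
  refine h2.congr fun n => ?_
  simp only [shiftedLevel, Pi.div_apply]
  ring

theorem tendsto_mul_gaussTail_shiftedLevel {γ : ℝ} (hγ : 0 ≤ γ) (x z : ℝ) :
    Tendsto (fun n : ℕ => n * gaussTail (shiftedLevel (un n x) (γ / log n) z)) atTop
      (nhds (g γ x z)) := by
  have hρ : Tendsto (fun n : ℕ => γ / log n) atTop (nhds 0) :=
    tendsto_const_nhds.div_atTop tendsto_log_natCast_atTop
  have hs : Tendsto (fun n : ℕ => √(log n)) atTop atTop :=
    tendsto_sqrt_atTop.comp tendsto_log_natCast_atTop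
  set v : ℕ → ℝ := fun n => shiftedLevel (un n x) (γ / log n) z with hv
  have hvs : Tendsto (fun n => v n / √(log n)) atTop (nhds √2) := tendsto_shiftedLevel_atTop γ x z
  have hv_top : Tendsto v atTop atTop := by
    refine (hvs.pos_mul_atTop (by positivity) hs).congr' ?_
    filter_upwards [eventually_ge_atTop 2] with n hn
    have hL : 0 < log n := log_pos (by exact_mod_cast hn)
    have : 0 < √(log n) := sqrt_pos.2 hL
    field_simp
  refine tendsto_natCast_mul_gaussTail hv_top ?_
  have hW : Tendsto (fun n : ℕ => v n ^ 2 / 2 - log n - unCorr n x) atTop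
      (nhds (γ - √2 * √γ * z)) := by
    have h1 := (tendsto_unCorr_sq_div_log x).const_mul (1 / 4)
    have h2 := ((tendsto_un_div_sqrt_log x).mul_const √γ).mul_const z
    have h3 := hρ.mul_const (z ^ 2 / 2)
    have h4 := (tendsto_unCorr_div_log x).const_mul γ
    have h5 := ((((h1.sub h2).add h3).add_const γ).add h4).div (hρ.const_sub 1) (by simp)
    have e : (1 / 4 * 0 - √2 * √γ * z + 0 * (z ^ 2 / 2) + γ + γ * 0) / (1 - 0)
        = γ - √2 * √γ * z := by ring
    rw [e] at h5
    refine h5.congr' ?_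
    filter_upwards [eventually_ge_atTop 2, hρ.eventually_lt_const one_pos] with n hn hρn
    have hL : 0 < log n := log_pos (by exact_mod_cast hn)
    have hρ1 : 0 < 1 - γ / log n := by linarith
    have hsq : √(γ / log n) * √(log n) = √γ := by
      rw [← sqrt_mul (by positivity), div_mul_cancel₀ _ hL.ne']
    have hv2 : v n ^ 2 = (un n x ^ 2 - 2 * (un n x * √(γ / log n)) * z + γ / log n * z ^ 2)
        / (1 - γ / log n) := by
      simp only [hv, shiftedLevel]
      rw [div_pow, sq_sqrt hρ1.le, sub_sq, mul_pow, sq_sqrt (by positivity)]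
      ring
    have hu : un n x * √(γ / log n) = un n x / √(log n) * √γ := by
      rw [← hsq]
      have : 0 < √(log n) := sqrt_pos.2 hL
      field_simp
    simp only [Pi.div_apply]
    rw [hv2, hu, un_sq hn, div_eq_iff hρ1.ne']
    generalize un n x / √(log n) = A
    rw [sub_mul, sub_mul, div_right_comm, div_mul_cancel₀ _ hρ1.ne']
    field_simp
    ring
  have hφ : Tendsto (fun n : ℕ => (√(2 * π))⁻¹ * rexp (-(v n ^ 2 / 2 - log n - unCorr n x))
      * (rexp (-x) * √(4 * π)) * (v n / √(log n))⁻¹) atTop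
      (nhds ((√(2 * π))⁻¹ * rexp (-(γ - √2 * √γ * z)) * (rexp (-x) * √(4 * π)) * (√2)⁻¹)) :=
    (((continuous_exp.continuousAt.tendsto.comp hW.neg).const_mul _).mul_const _).mul
      (hvs.inv₀ (by positivity))
  have e : (√(2 * π))⁻¹ * rexp (-(γ - √2 * √γ * z)) * (rexp (-x) * √(4 * π)) * (√2)⁻¹
      = g γ x z := by
    have h4 : √(4 * π) = √(2 * π) * √2 := by
      rw [← sqrt_mul (by positivity)]
      congr 1
      ring
    have h2 : √(2 * γ) = √2 * √γ := sqrt_mul zero_le_two _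
    have h3 : 0 < √(2 * π) := by positivity
    rw [h4, g, h2, show -x - γ + √2 * √γ * z = -(γ - √2 * √γ * z) + -x by ring, exp_add]
    field_simp
  rw [e] at hφ
  refine hφ.congr' ?_
  filter_upwards [eventually_ge_atTop 2] with n hn
  have hL : 0 < log n := log_pos (by exact_mod_cast hn)
  have hn0 : (0 : ℝ) < n := by positivity
  have hφv : gaussianPDFReal 0 1 (v n) = (√(2 * π))⁻¹ * rexp (-(v n ^ 2 / 2)) := by
    simp only [gaussianPDFReal]
    congr 2
    · simp
    · simp; ring
  have h1 : rexp (-(v n ^ 2 / 2 - log n - unCorr n x)) * rexp (-unCorr n x)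
      = n * rexp (-(v n ^ 2 / 2)) := by
    rw [← exp_add, show -(v n ^ 2 / 2 - log n - unCorr n x) + -unCorr n x
      = log n + -(v n ^ 2 / 2) by ring, exp_add, exp_log hn0]
  rw [exp_neg_unCorr hn, sqrt_mul (by positivity)] at h1
  rw [hφv, inv_div]
  calc _ = (√(2 * π))⁻¹ * (rexp (-(v n ^ 2 / 2 - log n - unCorr n x))
        * (rexp (-x) * (√(4 * π) * √(log n)))) / v n := by ring
    _ = _ := by rw [h1]; ring

/-! ### Trinomial counts -/

/-- The probability that, among `M` independent trials with outcomes `0, 1, 2` where outcome `2`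
has probability `p` and outcome `0` has probability `1 - q`, there are exactly `k` outcomes `2` and
`l` nonzero outcomes. -/
noncomputable def trinomial (M k l : ℕ) (p q : ℝ) : ℝ :=
  M.choose l * l.choose k * (p ^ k * (q - p) ^ (l - k) * (1 - q) ^ (M - l))

section Trinomial

variable {Ω ι : Type*} [MeasurableSpace Ω] {P : Measure Ω}

/-- The state in `Fin 3` of an index for which `A` is the set of indices in state `2` and `A'`
the set of indices in a nonzero state. -/
noncomputable def statePattern (A A' : Finset ι) (i : ι) : Fin 3 :=
  if i ∈ A then 2 else if i ∈ A' then 1 else 0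

lemma filter_eq_iff_statePattern {J A A' : Finset ι} (hA' : A' ⊆ J) (hA : A ⊆ A')
    (s : ι → Fin 3) :
    (J.filter (fun i => s i ≠ 0) = A' ∧ J.filter (fun i => s i = 2) = A)
      ↔ ∀ i ∈ J, s i = statePattern A A' i := by
  constructor
  · rintro ⟨h1, h2⟩ i hi
    have e1 : i ∈ A' ↔ s i ≠ 0 := by rw [← h1]; simp [hi]
    have e2 : i ∈ A ↔ s i = 2 := by rw [← h2]; simp [hi]
    rw [statePattern]
    simp only [e1, e2]
    generalize s i = a
    fin_cases a <;> simp
  · intro h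
    constructor
    · ext i
      rw [Finset.mem_filter]
      constructor
      · rintro ⟨hi, hs⟩
        rw [h i hi, statePattern] at hs
        by_contra hn
        have hn2 : i ∉ A := fun hh => hn (hA hh)
        simp [hn, hn2] at hs
      · intro hi
        refine ⟨hA' hi, ?_⟩
        rw [h i (hA' hi), statePattern]
        split_ifs <;> simp
    · ext i
      rw [Finset.mem_filter]
      constructor
      · rintro ⟨hi, hs⟩
        rw [h i hi, statePattern] at hs
        by_contra hn
        simp only [hn, if_false] at hs
        split_ifs at hs <;> simp at hs
      · intro hi
        refine ⟨hA' (hA hi), ?_⟩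
        rw [h i (hA' (hA hi)), statePattern, if_pos hi]

lemma prod_statePattern {J A A' : Finset ι} (hA' : A' ⊆ J) (hA : A ⊆ A') (p : Fin 3 → ℝ) :
    ∏ i ∈ J, p (statePattern A A' i)
      = p 2 ^ A.card * p 1 ^ (A'.card - A.card) * p 0 ^ (J.card - A'.card) := by
  rw [← Finset.prod_sdiff hA', ← Finset.prod_sdiff hA]
  have h0 : ∏ i ∈ J \ A', p (statePattern A A' i) = p 0 ^ (J.card - A'.card) := by
    rw [← Finset.card_sdiff_of_subset hA', ← Finset.prod_const]
    refine Finset.prod_congr rfl fun i hi => ?_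
    have hi' := (Finset.mem_sdiff.1 hi).2
    have hi2 : i ∉ A := fun h => hi' (hA h)
    simp [statePattern, hi', hi2]
  have h1 : ∏ i ∈ A' \ A, p (statePattern A A' i) = p 1 ^ (A'.card - A.card) := by
    rw [← Finset.card_sdiff_of_subset hA, ← Finset.prod_const]
    refine Finset.prod_congr rfl fun i hi => ?_
    simp [statePattern, (Finset.mem_sdiff.1 hi).2, (Finset.mem_sdiff.1 hi).1]
  have h2 : ∏ i ∈ A, p (statePattern A A' i) = p 2 ^ A.card := by
    rw [← Finset.prod_const]
    exact Finset.prod_congr rfl fun i hi => by simp [statePattern, hi]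
  rw [h0, h1, h2]
  ring

/-- The counting event for independent trials with the same distribution has trinomial
probability. -/
lemma measureReal_counts_eq_trinomial [IsProbabilityMeasure P] {s : ι → Ω → Fin 3}
    (hs : ∀ i, Measurable (s i)) (hind : iIndepFun s P) {p q : ℝ}
    (h2 : ∀ i, P.real {ω | s i ω = 2} = p) (h1 : ∀ i, P.real {ω | s i ω = 1} = q - p)
    (h0 : ∀ i, P.real {ω | s i ω = 0} = 1 - q) (J : Finset ι) {k l : ℕ} :
    P.real {ω | (J.filter (fun i => s i ω = 2)).card = k ∧
      (J.filter (fun i => s i ω ≠ 0)).card = l} = trinomial J.card k l p q := by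
  set I := (J.powersetCard l).sigma (fun A' => A'.powersetCard k) with hI
  have hE : {ω | (J.filter (fun i => s i ω = 2)).card = k ∧
      (J.filter (fun i => s i ω ≠ 0)).card = l}
      = ⋃ A ∈ I, {ω | J.filter (fun i => s i ω ≠ 0) = A.1 ∧ J.filter (fun i => s i ω = 2) = A.2} := by
    ext ω
    simp only [Set.mem_ofPred_eq, Set.mem_iUnion, exists_prop]
    constructor
    · rintro ⟨e1, e2⟩
      refine ⟨⟨J.filter (fun i => s i ω ≠ 0), J.filter (fun i => s i ω = 2)⟩, ?_, rfl, rfl⟩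
      rw [hI, Finset.mem_sigma]
      refine ⟨Finset.mem_powersetCard.2 ⟨Finset.filter_subset _ _, e2⟩,
        Finset.mem_powersetCard.2 ⟨?_, e1⟩⟩
      intro i hi
      rw [Finset.mem_filter] at hi ⊢
      refine ⟨hi.1, ?_⟩
      rw [hi.2]
      simp
    · rintro ⟨A, hA, e1, e2⟩
      rw [hI, Finset.mem_sigma] at hA
      rw [e1, e2]
      exact ⟨(Finset.mem_powersetCard.1 hA.2).2, (Finset.mem_powersetCard.1 hA.1).2⟩
  have hEA : ∀ A ∈ I,
      {ω | J.filter (fun i => s i ω ≠ 0) = A.1 ∧ J.filter (fun i => s i ω = 2) = A.2}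
        = ⋂ i ∈ J, s i ⁻¹' {statePattern A.2 A.1 i} := by
    intro A hA
    rw [hI, Finset.mem_sigma, Finset.mem_powersetCard, Finset.mem_powersetCard] at hA
    ext ω
    rw [Set.mem_ofPred_eq, filter_eq_iff_statePattern hA.1.1 hA.2.1 fun i => s i ω]
    simp
  have hmeas : ∀ A ∈ I, MeasurableSet
      {ω | J.filter (fun i => s i ω ≠ 0) = A.1 ∧ J.filter (fun i => s i ω = 2) = A.2} := by
    intro A hA
    rw [hEA A hA]
    exact Finset.measurableSet_biInter _ fun i _ => hs i (measurableSet_singleton _)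
  rw [hE, measureReal_biUnion_finset _ hmeas]
  · have hval : ∀ A ∈ I, P.real
        {ω | J.filter (fun i => s i ω ≠ 0) = A.1 ∧ J.filter (fun i => s i ω = 2) = A.2}
          = p ^ k * (q - p) ^ (l - k) * (1 - q) ^ (J.card - l) := by
      intro A hA
      rw [hEA A hA]
      rw [hI, Finset.mem_sigma, Finset.mem_powersetCard, Finset.mem_powersetCard] at hA
      rw [measureReal_def, hind.measure_inter_preimage_eq_mul J
        (fun i _ => measurableSet_singleton _), ENNReal.toReal_prod]
      have := prod_statePattern hA.1.1 hA.2.1 ![1 - q, q - p, p]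
      rw [hA.1.2, hA.2.2] at this
      refine Eq.trans (Finset.prod_congr rfl fun i _ => ?_) this
      generalize statePattern A.2 A.1 i = a
      fin_cases a
      · exact h0 i
      · exact h1 i
      · exact h2 i
    rw [Finset.sum_congr rfl hval, Finset.sum_const, hI, Finset.card_sigma, nsmul_eq_mul, trinomial]
    congr 1
    rw [Finset.sum_congr rfl fun A' hA' => by
      rw [Finset.card_powersetCard, (Finset.mem_powersetCard.1 hA').2], Finset.sum_const,
      Finset.card_powersetCard]
    simp
  · intro A _ A₂ _ hne
    refine Set.disjoint_left.2 fun ω hω hω₂ => hne ?_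
    simp only [Set.mem_ofPred_eq] at hω hω₂
    exact Sigma.ext (hω.1.symm.trans hω₂.1) (heq_of_eq (hω.2.symm.trans hω₂.2))

lemma card_filter_coe {α : Type*} (J : Finset α) (Q : α → Prop) [DecidablePred Q]
    [DecidablePred fun i : J => Q i] :
    (Finset.univ.filter fun i : J => Q i).card = (J.filter Q).card := by
  rw [Finset.card_filter, Finset.card_filter, ← Finset.sum_coe_sort J]
  exact Finset.sum_congr rfl fun i _ => by congr

lemma measureReal_counts_pair_eq [IsProbabilityMeasure P] {s : ι → Ω → Fin 3}
    (hs : ∀ i, Measurable (s i)) (hind : iIndepFun s P) {p q : ℝ}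
    (h2 : ∀ i, P.real {ω | s i ω = 2} = p) (h1 : ∀ i, P.real {ω | s i ω = 1} = q - p)
    (h0 : ∀ i, P.real {ω | s i ω = 0} = 1 - q) {J₁ J₂ : Finset ι} (hJ : Disjoint J₁ J₂)
    {k₁ k₂ k₃ k₄ : ℕ} :
    P.real {ω | (J₁.filter (fun i => s i ω = 2)).card = k₁ ∧
      (J₂.filter (fun i => s i ω = 2)).card = k₂ ∧
      (J₁.filter (fun i => s i ω ≠ 0)).card = k₃ ∧ (J₂.filter (fun i => s i ω ≠ 0)).card = k₄}
      = trinomial J₁.card k₁ k₃ p q * trinomial J₂.card k₂ k₄ p q := by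
  rw [← measureReal_counts_eq_trinomial hs hind h2 h1 h0 J₁,
    ← measureReal_counts_eq_trinomial hs hind h2 h1 h0 J₂]
  have hI := hind.indepFun_finset J₁ J₂ hJ hs
  have key := hI.measure_inter_preimage_eq_mul
    {t : J₁ → Fin 3 | (Finset.univ.filter fun i => t i = 2).card = k₁ ∧
      (Finset.univ.filter fun i => t i ≠ 0).card = k₃}
    {t : J₂ → Fin 3 | (Finset.univ.filter fun i => t i = 2).card = k₂ ∧
      (Finset.univ.filter fun i => t i ≠ 0).card = k₄}
    (Set.toFinite _).measurableSet (Set.toFinite _).measurableSet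
  have e : ∀ (J : Finset ι) (k l : ℕ), (fun ω (i : J) => s i ω) ⁻¹'
      {t : J → Fin 3 | (Finset.univ.filter fun i => t i = 2).card = k ∧
        (Finset.univ.filter fun i => t i ≠ 0).card = l}
      = {ω | (J.filter (fun i => s i ω = 2)).card = k ∧
        (J.filter (fun i => s i ω ≠ 0)).card = l} := by
    intro J k l
    ext ω
    simp only [Set.mem_preimage, Set.mem_ofPred_eq]
    rw [card_filter_coe J fun i => s i ω = 2, card_filter_coe J fun i => s i ω ≠ 0]
  rw [e, e] at key
  rw [measureReal_def, measureReal_def, measureReal_def, ← ENNReal.toReal_mul, ← key]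
  congr 2
  ext ω
  simp only [Set.mem_ofPred_eq, Set.mem_inter_iff]
  tauto

end Trinomial

/-! ### Poisson limit -/

section PoissonLimit

variable {α : Type*} {F : Filter α} {N M : α → ℕ} {μ : ℝ}

lemma tendsto_natCast_sub_div (hN : Tendsto N F atTop)
    (hM : Tendsto (fun a => (M a : ℝ) / N a) F (nhds μ)) (l : ℕ) :
    Tendsto (fun a => ((M a - l : ℕ) : ℝ) / N a) F (nhds μ) := by
  have h1 : Tendsto (fun a => (M a : ℝ) / N a - (l : ℝ) / N a) F (nhds μ) := by
    simpa [Function.comp_def] using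
      hM.sub ((tendsto_const_div_atTop_nhds_zero_nat (l : ℝ)).comp hN)
  refine tendsto_of_tendsto_of_tendsto_of_le_of_le h1 hM (fun a => ?_) fun a => ?_
  · rw [← sub_div]
    gcongr
    rw [sub_le_iff_le_add]
    calc (M a : ℝ) ≤ ((M a - l + l : ℕ) : ℝ) := Nat.cast_le.2 le_tsub_add
      _ = _ := Nat.cast_add _ _
  · dsimp only
    gcongr
    exact Nat.sub_le _ _

lemma tendsto_descFactorial_div_pow (hN : Tendsto N F atTop)
    (hM : Tendsto (fun a => (M a : ℝ) / N a) F (nhds μ)) (l : ℕ) :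
    Tendsto (fun a => ((M a).descFactorial l : ℝ) / (N a : ℝ) ^ l) F (nhds (μ ^ l)) := by
  induction l with
  | zero => simpa using tendsto_const_nhds
  | succ l ih =>
    rw [pow_succ']
    refine ((tendsto_natCast_sub_div hN hM l).mul ih).congr fun a => ?_
    rw [Nat.descFactorial_succ, pow_succ', div_mul_div_comm]
    push_cast
    rfl

lemma tendsto_one_sub_pow_exp {q : α → ℝ} {c : ℝ} (hq : Tendsto q F (nhds 0))
    (hN : Tendsto (fun n => N n * q n) F (nhds c)) :
    Tendsto (fun n => (1 - q n) ^ N n) F (nhds (rexp (-c))) := by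
  have hlo : Tendsto (fun n => rexp (-(N n * q n) / (1 - q n))) F (nhds (rexp (-c))) := by
    refine (continuous_exp.tendsto _).comp ?_
    simpa [Pi.div_def] using
      hN.neg.div (tendsto_const_nhds.sub hq) (by norm_num : (1 : ℝ) - 0 ≠ 0)
  have hhi : Tendsto (fun n => rexp (-(N n * q n))) F (nhds (rexp (-c))) :=
    (continuous_exp.tendsto _).comp hN.neg
  have hev : ∀ᶠ n in F, q n < 1 := hq.eventually_lt_const one_pos
  refine tendsto_of_tendsto_of_tendsto_of_le_of_le' hlo hhi ?_ ?_
  · filter_upwards [hev] with n hn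
    have h1 : 0 < 1 - q n := by linarith
    have h2 : rexp (-(q n) / (1 - q n)) ≤ 1 - q n := by
      have h3 := one_sub_inv_le_log_of_pos h1
      rw [← le_log_iff_exp_le h1]
      refine le_trans (le_of_eq ?_) h3
      field_simp
      ring
    calc rexp (-(N n * q n) / (1 - q n)) = rexp (-(q n) / (1 - q n)) ^ N n := by
          rw [← exp_nat_mul]; congr 1; ring
      _ ≤ _ := pow_le_pow_left₀ (exp_pos _).le h2 _
  · filter_upwards [hev] with n hn
    calc (1 - q n) ^ N n ≤ rexp (-(q n)) ^ N n :=
          pow_le_pow_left₀ (by linarith) (one_sub_le_exp_neg _) _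
      _ = _ := by rw [← exp_nat_mul]; congr 1; ring

/-- Trinomial probabilities with success probabilities of order `1 / n` converge to a product of
Poisson weights. -/
lemma tendsto_trinomial {p q : α → ℝ} {τ₁ τ₂ : ℝ} {k l : ℕ} (hkl : k ≤ l)
    (hN : Tendsto N F atTop)
    (hM : Tendsto (fun a => (M a : ℝ) / N a) F (nhds μ))
    (hp : Tendsto (fun a => N a * p a) F (nhds τ₁))
    (hq : Tendsto (fun a => N a * q a) F (nhds τ₂)) :
    Tendsto (fun a => trinomial (M a) k l (p a) (q a)) F
      (nhds ((μ * τ₁) ^ k / (k.factorial : ℝ)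
        * ((μ * (τ₂ - τ₁)) ^ (l - k) / ((l - k).factorial : ℝ)) * rexp (-(μ * τ₂)))) := by
  have hq' : Tendsto q F (nhds 0) := by
    have h := hq.mul ((tendsto_inv_atTop_nhds_zero_nat (𝕜 := ℝ)).comp hN)
    rw [mul_zero] at h
    refine h.congr' ?_
    filter_upwards [hN.eventually_ne_atTop 0] with a ha
    simp only [Function.comp_apply]
    field_simp
  have hMq : Tendsto (fun a => ((M a - l : ℕ) : ℝ) * q a) F (nhds (μ * τ₂)) := by
    refine ((tendsto_natCast_sub_div hN hM l).mul hq).congr' ?_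
    filter_upwards [hN.eventually_ne_atTop 0] with a ha
    field_simp
  have h1 := (((tendsto_descFactorial_div_pow hN hM l).mul
    ((hp.pow k).mul ((hq.sub hp).pow (l - k)))).mul (tendsto_one_sub_pow_exp hq' hMq)).div_const
      ((k.factorial : ℝ) * (l - k).factorial)
  have e : μ ^ l = μ ^ k * μ ^ (l - k) := by rw [← pow_add, Nat.add_sub_cancel' hkl]
  have hlim : μ ^ l * (τ₁ ^ k * (τ₂ - τ₁) ^ (l - k)) * rexp (-(μ * τ₂))
      / ((k.factorial : ℝ) * (l - k).factorial) = (μ * τ₁) ^ k / (k.factorial : ℝ)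
        * ((μ * (τ₂ - τ₁)) ^ (l - k) / ((l - k).factorial : ℝ)) * rexp (-(μ * τ₂)) := by
    rw [e, mul_pow, mul_pow]
    have := k.factorial_ne_zero
    have := (l - k).factorial_ne_zero
    field_simp
  rw [hlim] at h1
  refine h1.congr' ?_
  filter_upwards [hN.eventually_ne_atTop 0] with a ha
  have ha' : (N a : ℝ) ≠ 0 := Nat.cast_ne_zero.2 ha
  have hc : ((M a).choose l * l.choose k : ℝ) * (k.factorial * (l - k).factorial)
      = (M a).descFactorial l := by
    rw [Nat.descFactorial_eq_factorial_mul_choose, ← Nat.choose_mul_factorial_mul_factorial hkl]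
    push_cast
    ring
  have en : (N a : ℝ) ^ l = N a ^ k * N a ^ (l - k) := by rw [← pow_add, Nat.add_sub_cancel' hkl]
  rw [trinomial, ← hc, ← mul_sub, mul_pow, mul_pow, en]
  have := k.factorial_ne_zero
  have := (l - k).factorial_ne_zero
  field_simp

end PoissonLimit

lemma trinomial_nonneg {M k l : ℕ} {p q : ℝ} (hp : 0 ≤ p) (hpq : p ≤ q) (hq : q ≤ 1) :
    0 ≤ trinomial M k l p q := by
  have := sub_nonneg.2 hpq
  have := sub_nonneg.2 hq
  unfold trinomial
  positivity

lemma trinomial_le_one {M k l : ℕ} {p q : ℝ} (hp : 0 ≤ p) (hpq : p ≤ q) (hq : q ≤ 1) :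
    trinomial M k l p q ≤ 1 := by
  have hq' := sub_nonneg.2 hq
  have hpq' := sub_nonneg.2 hpq
  have hq0 : 0 ≤ q := hp.trans hpq
  rcases lt_or_ge M l with h | h
  · simp [trinomial, Nat.choose_eq_zero_of_lt h]
  rcases lt_or_ge l k with h' | h'
  · simp [trinomial, Nat.choose_eq_zero_of_lt h']
  have h1 : (l.choose k : ℝ) * (p ^ k * (q - p) ^ (l - k)) ≤ q ^ l := by
    have e : q ^ l = (p + (q - p)) ^ l := by ring
    rw [e, add_pow]
    refine le_trans (le_of_eq ?_) (Finset.single_le_sum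
      (f := fun m => p ^ m * (q - p) ^ (l - m) * (l.choose m : ℝ)) (fun m _ => by positivity)
      (Finset.mem_range_succ_iff.2 h'))
    ring
  have h2 : (M.choose l : ℝ) * (q ^ l * (1 - q) ^ (M - l)) ≤ 1 := by
    have e : (1 : ℝ) = (q + (1 - q)) ^ M := by ring_nf
    nth_rw 2 [e]
    rw [add_pow]
    refine le_trans (le_of_eq ?_) (Finset.single_le_sum
      (f := fun m => q ^ m * (1 - q) ^ (M - m) * (M.choose m : ℝ)) (fun m _ => by positivity)
      (Finset.mem_range_succ_iff.2 h))
    ring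
  calc trinomial M k l p q
      = M.choose l * ((l.choose k * (p ^ k * (q - p) ^ (l - k))) * (1 - q) ^ (M - l)) := by
        rw [trinomial]; ring
    _ ≤ M.choose l * (q ^ l * (1 - q) ^ (M - l)) := by gcongr
    _ ≤ 1 := h2

/-! ### The equicorrelated Gaussian vector -/

section Equicorrelated

variable {Ω ι : Type*} [MeasurableSpace Ω] [Fintype ι] {P : Measure Ω}

/-- The law of independent standard normal variables indexed by `ι`. -/
noncomputable def stdNormalPi (ι : Type*) [Fintype ι] : Measure (ι → ℝ) :=
  Measure.pi fun _ => gaussianReal 0 1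

instance : IsProbabilityMeasure (stdNormalPi ι) := by
  unfold stdNormalPi
  infer_instance

/-- The equicorrelated vector with coordinates `√(1 - ρ) ξ_i + √ρ z`. -/
noncomputable def equicorr (ρ : ℝ) (i : ι) (e : ℝ × (ι → ℝ)) : ℝ := √(1 - ρ) * e.2 i + √ρ * e.1

lemma iIndepFun_stdNormalPi : iIndepFun (fun (i : ι) (t : ι → ℝ) => t i) (stdNormalPi ι) :=
  iIndepFun_pi (X := fun _ => id) fun _ => aemeasurable_id

lemma hasLaw_stdNormalPi (i : ι) :
    HasLaw (fun t : ι → ℝ => t i) (gaussianReal 0 1) (stdNormalPi ι) :=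
  (measurePreserving_eval (fun _ : ι => gaussianReal 0 1) i).hasLaw

lemma hasGaussianLaw_stdNormalPi :
    HasGaussianLaw (fun t : ι → ℝ => t) (stdNormalPi ι) :=
  iIndepFun.hasGaussianLaw (fun i => (hasLaw_stdNormalPi i).hasGaussianLaw) iIndepFun_stdNormalPi

lemma hasGaussianLaw_prod_stdNormalPi :
    HasGaussianLaw (fun e : ℝ × (ι → ℝ) => (e.1, e.2))
      ((gaussianReal 0 1).prod (stdNormalPi ι)) := by
  refine IndepFun.hasGaussianLaw ?_ ?_ (indepFun_prod measurable_id measurable_id)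
  · exact measurePreserving_fst.hasLaw.hasGaussianLaw
  · have := (hasGaussianLaw_stdNormalPi (ι := ι)).isGaussian_map
    rw [Measure.map_id'] at this
    exact measurePreserving_snd.hasLaw.hasGaussianLaw

lemma hasLaw_equicorr_noise (i : ι) : HasLaw (fun e : ℝ × (ι → ℝ) => e.2 i) (gaussianReal 0 1)
    ((gaussianReal 0 1).prod (stdNormalPi ι)) :=
  ((measurePreserving_eval (fun _ : ι => gaussianReal 0 1) i).comp
    (measurePreserving_snd (μ := gaussianReal 0 1) (ν := stdNormalPi ι))).hasLaw

lemma hasLaw_equicorr_common : HasLaw (fun e : ℝ × (ι → ℝ) => e.1) (gaussianReal 0 1)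
    ((gaussianReal 0 1).prod (stdNormalPi ι)) :=
  measurePreserving_fst.hasLaw

lemma integral_equicorr (ρ : ℝ) (i : ι) :
    ∫ e, equicorr ρ i e ∂((gaussianReal 0 1).prod (stdNormalPi ι)) = 0 := by
  have h1 := (hasLaw_equicorr_noise i).hasGaussianLaw.integrable
  have h2 := (hasLaw_equicorr_common (ι := ι)).hasGaussianLaw.integrable
  unfold equicorr
  rw [integral_add (h1.const_mul _) (h2.const_mul _), integral_const_mul, integral_const_mul,
    (hasLaw_equicorr_noise i).integral_eq, (hasLaw_equicorr_common (ι := ι)).integral_eq,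
    integral_id_gaussianReal]
  simp

lemma covariance_equicorr {ρ : ℝ} (h0 : 0 ≤ ρ) (h1 : ρ ≤ 1) (i j : ι) :
    cov[equicorr ρ i, equicorr ρ j; (gaussianReal 0 1).prod (stdNormalPi ι)]
      = if i = j then 1 else ρ := by
  have hN := fun i : ι => (hasLaw_equicorr_noise i).hasGaussianLaw.memLp_two
  have hC := (hasLaw_equicorr_common (ι := ι)).hasGaussianLaw.memLp_two
  have hCN : ∀ i : ι, cov[fun e : ℝ × (ι → ℝ) => e.1, fun e : ℝ × (ι → ℝ) => e.2 i;
      (gaussianReal 0 1).prod (stdNormalPi ι)] = 0 := fun i =>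
    (indepFun_prod (X := id) (Y := fun t : ι → ℝ => t i) measurable_id
      (measurable_pi_apply i)).covariance_eq_zero hC (hN i)
  have hCC : cov[fun e : ℝ × (ι → ℝ) => e.1, fun e : ℝ × (ι → ℝ) => e.1;
      (gaussianReal 0 1).prod (stdNormalPi ι)] = 1 := by
    rw [covariance_self hC.aemeasurable, hasLaw_equicorr_common.variance_eq,
      variance_id_gaussianReal, NNReal.coe_one]
  have hNN : cov[fun e : ℝ × (ι → ℝ) => e.2 i, fun e : ℝ × (ι → ℝ) => e.2 j;
      (gaussianReal 0 1).prod (stdNormalPi ι)] = if i = j then 1 else 0 := by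
    split_ifs with hij
    · subst hij
      rw [covariance_self (hN i).aemeasurable, (hasLaw_equicorr_noise i).variance_eq,
        variance_id_gaussianReal, NNReal.coe_one]
    · have hs := (measurePreserving_snd (μ := gaussianReal 0 1) (ν := stdNormalPi ι)).hasLaw
      rw [hs.covariance_fun_comp (f := fun t : ι → ℝ => t i) (g := fun t : ι → ℝ => t j)
        (measurable_pi_apply i).aemeasurable (measurable_pi_apply j).aemeasurable]
      exact (iIndepFun_stdNormalPi.indepFun hij).covariance_eq_zero
        (hasLaw_stdNormalPi i).hasGaussianLaw.memLp_two
        (hasLaw_stdNormalPi j).hasGaussianLaw.memLp_two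
  have e : ∀ i : ι, equicorr ρ i = (fun e : ℝ × (ι → ℝ) => √(1 - ρ) * e.2 i)
      + fun e : ℝ × (ι → ℝ) => √ρ * e.1 := fun _ => rfl
  rw [e, e, covariance_add_left ((hN i).const_mul _) (hC.const_mul _)
      (((hN j).const_mul _).add (hC.const_mul _)),
    covariance_add_right ((hN i).const_mul _) ((hN j).const_mul _) (hC.const_mul _),
    covariance_add_right (hC.const_mul _) ((hN j).const_mul _) (hC.const_mul _)]
  simp only [covariance_const_mul_left, covariance_const_mul_right, hCN, hCC, hNN,
    covariance_comm (fun e : ℝ × (ι → ℝ) => e.2 i) (fun e : ℝ × (ι → ℝ) => e.1)]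
  have s1 := Real.mul_self_sqrt h0
  have s2 := Real.mul_self_sqrt (sub_nonneg.2 h1)
  split_ifs <;> linarith

/-- On the product space, a Gaussian vector with standard coordinates and an equicorrelated vector
form a pair of independent Gaussian vectors. -/
lemma isStdGaussPair_equicorr [IsProbabilityMeasure P] {X : ι → Ω → ℝ}
    (hX : ∀ i, Measurable (X i))
    (hG : HasGaussianLaw (fun ω i => X i ω) P) (hm : ∀ i, P[X i] = 0)
    (hv : ∀ i, cov[X i, X i; P] = 1) {ρ : ℝ} (h0 : 0 ≤ ρ) (h1 : ρ ≤ 1) :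
    IsStdGaussPair (fun i (w : Ω × (ℝ × (ι → ℝ))) => X i w.1) (fun i w => equicorr ρ i w.2)
      (P.prod ((gaussianReal 0 1).prod (stdNormalPi ι))) := by
  set Q := (gaussianReal 0 1).prod (stdNormalPi ι)
  have hYm : ∀ i : ι, Measurable (equicorr ρ i) := fun i => by
    unfold equicorr
    fun_prop
  have hL1 := (measurePreserving_fst (μ := P) (ν := Q)).hasLaw
  have hL2 := (measurePreserving_snd (μ := P) (ν := Q)).hasLaw
  have hYG : HasGaussianLaw (fun e (i : ι) => equicorr ρ i e) Q := by
    let L : (ℝ × (ι → ℝ)) →L[ℝ] (ι → ℝ) := ContinuousLinearMap.pi fun i =>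
      √(1 - ρ) • (ContinuousLinearMap.proj i).comp (ContinuousLinearMap.snd ℝ ℝ (ι → ℝ))
        + √ρ • ContinuousLinearMap.fst ℝ ℝ (ι → ℝ)
    exact hasGaussianLaw_prod_stdNormalPi.map_fun L
  have hG1 : HasGaussianLaw (fun (w : Ω × (ℝ × (ι → ℝ))) i => X i w.1) (P.prod Q) := by
    constructor
    have := hG.isGaussian_map
    have e := Measure.map_map (μ := P.prod Q) (measurable_pi_iff.2 hX) measurable_fst
    rw [hL1.map_eq] at e
    exact e ▸ this
  have hG2 : HasGaussianLaw (fun (w : Ω × (ℝ × (ι → ℝ))) i => equicorr ρ i w.2) (P.prod Q) := by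
    constructor
    have := hYG.isGaussian_map
    have e := Measure.map_map (μ := P.prod Q) (measurable_pi_iff.2 hYm) measurable_snd
    rw [hL2.map_eq] at e
    exact e ▸ this
  constructor
  · exact IndepFun.hasGaussianLaw hG1 hG2
      (indepFun_prod (measurable_pi_iff.2 hX) (measurable_pi_iff.2 hYm))
  · exact fun i j => (indepFun_prod (hX i) (hYm j)).covariance_eq_zero
      (hG1.eval i).memLp_two (hG2.eval j).memLp_two
  · intro i
    rw [← hm i]
    exact hL1.integral_comp (hX i).aestronglyMeasurable
  · intro i
    rw [← integral_equicorr ρ i]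
    exact hL2.integral_comp (hYm i).aestronglyMeasurable
  · intro i
    rw [hL1.covariance_fun_comp (hX i).aemeasurable (hX i).aemeasurable, hv]
  · intro i
    rw [hL2.covariance_fun_comp (hYm i).aemeasurable (hYm i).aemeasurable,
      covariance_equicorr h0 h1, if_pos rfl]

/-- Comparison of the joint level states of a standardized Gaussian vector with those of an
equicorrelated one. -/
lemma abs_integral_levelState_sub_equicorr_le [IsProbabilityMeasure P] {X : ι → Ω → ℝ}
    (hX : ∀ i, Measurable (X i))
    (hG : HasGaussianLaw (fun ω i => X i ω) P) (hm : ∀ i, P[X i] = 0)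
    (hv : ∀ i, cov[X i, X i; P] = 1) {ρ : ℝ} (h0 : 0 ≤ ρ) (h1 : ρ < 1)
    (hX1 : ∀ i j, i ≠ j → |cov[X i, X j; P]| < 1)
    {F : (ι → Fin 3) → ℝ} (hF : ∀ s, |F s| ≤ 1) {y x : ℝ} (hy : 0 ≤ y) (hyx : y ≤ x) :
    |∫ ω, F (fun i => levelState y x (X i ω)) ∂P
      - ∫ z, ∫ t, F (fun i => levelState y x (equicorr ρ i (z, t))) ∂(stdNormalPi ι)
        ∂(gaussianReal 0 1)|
      ≤ (∑ i, ∑ j, if i = j then 0 else |cov[X i, X j; P] - ρ|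
          * (16 * pairBound y (max |cov[X i, X j; P]| ρ))) * (π / 2) := by
  have h := isStdGaussPair_equicorr hX hG hm hv h0 h1.le
  set Q := (gaussianReal 0 1).prod (stdNormalPi ι)
  have hYm : ∀ i : ι, Measurable (equicorr ρ i) := fun i => by
    unfold equicorr
    fun_prop
  have hL1 := (measurePreserving_fst (μ := P) (ν := Q)).hasLaw
  have hL2 := (measurePreserving_snd (μ := P) (ν := Q)).hasLaw
  have c1 : ∀ i j, cov[fun w => X i w.1, fun w => X j w.1; P.prod Q] = cov[X i, X j; P] :=
    fun i j => hL1.covariance_fun_comp (hX i).aemeasurable (hX j).aemeasurable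
  have c2 : ∀ i j : ι, cov[fun w => equicorr ρ i w.2, fun w => equicorr ρ j w.2; P.prod Q]
      = if i = j then 1 else ρ := fun i j => by
    rw [hL2.covariance_fun_comp (hYm i).aemeasurable (hYm j).aemeasurable,
      covariance_equicorr h0 h1.le]
  have hFm : Measurable F := measurable_of_finite F
  have key := h.abs_integral_levelState_sub_le hF hy hyx
    (w := fun i j => max |cov[X i, X j; P]| ρ)
    (fun i j _ => by rw [c1]; exact le_max_left _ _)
    (fun i j hij => by rw [c2, if_neg hij, abs_of_nonneg h0]; exact le_max_right _ _)
    (fun i j hij => max_lt (hX1 i j hij) h1)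
  have e1 : ∫ w, F (fun i => levelState y x (X i w.1)) ∂(P.prod Q)
      = ∫ ω, F (fun i => levelState y x (X i ω)) ∂P :=
    hL1.integral_comp (f := fun ω => F (fun i => levelState y x (X i ω)))
      (hFm.comp (measurable_pi_iff.2 fun i =>
        (measurable_levelState y x).comp (hX i))).aestronglyMeasurable
  have hm2 : Measurable fun e : ℝ × (ι → ℝ) => F (fun i => levelState y x (equicorr ρ i e)) :=
    hFm.comp (measurable_pi_iff.2 fun i => (measurable_levelState y x).comp (hYm i))
  have e2 : ∫ w, F (fun i => levelState y x (equicorr ρ i w.2)) ∂(P.prod Q)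
      = ∫ z, ∫ t, F (fun i => levelState y x (equicorr ρ i (z, t))) ∂(stdNormalPi ι)
        ∂(gaussianReal 0 1) := by
    rw [← integral_prod (fun e : ℝ × (ι → ℝ) => F (fun i => levelState y x (equicorr ρ i e)))
      (Integrable.of_bound hm2.aestronglyMeasurable 1 (ae_of_all _ fun e => hF _))]
    exact hL2.integral_comp (f := fun e => F (fun i => levelState y x (equicorr ρ i e)))
      hm2.aestronglyMeasurable
  rw [e1, e2] at key
  refine key.trans (mul_le_mul_of_nonneg_right ?_ (by positivity))
  refine Finset.sum_le_sum fun i _ => Finset.sum_le_sum fun j _ => ?_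
  rw [c1, c2]
  split_ifs with hij
  · subst hij
    simp [hv]
  · exact le_rfl

end Equicorrelated

/-! ### Exceedance counts of the equicorrelated vector -/

lemma gaussTail_antitone : Antitone gaussTail := fun _ _ h =>
  measureReal_mono (Set.Ioi_subset_Ioi h)

lemma gaussTail_nonneg (t : ℝ) : 0 ≤ gaussTail t := measureReal_nonneg

lemma gaussTail_le_one (t : ℝ) : gaussTail t ≤ 1 := measureReal_le_one

lemma lt_equicorr_iff {ρ : ℝ} (hρ : ρ < 1) (u z s : ℝ) :
    u < √(1 - ρ) * s + √ρ * z ↔ shiftedLevel u ρ z < s := by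
  rw [shiftedLevel, div_lt_iff₀ (Real.sqrt_pos.2 (sub_pos.2 hρ)), sub_lt_iff_lt_add, mul_comm s]

lemma levelState_equicorr {ι : Type*} {ρ : ℝ} (hρ : ρ < 1) (y x z : ℝ) (t : ι → ℝ) (i : ι) :
    levelState y x (equicorr ρ i (z, t))
      = levelState (shiftedLevel y ρ z) (shiftedLevel x ρ z) (t i) := by
  simp only [levelState, equicorr, lt_equicorr_iff hρ]

lemma shiftedLevel_le_shiftedLevel {y x : ℝ} (h : y ≤ x) (ρ z : ℝ) :
    shiftedLevel y ρ z ≤ shiftedLevel x ρ z :=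
  div_le_div_of_nonneg_right (by linarith) (Real.sqrt_nonneg _)

lemma levelState_eq_two_iff {y x t : ℝ} : levelState y x t = 2 ↔ x < t := by
  unfold levelState
  split_ifs <;> simp [*]

lemma levelState_eq_zero_iff {y x t : ℝ} (h : y ≤ x) : levelState y x t = 0 ↔ t ≤ y := by
  unfold levelState
  split_ifs with h1 h2
  · simpa using h.trans_lt h1
  · simpa using h2
  · simpa using h2

lemma levelState_ne_zero_iff {y x t : ℝ} (h : y ≤ x) : levelState y x t ≠ 0 ↔ y < t := by
  rw [Ne, levelState_eq_zero_iff h, not_le]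

lemma levelState_eq_one_iff {y x t : ℝ} : levelState y x t = 1 ↔ y < t ∧ t ≤ x := by
  unfold levelState
  split_ifs with h1 h2
  · simpa using fun _ => h1
  · simpa [h2] using h1
  · simpa using fun h => absurd h h2

section Counts

variable {ι : Type*}

/-- The indicator of the event that there are `k₁`, `k₂` indices in state `2` and `k₃`, `k₄`
indices in a nonzero state among `J₁`, `J₂` respectively. -/
noncomputable def countIndicator (J₁ J₂ : Finset ι) (k₁ k₂ k₃ k₄ : ℕ) (s : ι → Fin 3) : ℝ :=
  if (J₁.filter (fun i => s i = 2)).card = k₁ ∧ (J₂.filter (fun i => s i = 2)).card = k₂ ∧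
    (J₁.filter (fun i => s i ≠ 0)).card = k₃ ∧ (J₂.filter (fun i => s i ≠ 0)).card = k₄ then 1
  else 0

lemma abs_countIndicator_le (J₁ J₂ : Finset ι) (k₁ k₂ k₃ k₄ : ℕ) (s : ι → Fin 3) :
    |countIndicator J₁ J₂ k₁ k₂ k₃ k₄ s| ≤ 1 := by
  unfold countIndicator
  split_ifs <;> simp

lemma integral_countIndicator_equicorr [Fintype ι] {ρ y x : ℝ} (hρ : ρ < 1) (hyx : y ≤ x) (z : ℝ)
    {J₁ J₂ : Finset ι} (hJ : Disjoint J₁ J₂) (k₁ k₂ k₃ k₄ : ℕ) :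
    ∫ t, countIndicator J₁ J₂ k₁ k₂ k₃ k₄ (fun i => levelState y x (equicorr ρ i (z, t)))
        ∂(stdNormalPi ι)
      = trinomial J₁.card k₁ k₃ (gaussTail (shiftedLevel x ρ z)) (gaussTail (shiftedLevel y ρ z))
        * trinomial J₂.card k₂ k₄ (gaussTail (shiftedLevel x ρ z))
          (gaussTail (shiftedLevel y ρ z)) := by
  simp only [levelState_equicorr hρ]
  set u := shiftedLevel y ρ z
  set v := shiftedLevel x ρ z
  have huv : u ≤ v := shiftedLevel_le_shiftedLevel hyx ρ z
  have hs : ∀ i : ι, Measurable fun t : ι → ℝ => levelState u v (t i) := fun i =>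
    (measurable_levelState u v).comp (measurable_pi_apply i)
  have hlaw : ∀ (i : ι) (S : Set ℝ), MeasurableSet S →
      (stdNormalPi ι).real {t | t i ∈ S} = (gaussianReal 0 1).real S := fun i S hS => by
    rw [← (hasLaw_stdNormalPi i).map_eq, map_measureReal_apply (measurable_pi_apply i) hS]
    rfl
  have h2 : ∀ i : ι, (stdNormalPi ι).real {t | levelState u v (t i) = 2} = gaussTail v := by
    intro i
    simp only [levelState_eq_two_iff]
    exact hlaw i (Set.Ioi v) measurableSet_Ioi
  have h0 : ∀ i : ι, (stdNormalPi ι).real {t | levelState u v (t i) = 0} = 1 - gaussTail u := by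
    intro i
    simp only [levelState_eq_zero_iff huv]
    rw [gaussTail, ← probReal_compl_eq_one_sub measurableSet_Ioi, Set.compl_Ioi]
    exact hlaw i (Set.Iic u) measurableSet_Iic
  have h1 : ∀ i : ι, (stdNormalPi ι).real {t | levelState u v (t i) = 1}
      = gaussTail u - gaussTail v := by
    intro i
    simp only [levelState_eq_one_iff]
    rw [gaussTail, gaussTail, ← measureReal_sdiff (Set.Ioi_subset_Ioi huv) measurableSet_Ioi]
    have e : Set.Ioi u \ Set.Ioi v = Set.Ioc u v := by
      ext t
      simp
    rw [e]
    exact hlaw i (Set.Ioc u v) measurableSet_Ioc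
  have hind : iIndepFun (fun (i : ι) (t : ι → ℝ) => levelState u v (t i)) (stdNormalPi ι) :=
    iIndepFun_stdNormalPi.comp (fun _ => levelState u v) fun _ => measurable_levelState u v
  rw [← measureReal_counts_pair_eq hs hind h2 h1 h0 hJ]
  have hset : MeasurableSet {t : ι → ℝ | (J₁.filter (fun i => levelState u v (t i) = 2)).card = k₁ ∧
      (J₂.filter (fun i => levelState u v (t i) = 2)).card = k₂ ∧
      (J₁.filter (fun i => levelState u v (t i) ≠ 0)).card = k₃ ∧
      (J₂.filter (fun i => levelState u v (t i) ≠ 0)).card = k₄} :=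
    measurableSet_preimage (measurable_pi_iff.2 hs)
      (Set.toFinite {s : ι → Fin 3 | (J₁.filter (fun i => s i = 2)).card = k₁ ∧
        (J₂.filter (fun i => s i = 2)).card = k₂ ∧
        (J₁.filter (fun i => s i ≠ 0)).card = k₃ ∧
        (J₂.filter (fun i => s i ≠ 0)).card = k₄}).measurableSet
  rw [← integral_indicator_one hset]
  refine integral_congr_ae (ae_of_all _ fun t => ?_)
  simp only [countIndicator, Set.indicator_apply, Set.mem_ofPred_eq, Pi.one_apply]

lemma measurable_gaussTail : Measurable gaussTail := gaussTail_antitone.measurable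

lemma measurable_gaussTail_shiftedLevel (u ρ : ℝ) :
    Measurable fun z => gaussTail (shiftedLevel u ρ z) := by
  refine measurable_gaussTail.comp ?_
  unfold shiftedLevel
  fun_prop

end Counts

/-! ### Stationary Gaussian sequences -/

section Stationary

variable {Ω : Type*} [MeasurableSpace Ω] {P : Measure Ω} {X : ℕ → Ω → ℝ}

/-- A stationary sequence `X 1, X 2, …` of jointly Gaussian standard normal variables. -/
structure IsStationaryGaussian (X : ℕ → Ω → ℝ) (P : Measure Ω) : Prop where
  measurable : ∀ n, Measurable (X n)
  gauss : ∀ (m : ℕ) (idx : Fin m → ℕ) (c : Fin m → ℝ), ∃ v : ℝ≥0,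
    Measure.map (fun ω => ∑ i, c i * X (idx i) ω) P = gaussianReal 0 v
  std : ∀ n, Measure.map (X n) P = gaussianReal 0 1
  stat : ∀ m k : ℕ, Measure.map (fun ω => fun i : Fin m => X (i.1 + 1 + k) ω) P =
    Measure.map (fun ω => fun i : Fin m => X (i.1 + 1) ω) P

/-- The correlation at lag `k`. -/
noncomputable def lagCorr (X : ℕ → Ω → ℝ) (P : Measure Ω) (k : ℕ) : ℝ :=
  ∫ ω, X 1 ω * X (k + 1) ω ∂P

namespace IsStationaryGaussian

lemma hasLaw (h : IsStationaryGaussian X P) (n : ℕ) : HasLaw (X n) (gaussianReal 0 1) P :=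
  ⟨(h.measurable n).aemeasurable, h.std n⟩

lemma memLp_two (h : IsStationaryGaussian X P) (n : ℕ) : MemLp (X n) 2 P :=
  (h.hasLaw n).hasGaussianLaw.memLp_two

lemma integral_eq_zero (h : IsStationaryGaussian X P) (n : ℕ) : P[X n] = 0 := by
  rw [(h.hasLaw n).integral_eq, integral_id_gaussianReal]

lemma integral_mul_self [IsProbabilityMeasure P] (h : IsStationaryGaussian X P) (n : ℕ) :
    ∫ ω, X n ω * X n ω ∂P = 1 := by
  have h1 := covariance_eq_sub (h.memLp_two n) (h.memLp_two n)
  rw [covariance_self (h.measurable n).aemeasurable, (h.hasLaw n).variance_eq,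
    variance_id_gaussianReal, h.integral_eq_zero] at h1
  simpa using h1.symm

lemma covariance_eq [IsProbabilityMeasure P] (h : IsStationaryGaussian X P) (i j : ℕ) :
    cov[X i, X j; P] = ∫ ω, X i ω * X j ω ∂P := by
  rw [covariance_eq_sub (h.memLp_two i) (h.memLp_two j), h.integral_eq_zero]
  simp

lemma integral_mul_shift (h : IsStationaryGaussian X P) (k l : ℕ) :
    ∫ ω, X (k + 1) ω * X (k + 1 + l) ω ∂P = lagCorr X P l := by
  have hf : Measurable fun t : Fin (l + 1) → ℝ => t 0 * t (Fin.last l) := by fun_prop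
  have e : ∀ k : ℕ, ∫ t, t 0 * t (Fin.last l)
      ∂(Measure.map (fun ω => fun i : Fin (l + 1) => X (i.1 + 1 + k) ω) P)
      = ∫ ω, X (k + 1) ω * X (k + 1 + l) ω ∂P := fun k => by
    rw [integral_map (measurable_pi_iff.2 fun i => h.measurable _).aemeasurable
      hf.aestronglyMeasurable]
    have e1 : ((0 : Fin (l + 1)) : ℕ) + 1 + k = k + 1 := by simp [add_comm]
    have e2 : (Fin.last l : ℕ) + 1 + k = k + 1 + l := by simp; ring
    simp only [e1, e2]
  rw [← e k, h.stat, ← h.stat _ 0, e 0, lagCorr, zero_add, add_comm 1 l]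

lemma integral_mul_eq_lagCorr (h : IsStationaryGaussian X P) {i j : ℕ} (hi : 1 ≤ i)
    (hij : i ≤ j) : ∫ ω, X i ω * X j ω ∂P = lagCorr X P (j - i) := by
  rw [← h.integral_mul_shift (i - 1) (j - i)]
  have e1 : i - 1 + 1 = i := by omega
  have e2 : i - 1 + 1 + (j - i) = j := by omega
  rw [e2, e1]

lemma covariance_eq_lagCorr [IsProbabilityMeasure P] (h : IsStationaryGaussian X P) {i j : ℕ}
    (hi : 1 ≤ i) (hj : 1 ≤ j) : cov[X i, X j; P] = lagCorr X P (max i j - min i j) := by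
  rcases le_total i j with hij | hij
  · rw [h.covariance_eq, h.integral_mul_eq_lagCorr hi hij, max_eq_right hij, min_eq_left hij]
  · rw [covariance_comm, h.covariance_eq, h.integral_mul_eq_lagCorr hj hij, max_eq_left hij,
      min_eq_right hij]

lemma integral_sub_mul_sq [IsProbabilityMeasure P] (h : IsStationaryGaussian X P) (s : ℝ)
    (m k : ℕ) :
    ∫ ω, (X (m + 1 + k) ω - s * X (m + 1) ω) ^ 2 ∂P = 1 + s ^ 2 - 2 * s * lagCorr X P k := by
  have hI : ∀ i j, Integrable (fun ω => X i ω * X j ω) P := fun i j =>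
    (h.memLp_two i).integrable_mul (h.memLp_two j)
  have e : ∀ ω, (X (m + 1 + k) ω - s * X (m + 1) ω) ^ 2 = X (m + 1 + k) ω * X (m + 1 + k) ω
      + s ^ 2 * (X (m + 1) ω * X (m + 1) ω) - 2 * s * (X (m + 1) ω * X (m + 1 + k) ω) :=
    fun ω => by ring
  simp_rw [e]
  have hA : Integrable (fun ω => X (m + 1 + k) ω * X (m + 1 + k) ω
      + s ^ 2 * (X (m + 1) ω * X (m + 1) ω)) P := (hI _ _).add ((hI _ _).const_mul _)
  rw [integral_sub hA ((hI _ _).const_mul _),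
    integral_add (hI _ _) ((hI _ _).const_mul _), integral_const_mul, integral_const_mul,
    h.integral_mul_self, h.integral_mul_self, h.integral_mul_shift]
  ring

lemma abs_lagCorr_le_one [IsProbabilityMeasure P] (h : IsStationaryGaussian X P) (k : ℕ) :
    |lagCorr X P k| ≤ 1 := by
  have h1 := h.integral_sub_mul_sq 1 0 k
  have h2 := h.integral_sub_mul_sq (-1) 0 k
  have h3 : 0 ≤ ∫ ω, (X (0 + 1 + k) ω - 1 * X (0 + 1) ω) ^ 2 ∂P :=
    integral_nonneg fun ω => sq_nonneg _
  have h4 : 0 ≤ ∫ ω, (X (0 + 1 + k) ω - -1 * X (0 + 1) ω) ^ 2 ∂P :=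
    integral_nonneg fun ω => sq_nonneg _
  rw [abs_le]
  constructor <;> linarith

lemma abs_lagCorr_add_of_abs_eq_one [IsProbabilityMeasure P] (h : IsStationaryGaussian X P)
    {k : ℕ} (hk : |lagCorr X P k| = 1) (m : ℕ) :
    |lagCorr X P (m + k)| = |lagCorr X P m| := by
  set s := lagCorr X P k with hs
  have hs2 : s ^ 2 = 1 := by rw [← sq_abs, hk]; norm_num
  have h1 := h.integral_sub_mul_sq s m k
  rw [← hs] at h1
  have h2 : ∫ ω, (X (m + 1 + k) ω - s * X (m + 1) ω) ^ 2 ∂P = 0 := by rw [h1]; nlinarith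
  have hi : Integrable (fun ω => (X (m + 1 + k) ω - s * X (m + 1) ω) ^ 2) P :=
    ((h.memLp_two _).sub ((h.memLp_two _).const_mul s)).integrable_sq
  rw [integral_eq_zero_iff_of_nonneg (fun ω => sq_nonneg _) hi] at h2
  have h3 : lagCorr X P (m + k) = s * lagCorr X P m := by
    unfold lagCorr
    rw [← integral_const_mul]
    refine integral_congr_ae ?_
    filter_upwards [h2] with ω hω
    have h4 : X (m + 1 + k) ω - s * X (m + 1) ω = 0 := pow_eq_zero_iff two_ne_zero |>.1 hω
    have e : m + k + 1 = m + 1 + k := by ring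
    rw [e, sub_eq_zero.1 h4]
    ring
  rw [h3, abs_mul, hk, one_mul]

lemma abs_lagCorr_lt_one [IsProbabilityMeasure P] (h : IsStationaryGaussian X P)
    (hr : Tendsto (lagCorr X P) atTop (nhds 0)) {k : ℕ} (hk : 1 ≤ k) : |lagCorr X P k| < 1 := by
  refine lt_of_le_of_ne (h.abs_lagCorr_le_one k) fun h1 => ?_
  have h2 : ∀ j : ℕ, |lagCorr X P ((j + 1) * k)| = 1 := by
    intro j
    induction j with
    | zero => simpa using h1
    | succ j ih =>
      rw [add_mul _ 1 k, one_mul, h.abs_lagCorr_add_of_abs_eq_one h1, ih]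
  have h3 : Tendsto (fun j : ℕ => (j + 1) * k) atTop atTop :=
    (tendsto_add_atTop_nat 1).atTop_mul_const' hk
  have h4 := (hr.comp h3).abs
  simp only [Function.comp_def, h2, abs_zero] at h4
  exact one_ne_zero (tendsto_nhds_unique tendsto_const_nhds h4)

lemma exists_abs_lagCorr_le [IsProbabilityMeasure P] (h : IsStationaryGaussian X P)
    (hr : Tendsto (lagCorr X P) atTop (nhds 0)) :
    ∃ δ, 0 < δ ∧ δ < 1 ∧ ∀ k ≥ 1, |lagCorr X P k| ≤ δ := by
  have h1 : ∀ᶠ k in atTop, |lagCorr X P k| < 1 / 2 := by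
    have := hr.abs
    rw [abs_zero] at this
    exact this.eventually_lt_const (by norm_num)
  obtain ⟨N, hN⟩ := eventually_atTop.1 h1
  have h2 : ∀ M : ℕ, ∃ δ, 0 < δ ∧ δ < 1 ∧ ∀ k ≥ 1, k < M → |lagCorr X P k| ≤ δ := by
    intro M
    induction M with
    | zero => exact ⟨1 / 2, by norm_num, by norm_num, fun k _ hk => absurd hk (Nat.not_lt_zero k)⟩
    | succ M ih =>
      obtain ⟨δ, h0, h1, hδ⟩ := ih
      rcases Nat.eq_zero_or_pos M with hM | hM
      · exact ⟨δ, h0, h1, fun k hk hkM => by omega⟩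
      · refine ⟨max δ |lagCorr X P M|, lt_max_of_lt_left h0,
          max_lt h1 (h.abs_lagCorr_lt_one hr hM), fun k hk hkM => ?_⟩
        rcases Nat.lt_succ_iff_lt_or_eq.1 hkM with h' | h'
        · exact (hδ k hk h').trans (le_max_left _ _)
        · rw [h']
          exact le_max_right _ _
  obtain ⟨δ, h0, h3, hδ⟩ := h2 N
  refine ⟨max δ (1 / 2), lt_max_of_lt_left h0, max_lt h3 (by norm_num), fun k hk => ?_⟩
  rcases lt_or_ge k N with h' | h'
  · exact (hδ k hk h').trans (le_max_left _ _)
  · exact (hN k h').le.trans (le_max_right _ _)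

lemma hasGaussianLaw [IsProbabilityMeasure P] (h : IsStationaryGaussian X P) {ι : Type*}
    [Fintype ι] (idx : ι → ℕ) : HasGaussianLaw (fun ω i => X (idx i) ω) P := by
  have hm : Measurable fun ω i => X (idx i) ω := measurable_pi_iff.2 fun i => h.measurable _
  refine ⟨isGaussian_of_map_eq_gaussianReal fun L => ?_⟩
  obtain ⟨v, hv⟩ := h.gauss (Fintype.card ι) (fun i => idx ((Fintype.equivFin ι).symm i))
    fun i => L (Pi.single ((Fintype.equivFin ι).symm i) 1)
  refine ⟨0, v, ?_⟩
  rw [← hv, Measure.map_map (by fun_prop) hm]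
  congr 1
  ext ω
  rw [(Fintype.equivFin ι).symm.sum_comp fun i => L (Pi.single i 1) * X (idx i) ω]
  rw [Function.comp_apply, ← ContinuousLinearMap.coe_coe, LinearMap.pi_apply_eq_sum_univ]
  refine Finset.sum_congr rfl fun i _ => ?_
  rw [smul_eq_mul, mul_comm]
  congr 2
  ext j
  simp [Pi.single_apply, eq_comm]

end IsStationaryGaussian

end Stationary

lemma sum_lag_le {f : ℕ → ℝ} (hf : ∀ k, 0 ≤ f k) (n : ℕ) :
    ∑ i ∈ Finset.Icc 1 n, ∑ j ∈ Finset.Icc 1 n, (if i = j then 0 else f (max i j - min i j))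
      ≤ n * (2 * ∑ k ∈ Finset.Icc 1 n, f k) := by
  have hinj : ∀ (s : Finset ℕ) (φ : ℕ → ℕ), Set.InjOn φ s → (∀ j ∈ s, φ j ∈ Finset.Icc 1 n) →
      ∑ j ∈ s, f (φ j) ≤ ∑ k ∈ Finset.Icc 1 n, f k := by
    intro s φ h1 h2
    rw [← Finset.sum_image h1]
    exact Finset.sum_le_sum_of_subset_of_nonneg (Finset.image_subset_iff.2 h2)
      fun k _ _ => hf k
  have hrow : ∀ i ∈ Finset.Icc 1 n,
      ∑ j ∈ Finset.Icc 1 n, (if i = j then 0 else f (max i j - min i j))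
        ≤ 2 * ∑ k ∈ Finset.Icc 1 n, f k := by
    intro i hi
    rw [Finset.mem_Icc] at hi
    have hle : ∀ j ∈ Finset.Icc 1 n, (if i = j then 0 else f (max i j - min i j))
        ≤ (if j < i then f (i - j) else 0) + if i < j then f (j - i) else 0 := by
      intro j _
      rcases lt_trichotomy i j with h | h | h
      · simp [h, h.ne, h.le, h.not_gt]
      · simp [h]
      · simp [h, h.ne', h.le, h.not_gt]
    refine (Finset.sum_le_sum hle).trans ?_
    rw [Finset.sum_add_distrib, two_mul, ← Finset.sum_filter, ← Finset.sum_filter]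
    refine add_le_add (hinj _ _ ?_ ?_) (hinj _ _ ?_ ?_)
    · intro a ha b hb hab
      simp only [Finset.coe_filter, Finset.mem_Icc, Set.mem_ofPred_eq] at ha hb hab
      omega
    · intro a ha
      simp only [Finset.mem_filter, Finset.mem_Icc] at ha ⊢
      omega
    · intro a ha b hb hab
      simp only [Finset.coe_filter, Finset.mem_Icc, Set.mem_ofPred_eq] at ha hb hab
      omega
    · intro a ha
      simp only [Finset.mem_filter, Finset.mem_Icc] at ha ⊢
      omega
  refine (Finset.sum_le_sum hrow).trans ?_
  simp

/-- The level states of a stationary Gaussian sequence with `r_n ln n → γ` are asymptotically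
those of an equicorrelated vector with correlation `γ / ln n`, uniformly over bounded
functionals. -/
theorem IsStationaryGaussian.exists_levelState_comparison {Ω : Type*} [MeasurableSpace Ω]
    {P : Measure Ω} [IsProbabilityMeasure P] {X : ℕ → Ω → ℝ} (h : IsStationaryGaussian X P)
    {γ : ℝ} (hγ : 0 ≤ γ)
    (hr : Tendsto (fun n : ℕ => lagCorr X P n * log n) atTop (nhds γ)) {y x : ℝ} (hyx : y ≤ x) :
    ∃ err : ℕ → ℝ, Tendsto err atTop (nhds 0) ∧ ∀ᶠ n : ℕ in atTop,
      ∀ F : (Finset.Icc 1 n → Fin 3) → ℝ, (∀ s, |F s| ≤ 1) →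
        |∫ ω, F (fun i => levelState (un n y) (un n x) (X i ω)) ∂P
          - ∫ z, ∫ t, F (fun i => levelState (un n y) (un n x) (equicorr (γ / log n) i (z, t)))
            ∂(stdNormalPi (Finset.Icc 1 n)) ∂(gaussianReal 0 1)| ≤ err n := by
  have hr0 : Tendsto (lagCorr X P) atTop (nhds 0) := by
    have h1 := hr.mul (tendsto_inv_atTop_zero.comp tendsto_log_natCast_atTop)
    rw [mul_zero] at h1
    refine h1.congr' ?_
    filter_upwards [tendsto_log_natCast_atTop.eventually_gt_atTop 0] with n hn
    simp only [Function.comp_apply]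
    field_simp
  obtain ⟨δ, hδ0, hδ1, hδ⟩ := h.exists_abs_lagCorr_le hr0
  have key := tendsto_sum_pairBound (y := y) hγ hr hδ0 hδ1 hδ
  have hρ0 : Tendsto (fun n : ℕ => γ / log n) atTop (nhds 0) :=
    tendsto_const_nhds.div_atTop tendsto_log_natCast_atTop
  refine ⟨_, by simpa using key.const_mul (16 * π), ?_⟩
  filter_upwards [(tendsto_un_atTop y).eventually_ge_atTop 0, hρ0.eventually_lt_const one_pos,
    tendsto_log_natCast_atTop.eventually_gt_atTop 0] with n hy hρ1 hlog F hF
  have hρ : 0 ≤ γ / log n := by positivity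
  have hpos : ∀ i : Finset.Icc 1 n, 1 ≤ (i : ℕ) := fun i => (Finset.mem_Icc.1 i.2).1
  have hcov : ∀ i j : Finset.Icc 1 n, cov[X i, X j; P]
      = lagCorr X P (max (i : ℕ) j - min (i : ℕ) j) := fun i j =>
    h.covariance_eq_lagCorr (hpos i) (hpos j)
  have hlag : ∀ i j : Finset.Icc 1 n, i ≠ j → 1 ≤ max (i : ℕ) j - min (i : ℕ) j := by
    intro i j hij
    have : (i : ℕ) ≠ j := fun h => hij (Subtype.ext h)
    omega
  refine (abs_integral_levelState_sub_equicorr_le (fun i : Finset.Icc 1 n => h.measurable i)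
    (h.hasGaussianLaw fun i : Finset.Icc 1 n => (i : ℕ)) (fun i => h.integral_eq_zero i)
    (fun i => by rw [h.covariance_eq, h.integral_mul_self]) hρ hρ1
    (fun i j hij => by
      rw [hcov]
      exact (hδ _ (hlag i j hij)).trans_lt hδ1) hF hy (un_le_un hyx)).trans ?_
  simp only [hcov]
  set f : ℕ → ℝ := fun k => |lagCorr X P k - γ / log n|
    * pairBound (un n y) (max |lagCorr X P k| |γ / log n|) with hf
  have hf0 : ∀ k, 0 ≤ f k := fun k => mul_nonneg (abs_nonneg _) (pairBound_nonneg _ _)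
  have e : ∀ i j : Finset.Icc 1 n, (if i = j then (0 : ℝ) else
      |lagCorr X P (max (i : ℕ) j - min (i : ℕ) j) - γ / log n| * (16 * pairBound (un n y)
        (max |lagCorr X P (max (i : ℕ) j - min (i : ℕ) j)| (γ / log n))))
      = 16 * (if (i : ℕ) = j then 0 else f (max (i : ℕ) j - min (i : ℕ) j)) := by
    intro i j
    by_cases hij : i = j
    · simp [hij]
    · rw [if_neg hij, if_neg fun h => hij (Subtype.ext h), hf]
      simp only [abs_of_nonneg hρ]
      ring
  simp only [e, ← Finset.mul_sum]
  have e2 : ∑ i : Finset.Icc 1 n, ∑ j : Finset.Icc 1 n,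
      (if (i : ℕ) = j then (0 : ℝ) else f (max (i : ℕ) j - min (i : ℕ) j))
      = ∑ i ∈ Finset.Icc 1 n, ∑ j ∈ Finset.Icc 1 n,
        (if i = j then 0 else f (max i j - min i j)) := by
    rw [← Finset.sum_coe_sort (Finset.Icc 1 n)]
    exact Finset.sum_congr rfl fun i _ => Finset.sum_coe_sort (Finset.Icc 1 n)
      fun j => if (i : ℕ) = j then (0 : ℝ) else f (max (i : ℕ) j - min (i : ℕ) j)
  rw [e2]
  have h3 := sum_lag_le hf0 n
  have hπ := Real.pi_pos
  nlinarith

lemma exists_lipschitzWith_approx_indicator {B : Set ℝ} (hBf : volume (frontier B) = 0)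
    {η : ℝ} (hη : 0 < η) :
    ∃ (K : ℝ≥0) (f h : ℝ → ℝ), LipschitzWith K f ∧ LipschitzWith K h ∧
      (∀ t, |B.indicator (fun _ => (1 : ℝ)) t - f t| ≤ h t) ∧ ∫ t in (0 : ℝ)..1, h t < η := by
  set δ : ℕ → ℝ := fun n => 1 / ((n : ℝ) + 1)
  have hδ : ∀ n, 0 < δ n := fun n => by positivity
  have hδ0 : Tendsto δ atTop (nhds 0) := tendsto_one_div_add_atTop_nhds_zero_nat
  set φ : Set ℝ → ℕ → ℝ → ℝ := fun E n t => (thickenedIndicator (hδ n) E t : ℝ)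
  have hφL : ∀ E n, LipschitzWith (δ n).toNNReal⁻¹ (φ E n) := fun E n =>
    (lipschitzWith_thickenedIndicator (hδ n) E)
  have hφ1 : ∀ E n t, φ E n t ≤ 1 := fun E n t => by
    exact_mod_cast thickenedIndicator_le_one (hδ n) E t
  have hφ0 : ∀ E n t, 0 ≤ φ E n t := fun E n t => NNReal.coe_nonneg _
  have hφe : ∀ E n t, t ∈ E → φ E n t = 1 := fun E n t ht => by
    have := thickenedIndicator_one_of_mem_closure (hδ n) E (subset_closure ht)
    exact congrArg NNReal.toReal this
  have hφlim : ∀ E t, Tendsto (fun n => φ E n t) atTop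
      (nhds ((closure E).indicator (fun _ => (1 : ℝ)) t)) := fun E t => by
    have h1 := tendsto_pi_nhds.1 (thickenedIndicator_tendsto_indicator_closure hδ hδ0 E) t
    have h2 := (NNReal.tendsto_coe.2 h1)
    convert h2 using 2
    by_cases ht : t ∈ closure E <;> simp [ht]
  have hint : Tendsto (fun n => ∫ t in (0 : ℝ)..1, (φ B n t + φ Bᶜ n t - 1)) atTop (nhds 0) := by
    have h0 : ∫ t in (0 : ℝ)..1, (frontier B).indicator (fun _ => (1 : ℝ)) t = 0 := by
      rw [intervalIntegral.integral_of_le zero_le_one]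
      refine integral_eq_zero_of_ae (ae_restrict_of_ae ?_)
      have : ∀ᵐ t : ℝ, t ∉ frontier B := measure_eq_zero_iff_ae_notMem.1 hBf
      filter_upwards [this] with t ht
      simp [ht]
    suffices h1 : Tendsto (fun n => ∫ t in (0 : ℝ)..1, (φ B n t + φ Bᶜ n t - 1)) atTop
        (nhds (∫ t in (0 : ℝ)..1, (frontier B).indicator (fun _ => (1 : ℝ)) t)) by
      rwa [h0] at h1
    have hb : IntervalIntegrable (fun _ : ℝ => (1 : ℝ)) volume 0 1 := intervalIntegrable_const
    refine intervalIntegral.tendsto_integral_filter_of_dominated_convergence (fun _ : ℝ => (1 : ℝ))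
      (Eventually.of_forall fun n => ?_) (Eventually.of_forall fun n => ae_of_all _ fun t _ => ?_)
      hb (ae_of_all _ fun t _ => ?_)
    · exact (((hφL B n).continuous.add (hφL Bᶜ n).continuous).sub
        continuous_const).aestronglyMeasurable
    · rw [Real.norm_eq_abs, abs_le]
      constructor <;> linarith [hφ1 B n t, hφ1 Bᶜ n t, hφ0 B n t, hφ0 Bᶜ n t]
    · have h1 := ((hφlim B t).add (hφlim Bᶜ t)).sub_const 1
      convert h1 using 2
      rw [frontier_eq_closure_inter_closure]
      by_cases h2 : t ∈ closure B <;> by_cases h3 : t ∈ closure Bᶜ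
      · simp only [Set.indicator_apply, Set.mem_inter_iff, h2, h3]; norm_num
      · simp only [Set.indicator_apply, Set.mem_inter_iff, h2, h3]; norm_num
      · simp only [Set.indicator_apply, Set.mem_inter_iff, h2, h3]; norm_num
      · exact absurd (subset_closure (show t ∈ Bᶜ from fun h => h2 (subset_closure h))) h3
  obtain ⟨n, hn⟩ := (hint.eventually (gt_mem_nhds hη)).exists
  refine ⟨(δ n).toNNReal⁻¹ + (δ n).toNNReal⁻¹, φ B n, fun t => φ B n t + φ Bᶜ n t - 1,
    (hφL B n).weaken le_self_add, ?_, fun t => ?_, hn⟩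
  · have := ((hφL B n).add (hφL Bᶜ n)).sub (LipschitzWith.const (1 : ℝ))
    simpa using this
  · by_cases ht : t ∈ B
    · simp [ht, hφe B n t ht, hφ0]
    · simp [ht, hφe Bᶜ n t ht, abs_of_nonneg (hφ0 B n t)]

lemma sum_Icc_one_eq_sum_range (a : ℕ → ℝ) (m : ℕ) :
    ∑ j ∈ Finset.Icc 1 m, a j = ∑ j ∈ Finset.range m, a (j + 1) := by
  rw [Finset.range_eq_Ico, Finset.sum_Ico_add' a 0 m 1]
  rfl

lemma tendsto_riemannSum {K : ℝ≥0} {f : ℝ → ℝ} (hf : LipschitzWith K f) :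
    Tendsto (fun n : ℕ => (∑ j ∈ Finset.Icc 1 n, f ((j : ℝ) / n)) / n) atTop
      (nhds (∫ t in (0 : ℝ)..1, f t)) := by
  rw [tendsto_iff_norm_sub_tendsto_zero]
  refine squeeze_zero' (Eventually.of_forall fun n => norm_nonneg _) ?_
    (tendsto_const_div_atTop_nhds_zero_nat (K : ℝ))
  filter_upwards [eventually_gt_atTop 0] with n hn
  have hn' : (0 : ℝ) < n := Nat.cast_pos.2 hn
  have hcell : ∀ j : ℕ, ((j + 1 : ℕ) : ℝ) / n - (j : ℝ) / n = 1 / n := fun j => by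
    push_cast; ring
  have h1 : ∫ t in (0 : ℝ)..1, f t
      = ∑ j ∈ Finset.range n, ∫ t in (j : ℝ) / n..((j + 1 : ℕ) : ℝ) / n, f t := by
    rw [intervalIntegral.sum_integral_adjacent_intervals (a := fun j : ℕ => (j : ℝ) / n)
      fun j _ => hf.continuous.intervalIntegrable _ _]
    simp [hn'.ne']
  have h2 : (∑ j ∈ Finset.Icc 1 n, f ((j : ℝ) / n)) / n
      = ∑ j ∈ Finset.range n,
        ∫ _ in (j : ℝ) / n..((j + 1 : ℕ) : ℝ) / n, f (((j + 1 : ℕ) : ℝ) / n) := by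
    rw [sum_Icc_one_eq_sum_range, Finset.sum_div]
    refine Finset.sum_congr rfl fun j _ => ?_
    rw [intervalIntegral.integral_const, hcell, smul_eq_mul]
    ring
  rw [h1, h2, ← Finset.sum_sub_distrib]
  refine (norm_sum_le _ _).trans ?_
  have h3 : ∀ j ∈ Finset.range n, ‖(∫ _ in (j : ℝ) / n..((j + 1 : ℕ) : ℝ) / n,
      f (((j + 1 : ℕ) : ℝ) / n)) - ∫ t in (j : ℝ) / n..((j + 1 : ℕ) : ℝ) / n, f t‖
      ≤ K * (1 / n) * (1 / n) := by
    intro j _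
    rw [← intervalIntegral.integral_sub (continuous_const.intervalIntegrable _ _)
      (hf.continuous.intervalIntegrable _ _)]
    have hle : (j : ℝ) / n ≤ ((j + 1 : ℕ) : ℝ) / n := by
      have := hcell j
      have : (0 : ℝ) ≤ 1 / n := by positivity
      linarith [hcell j]
    refine (intervalIntegral.norm_integral_le_of_norm_le_const (C := K * (1 / n))
      fun t ht => ?_).trans ?_
    · rw [Set.uIoc_of_le hle] at ht
      refine (hf.norm_sub_le _ _).trans (mul_le_mul_of_nonneg_left ?_ K.2)
      rw [Real.norm_eq_abs, abs_of_nonneg (by linarith [ht.2]), ← hcell j]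
      linarith [ht.1]
    · rw [hcell, abs_of_nonneg (by positivity)]
  refine (Finset.sum_le_sum h3).trans (le_of_eq ?_)
  rw [Finset.sum_const, Finset.card_range, nsmul_eq_mul]
  field_simp

lemma tendsto_average_indicator {B : Set ℝ} (hB : MeasurableSet B) (hBs : B ⊆ Set.Ioc 0 1)
    (hBf : volume (frontier B) = 0) :
    Tendsto (fun n : ℕ => (∑ j ∈ Finset.Icc 1 n, B.indicator (fun _ => (1 : ℝ)) ((j : ℝ) / n)) / n)
      atTop (nhds (volume B).toReal) := by
  have hvol : (volume B).toReal = ∫ t in (0 : ℝ)..1, B.indicator (fun _ => (1 : ℝ)) t := by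
    rw [intervalIntegral.integral_of_le zero_le_one, setIntegral_indicator hB,
      Set.inter_eq_right.2 hBs, setIntegral_const]
    simp [Measure.real]
  rw [Metric.tendsto_atTop']
  intro η hη
  obtain ⟨K, f, h, hf, hh, hBfh, hhη⟩ :=
    exists_lipschitzWith_approx_indicator hBf (show (0 : ℝ) < η / 4 by linarith)
  have hi : IntervalIntegrable (B.indicator fun _ => (1 : ℝ)) volume 0 1 :=
    (intervalIntegrable_const (c := (1 : ℝ))).mono_fun'
      ((measurable_const.indicator hB).aestronglyMeasurable)
      (ae_of_all _ fun t => by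
        by_cases ht : t ∈ B <;> simp [ht])
  have hdiff : |(∫ t in (0 : ℝ)..1, B.indicator (fun _ => (1 : ℝ)) t) - ∫ t in (0 : ℝ)..1, f t|
      ≤ ∫ t in (0 : ℝ)..1, h t := by
    rw [← intervalIntegral.integral_sub hi (hf.continuous.intervalIntegrable _ _)]
    rw [← Real.norm_eq_abs]
    exact intervalIntegral.norm_integral_le_of_norm_le zero_le_one
      (ae_of_all _ fun t _ => (Real.norm_eq_abs _).trans_le (hBfh t)) (hh.continuous.intervalIntegrable _ _)
  have e1 := (tendsto_riemannSum hf).eventually (Metric.ball_mem_nhds _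
    (show (0 : ℝ) < η / 4 by linarith))
  have e2 := (tendsto_riemannSum hh).eventually (gt_mem_nhds hhη)
  obtain ⟨N, hN⟩ := eventually_atTop.1 (e1.and e2)
  refine ⟨N, fun n hn => ?_⟩
  obtain ⟨h1, h2⟩ := hN n hn.le
  rw [Real.dist_eq] at h1
  have h3 : |(∑ j ∈ Finset.Icc 1 n, B.indicator (fun _ => (1 : ℝ)) ((j : ℝ) / n)) / n
      - (∑ j ∈ Finset.Icc 1 n, f ((j : ℝ) / n)) / n|
      ≤ (∑ j ∈ Finset.Icc 1 n, h ((j : ℝ) / n)) / n := by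
    rw [← sub_div, ← Finset.sum_sub_distrib, abs_div, Nat.abs_cast]
    gcongr
    exact (Finset.abs_sum_le_sum_abs _ _).trans (Finset.sum_le_sum fun j _ => hBfh _)
  rw [Real.dist_eq, hvol]
  rw [abs_lt] at h1 ⊢
  rw [abs_le] at h3 hdiff
  constructor <;> linarith [h1.1, h1.2, h3.1, h3.2, hdiff.1, hdiff.2]

lemma abs_sum_mul_le {K : ℝ≥0} {f : ℝ → ℝ} (hf : LipschitzWith K f) (v : ℕ → ℝ) (n : ℕ) :
    |∑ j ∈ Finset.Icc 1 n, f ((j : ℝ) / n) * v j|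
      ≤ |f 1| * |∑ j ∈ Finset.Icc 1 n, v j|
        + K / n * ∑ i ∈ Finset.Icc 1 n, |∑ j ∈ Finset.Icc 1 i, v j| := by
  rcases Nat.eq_zero_or_pos n with rfl | hn
  · simp
  have hn' : (0 : ℝ) < n := Nat.cast_pos.2 hn
  have key := Finset.sum_range_by_parts (fun j : ℕ => f (((j + 1 : ℕ) : ℝ) / n))
    (fun j => v (j + 1)) n
  simp only [smul_eq_mul] at key
  rw [sum_Icc_one_eq_sum_range, key, Nat.sub_add_cancel hn, div_self hn'.ne', ← sum_Icc_one_eq_sum_range v n]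
  refine (abs_sub _ _).trans (add_le_add (abs_mul _ _).le ?_)
  refine (Finset.abs_sum_le_sum_abs _ _).trans ?_
  rw [Finset.mul_sum, sum_Icc_one_eq_sum_range]
  refine (Finset.sum_le_sum fun j _ => ?_).trans (Finset.sum_le_sum_of_subset_of_nonneg
    (Finset.range_mono (Nat.sub_le n 1)) fun j _ _ => by positivity)
  rw [abs_mul, sum_Icc_one_eq_sum_range v]
  refine mul_le_mul_of_nonneg_right ?_ (abs_nonneg _)
  refine (hf.norm_sub_le _ _).trans (le_of_eq ?_)
  rw [← sub_div, Real.norm_eq_abs, abs_div]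
  push_cast
  rw [Nat.abs_cast]
  simp [div_eq_mul_inv]

section WeightedAverages

variable {Ω : Type*} [MeasurableSpace Ω] {P : Measure Ω} [IsProbabilityMeasure P]

lemma tendsto_integral_abs_of_tendstoInMeasure {f : ℕ → Ω → ℝ} (hf : ∀ n, Measurable (f n))
    {C : ℝ} (hC : ∀ n, ∀ᵐ ω ∂P, |f n ω| ≤ C) (h : TendstoInMeasure P f atTop 0) :
    Tendsto (fun n => ∫ ω, |f n ω| ∂P) atTop (nhds 0) := by
  refine tendsto_of_subseq_tendsto fun ns hns => ?_
  obtain ⟨ms, _, hms⟩ := TendstoInMeasure.exists_seq_tendsto_ae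
    (f := fun k => f (ns k)) (fun δ hδ => (h δ hδ).comp hns)
  refine ⟨ms, ?_⟩
  have := tendsto_integral_of_dominated_convergence (μ := P) (F := fun k ω => |f (ns (ms k)) ω|)
    (f := fun _ => (0 : ℝ)) (fun _ => C)
    (fun k => (hf _).abs.aestronglyMeasurable) (integrable_const _)
    (fun k => by simpa using hC (ns (ms k)))
    (by filter_upwards [hms] with ω hω; simpa using hω.abs)
  simpa using this

lemma tendsto_integral_abs_weighted_average {v : ℕ → Ω → ℝ} (hv : ∀ n, Measurable (v n))
    (hv1 : ∀ n, ∀ᵐ ω ∂P, |v n ω| ≤ 1)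
    (hV : Tendsto (fun n : ℕ => ∫ ω, |(∑ j ∈ Finset.Icc 1 n, v j ω) / n| ∂P) atTop (nhds 0))
    {B : Set ℝ} (hBf : volume (frontier B) = 0) :
    Tendsto (fun n : ℕ => ∫ ω, |(∑ j ∈ Finset.Icc 1 n,
      B.indicator (fun _ => (1 : ℝ)) ((j : ℝ) / n) * v j ω) / n| ∂P) atTop (nhds 0) := by
  have hvi : ∀ n, Integrable (v n) P := fun n =>
    Integrable.of_bound (hv n).aestronglyMeasurable 1 (by simpa using hv1 n)
  rw [Metric.tendsto_atTop']
  intro η hη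
  obtain ⟨K, f, h, hf, hh, hBfh, hhη⟩ :=
    exists_lipschitzWith_approx_indicator hBf (show (0 : ℝ) < η / 2 by linarith)
  have hbound : Tendsto (fun n : ℕ => |f 1| * (∫ ω, |(∑ j ∈ Finset.Icc 1 n, v j ω) / n| ∂P)
      + K * ((∑ i ∈ Finset.Icc 1 n, ∫ ω, |(∑ j ∈ Finset.Icc 1 i, v j ω) / i| ∂P) / n)) atTop
      (nhds 0) := by
    simpa using (hV.const_mul |f 1|).add ((tendsto_average_Icc hV).const_mul (K : ℝ))
  have e1 := hbound.eventually (gt_mem_nhds (show (0 : ℝ) < η / 2 by linarith))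
  have e2 := (tendsto_riemannSum hh).eventually (gt_mem_nhds hhη)
  obtain ⟨N, hN⟩ := eventually_atTop.1 (e1.and (e2.and (eventually_gt_atTop 0)))
  refine ⟨N, fun n hn => ?_⟩
  obtain ⟨h1, h2, h3⟩ := hN n hn.le
  have hn' : (0 : ℝ) < n := Nat.cast_pos.2 h3
  have hVi : ∀ (m : ℕ) (c : ℝ), Integrable (fun ω => |(∑ j ∈ Finset.Icc 1 m, v j ω) / c|) P :=
    fun m c => ((integrable_finsetSum _ fun j _ => hvi j).div_const c).abs
  rw [Real.dist_0_eq_abs, abs_of_nonneg (integral_nonneg fun ω => abs_nonneg _)]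
  have hpt : ∀ᵐ ω ∂P, |(∑ j ∈ Finset.Icc 1 n,
        B.indicator (fun _ => (1 : ℝ)) ((j : ℝ) / n) * v j ω) / n|
      ≤ (|f 1| * |(∑ j ∈ Finset.Icc 1 n, v j ω) / n|
        + K * ((∑ i ∈ Finset.Icc 1 n, |(∑ j ∈ Finset.Icc 1 i, v j ω) / i|) / n))
        + (∑ j ∈ Finset.Icc 1 n, h ((j : ℝ) / n)) / n := by
    filter_upwards [ae_all_iff.2 hv1] with ω hω
    have hsplit : ∑ j ∈ Finset.Icc 1 n, B.indicator (fun _ => (1 : ℝ)) ((j : ℝ) / n) * v j ω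
        = ∑ j ∈ Finset.Icc 1 n, f ((j : ℝ) / n) * v j ω
        + ∑ j ∈ Finset.Icc 1 n,
          (B.indicator (fun _ => (1 : ℝ)) ((j : ℝ) / n) - f ((j : ℝ) / n)) * v j ω := by
      rw [← Finset.sum_add_distrib]
      exact Finset.sum_congr rfl fun j _ => by ring
    rw [hsplit, add_div]
    refine (abs_add_le _ _).trans (add_le_add ?_ ?_)
    · rw [abs_div, Nat.abs_cast, div_le_iff₀ hn']
      refine (abs_sum_mul_le hf (fun j => v j ω) n).trans ?_
      rw [add_mul, abs_div, Nat.abs_cast, mul_assoc, div_mul_cancel₀ _ hn'.ne', mul_assoc,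
        div_mul_cancel₀ _ hn'.ne', div_mul_eq_mul_div, mul_div_assoc, Finset.sum_div]
      gcongr with i hi
      rw [abs_div, Nat.abs_cast]
      rw [Finset.mem_Icc] at hi
      have : (0 : ℝ) < i := Nat.cast_pos.2 hi.1
      gcongr
      exact hi.2
    · rw [abs_div, Nat.abs_cast]
      gcongr
      refine (Finset.abs_sum_le_sum_abs _ _).trans (Finset.sum_le_sum fun j _ => ?_)
      rw [abs_mul]
      exact (mul_le_of_le_one_right (abs_nonneg _) (hω j)).trans (hBfh _)
  have i1 : Integrable (fun ω => |f 1| * |(∑ j ∈ Finset.Icc 1 n, v j ω) / n|) P :=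
    (hVi n n).const_mul _
  have i2 : Integrable (fun ω => (∑ i ∈ Finset.Icc 1 n, |(∑ j ∈ Finset.Icc 1 i, v j ω) / i|)) P :=
    integrable_finsetSum _ fun i _ => hVi i i
  have i3 : Integrable (fun ω => (K : ℝ) * ((∑ i ∈ Finset.Icc 1 n,
      |(∑ j ∈ Finset.Icc 1 i, v j ω) / i|) / n)) P := (i2.div_const _).const_mul _
  have hle := integral_mono_of_nonneg (ae_of_all _ fun ω => abs_nonneg _)
    ((i1.add i3).add (integrable_const _)) hpt
  have e3 := integral_add (i1.add i3)
    (integrable_const (μ := P) ((∑ j ∈ Finset.Icc 1 n, h ((j : ℝ) / n)) / n))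
  simp only [Pi.add_apply] at hle e3
  rw [e3, integral_const, probReal_univ, one_smul, integral_add i1 i3, integral_const_mul,
    integral_const_mul, integral_div, integral_finsetSum _ fun i _ => hVi i i] at hle
  linarith

lemma exists_subseq_tendsto_average_indicator {w : ℕ → Ω → ℝ} {lam : Ω → ℝ}
    (hw : ∀ n, Measurable (w n)) (hw01 : ∀ n ω, w n ω ∈ Set.Icc (0 : ℝ) 1)
    (hlam : Measurable lam) (hlam01 : ∀ᵐ ω ∂P, lam ω ∈ Set.Icc (0 : ℝ) 1)
    (hS : TendstoInMeasure P (fun n ω => (∑ k ∈ Finset.Icc 1 n, w k ω) / n) atTop lam)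
    {B : Set ℝ} (hB : MeasurableSet B) (hBs : B ⊆ Set.Ioc 0 1)
    (hBf : volume (frontier B) = 0) {ns : ℕ → ℕ} (hns : Tendsto ns atTop atTop) :
    ∃ ms : ℕ → ℕ, Tendsto ms atTop atTop ∧
      ∀ᵐ ω ∂P, Tendsto (fun k => (∑ j ∈ Finset.Icc 1 (ns (ms k)),
        B.indicator (fun _ => (1 : ℝ)) ((j : ℝ) / ns (ms k)) * w j ω) / ns (ms k)) atTop
        (nhds (lam ω * (volume B).toReal)) := by
  set v : ℕ → Ω → ℝ := fun n ω => w n ω - lam ω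
  have hv : ∀ n, Measurable (v n) := fun n => (hw n).sub hlam
  have hv1 : ∀ n, ∀ᵐ ω ∂P, |v n ω| ≤ 1 := fun n => by
    filter_upwards [hlam01] with ω hω
    have := hw01 n ω
    rw [abs_le]
    constructor <;> simp only [v] <;> linarith [this.1, this.2, hω.1, hω.2]
  have hVm : ∀ n : ℕ, Measurable fun ω => (∑ j ∈ Finset.Icc 1 n, v j ω) / n := fun n =>
    (Finset.measurable_fun_sum _ fun j _ => hv j).div_const _
  have hVeq : ∀ n : ℕ, 0 < n → ∀ ω, (∑ j ∈ Finset.Icc 1 n, v j ω) / n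
      = (∑ k ∈ Finset.Icc 1 n, w k ω) / n - lam ω := fun n hn ω => by
    have : (n : ℝ) ≠ 0 := Nat.cast_ne_zero.2 hn.ne'
    simp only [v, Finset.sum_sub_distrib, Finset.sum_const, Nat.card_Icc, nsmul_eq_mul,
      Nat.add_sub_cancel]
    field_simp
  have hVbound : ∀ n : ℕ, ∀ᵐ ω ∂P, |(∑ j ∈ Finset.Icc 1 n, v j ω) / n| ≤ 1 := fun n => by
    filter_upwards [ae_all_iff.2 hv1] with ω hω
    rw [abs_div, Nat.abs_cast]
    refine div_le_one_of_le₀ ((Finset.abs_sum_le_sum_abs _ _).trans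
      ((Finset.sum_le_sum fun j _ => hω j).trans ?_)) (Nat.cast_nonneg n)
    simp
  have hVmeas : TendstoInMeasure P (fun (n : ℕ) ω => (∑ j ∈ Finset.Icc 1 n, v j ω) / n) atTop 0 := by
    intro δ hδ
    refine (hS δ hδ).congr' ?_
    filter_upwards [eventually_gt_atTop 0] with n hn
    congr 1
    ext ω
    simp [hVeq n hn ω, edist_eq_enorm_sub]
  have hA := tendsto_integral_abs_weighted_average hv hv1
    (tendsto_integral_abs_of_tendstoInMeasure hVm hVbound hVmeas) hBf
  set A : ℕ → Ω → ℝ := fun n ω => (∑ j ∈ Finset.Icc 1 n,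
      B.indicator (fun _ => (1 : ℝ)) ((j : ℝ) / n) * v j ω) / n
  have hAm : ∀ n, Measurable (A n) := fun n =>
    (Finset.measurable_fun_sum _ fun j _ => (hv j).const_mul _).div_const _
  have hAi : ∀ n, Integrable (A n) P := fun n =>
    (integrable_finsetSum _ fun j _ => (Integrable.of_bound (hv j).aestronglyMeasurable 1
      (by simpa using hv1 j)).const_mul _).div_const _
  have hAmeas : TendstoInMeasure P A atTop 0 := by
    refine tendstoInMeasure_of_tendsto_eLpNorm one_ne_zero
      (fun n => (hAm n).aestronglyMeasurable) aestronglyMeasurable_const ?_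
    simp only [sub_zero, eLpNorm_one_eq_lintegral_enorm]
    simp_rw [← ofReal_integral_norm_eq_lintegral_enorm (hAi _)]
    simpa using ENNReal.tendsto_ofReal hA
  obtain ⟨ms, hms, hlim⟩ := TendstoInMeasure.exists_seq_tendsto_ae
    (f := fun k => A (ns k)) (fun δ hδ => (hAmeas δ hδ).comp hns)
  refine ⟨ms, hms.tendsto_atTop, ?_⟩
  filter_upwards [hlim] with ω hω
  have hc := ((tendsto_average_indicator hB hBs hBf).comp
    (hns.comp hms.tendsto_atTop)).const_mul (lam ω)
  have := hω.add hc
  rw [Pi.zero_apply, zero_add] at this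
  refine this.congr fun k => ?_
  simp only [A, v, Function.comp_apply, mul_sub, Finset.sum_sub_distrib, ← Finset.sum_mul]
  ring

end WeightedAverages

/-- The probability of the counts `k₁, k₂` above `un n x` and `k₃, k₄` above `un n y` in two
disjoint groups of `M₁` and `M₂` equicorrelated standard Gaussian variables with correlation
`γ / log n`. -/
noncomputable def equicorrCountProb (γ x y : ℝ) (k₁ k₂ k₃ k₄ n M₁ M₂ : ℕ) : ℝ :=
  ∫ z, trinomial M₁ k₁ k₃ (gaussTail (shiftedLevel (un n x) (γ / log n) z))
      (gaussTail (shiftedLevel (un n y) (γ / log n) z))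
    * trinomial M₂ k₂ k₄ (gaussTail (shiftedLevel (un n x) (γ / log n) z))
      (gaussTail (shiftedLevel (un n y) (γ / log n) z)) ∂(gaussianReal 0 1)

lemma measurable_trinomial_gaussTail (M k l : ℕ) (u v ρ : ℝ) :
    Measurable fun z => trinomial M k l (gaussTail (shiftedLevel u ρ z))
      (gaussTail (shiftedLevel v ρ z)) := by
  have h1 := measurable_gaussTail_shiftedLevel u ρ
  have h2 := measurable_gaussTail_shiftedLevel v ρ
  unfold trinomial
  fun_prop

lemma trinomial_gaussTail_mem_Icc (M k l : ℕ) {u v : ℝ} (h : v ≤ u) (ρ z : ℝ) :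
    trinomial M k l (gaussTail (shiftedLevel u ρ z)) (gaussTail (shiftedLevel v ρ z))
      ∈ Set.Icc (0 : ℝ) 1 :=
  have hle := gaussTail_antitone (shiftedLevel_le_shiftedLevel h ρ z)
  ⟨trinomial_nonneg (gaussTail_nonneg _) hle (gaussTail_le_one _),
    trinomial_le_one (gaussTail_nonneg _) hle (gaussTail_le_one _)⟩

lemma abs_trinomial_mul_trinomial_le (M₁ M₂ k₁ k₂ k₃ k₄ : ℕ) {u v : ℝ} (h : v ≤ u) (ρ z : ℝ) :
    |trinomial M₁ k₁ k₃ (gaussTail (shiftedLevel u ρ z)) (gaussTail (shiftedLevel v ρ z))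
      * trinomial M₂ k₂ k₄ (gaussTail (shiftedLevel u ρ z)) (gaussTail (shiftedLevel v ρ z))|
      ≤ 1 := by
  have h1 := trinomial_gaussTail_mem_Icc M₁ k₁ k₃ h ρ z
  have h2 := trinomial_gaussTail_mem_Icc M₂ k₂ k₄ h ρ z
  rw [abs_of_nonneg (mul_nonneg h1.1 h2.1)]
  exact mul_le_one₀ h1.2 h2.1 h2.2

lemma abs_equicorrCountProb_le {γ x y : ℝ} (hyx : y ≤ x) (k₁ k₂ k₃ k₄ n M₁ M₂ : ℕ) :
    |equicorrCountProb γ x y k₁ k₂ k₃ k₄ n M₁ M₂| ≤ 1 := by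
  have := norm_integral_le_of_norm_le_const (μ := gaussianReal 0 1) (ae_of_all _ fun z =>
    (Real.norm_eq_abs _).trans_le
      (abs_trinomial_mul_trinomial_le M₁ M₂ k₁ k₂ k₃ k₄ (un_le_un (n := n) hyx) (γ / log n) z))
  simpa [equicorrCountProb] using this

lemma tendsto_equicorrCountProb {γ x y μ₁ μ₂ : ℝ} (hγ : 0 ≤ γ) (hyx : y ≤ x)
    {k₁ k₂ k₃ k₄ : ℕ} (h13 : k₁ ≤ k₃) (h24 : k₂ ≤ k₄) {N M₁ M₂ : ℕ → ℕ}
    (hN : Tendsto N atTop atTop)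
    (hM₁ : Tendsto (fun a => (M₁ a : ℝ) / N a) atTop (nhds μ₁))
    (hM₂ : Tendsto (fun a => (M₂ a : ℝ) / N a) atTop (nhds μ₂)) :
    Tendsto (fun a => equicorrCountProb γ x y k₁ k₂ k₃ k₄ (N a) (M₁ a) (M₂ a)) atTop
      (nhds (∫ z,
        (μ₁ * g γ x z) ^ k₁ / (Nat.factorial k₁ : ℝ) *
          ((μ₁ * (g γ y z - g γ x z)) ^ (k₃ - k₁) / (Nat.factorial (k₃ - k₁) : ℝ)) *
          Real.exp (-(μ₁ * g γ y z)) *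
        ((μ₂ * g γ x z) ^ k₂ / (Nat.factorial k₂ : ℝ) *
          ((μ₂ * (g γ y z - g γ x z)) ^ (k₄ - k₂) / (Nat.factorial (k₄ - k₂) : ℝ)) *
          Real.exp (-(μ₂ * g γ y z))) ∂(gaussianReal 0 1))) := by
  refine tendsto_integral_of_dominated_convergence (fun _ => (1 : ℝ))
    (fun a => ((measurable_trinomial_gaussTail _ _ _ _ _ _).mul
      (measurable_trinomial_gaussTail _ _ _ _ _ _)).aestronglyMeasurable) (integrable_const _)
    (fun a => ae_of_all _ fun z => (Real.norm_eq_abs _).trans_le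
      (abs_trinomial_mul_trinomial_le _ _ _ _ _ _ (un_le_un hyx) _ _))
    (ae_of_all _ fun z => ?_)
  have hp := (tendsto_mul_gaussTail_shiftedLevel hγ x z).comp hN
  have hq := (tendsto_mul_gaussTail_shiftedLevel hγ y z).comp hN
  exact (tendsto_trinomial h13 hN hM₁ hp hq).mul (tendsto_trinomial h24 hN hM₂ hp hq)

/-- The indices `j ≤ n` with `j / n ∈ B` whose mark is `b`. -/
noncomputable def markedIndices (B : Set ℝ) (e : ℕ → Bool) (b : Bool) (n : ℕ) : Finset ℕ :=
  (Finset.Icc 1 n).filter fun j : ℕ => (j : ℝ) / n ∈ B ∧ e j = b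

lemma card_markedIndices_true (B : Set ℝ) (e : ℕ → Bool) (n : ℕ) :
    ((markedIndices B e true n).card : ℝ) = ∑ j ∈ Finset.Icc 1 n,
      B.indicator (fun _ => (1 : ℝ)) ((j : ℝ) / n) * (if e j then 1 else 0) := by
  rw [markedIndices, Finset.card_filter]
  push_cast
  refine Finset.sum_congr rfl fun j _ => ?_
  by_cases h1 : (j : ℝ) / n ∈ B <;> by_cases h2 : e j = true <;> simp [h1, h2]

lemma card_markedIndices_false (B : Set ℝ) (e : ℕ → Bool) (n : ℕ) :
    ((markedIndices B e false n).card : ℝ) = ∑ j ∈ Finset.Icc 1 n,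
      B.indicator (fun _ => (1 : ℝ)) ((j : ℝ) / n) - (markedIndices B e true n).card := by
  rw [eq_sub_iff_add_eq, markedIndices, markedIndices, Finset.card_filter, Finset.card_filter]
  push_cast
  rw [← Finset.sum_add_distrib]
  refine Finset.sum_congr rfl fun j _ => ?_
  by_cases h1 : (j : ℝ) / n ∈ B <;> by_cases h2 : e j = true <;> simp [h1, h2]

section RandomMarks

variable {Ω : Type*} [MeasurableSpace Ω] {P : Measure Ω} [IsProbabilityMeasure P]
  {ε : ℕ → Ω → Bool} {lam : Ω → ℝ}

lemma measurable_card_markedIndices (hε : ∀ n, Measurable (ε n)) (B : Set ℝ) (b : Bool) (n : ℕ) :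
    Measurable fun ω => (markedIndices B (fun j => ε j ω) b n).card := by
  simp only [markedIndices, Finset.card_filter]
  refine Finset.measurable_fun_sum _ fun j _ => Measurable.ite ?_ measurable_const measurable_const
  exact (MeasurableSet.const _).inter (hε j (measurableSet_singleton b))

lemma measurable_equicorrCountProb_markedIndices (hε : ∀ n, Measurable (ε n)) (B : Set ℝ)
    (γ x y : ℝ) (k₁ k₂ k₃ k₄ n : ℕ) :
    Measurable fun ω => equicorrCountProb γ x y k₁ k₂ k₃ k₄ n
      (markedIndices B (fun j => ε j ω) true n).card
      (markedIndices B (fun j => ε j ω) false n).card := by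
  have h : Measurable fun M : ℕ × ℕ => equicorrCountProb γ x y k₁ k₂ k₃ k₄ n M.1 M.2 :=
    Measurable.of_discrete
  have h' := h.comp ((measurable_card_markedIndices hε B true n).prodMk
    (measurable_card_markedIndices hε B false n))
  exact h'

lemma tendsto_integral_equicorrCountProb {γ x y : ℝ} (hγ : 0 ≤ γ) (hyx : y ≤ x)
    {k₁ k₂ k₃ k₄ : ℕ} (h13 : k₁ ≤ k₃) (h24 : k₂ ≤ k₄) (hε : ∀ n, Measurable (ε n))
    (hlam : Measurable lam) (hlam01 : ∀ᵐ ω ∂P, lam ω ∈ Set.Icc (0 : ℝ) 1)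
    (hS : TendstoInMeasure P
      (fun n ω => (∑ k ∈ Finset.Icc 1 n, (if ε k ω then (1 : ℝ) else 0)) / n) atTop lam)
    {B : Set ℝ} (hB : MeasurableSet B) (hBs : B ⊆ Set.Ioc 0 1)
    (hBf : volume (frontier B) = 0) :
    Tendsto (fun n => ∫ ω, equicorrCountProb γ x y k₁ k₂ k₃ k₄ n
      (markedIndices B (fun j => ε j ω) true n).card
      (markedIndices B (fun j => ε j ω) false n).card ∂P) atTop
      (nhds (∫ ω, ∫ z,
        (lam ω * (volume B).toReal * g γ x z) ^ k₁ / (Nat.factorial k₁ : ℝ) *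
          ((lam ω * (volume B).toReal * (g γ y z - g γ x z)) ^ (k₃ - k₁) /
            (Nat.factorial (k₃ - k₁) : ℝ)) *
          Real.exp (-(lam ω * (volume B).toReal * g γ y z)) *
        (((1 - lam ω) * (volume B).toReal * g γ x z) ^ k₂ / (Nat.factorial k₂ : ℝ) *
          (((1 - lam ω) * (volume B).toReal * (g γ y z - g γ x z)) ^ (k₄ - k₂) /
            (Nat.factorial (k₄ - k₂) : ℝ)) *
          Real.exp (-((1 - lam ω) * (volume B).toReal * g γ y z)))
        ∂(gaussianReal 0 1) ∂P)) := by
  refine tendsto_of_subseq_tendsto fun ns hns => ?_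
  obtain ⟨ms, hms, hlim⟩ := exists_subseq_tendsto_average_indicator
    (w := fun k ω => if ε k ω then (1 : ℝ) else 0)
    (fun k => Measurable.ite (hε k (measurableSet_singleton true)) measurable_const
      measurable_const)
    (fun k ω => by split_ifs <;> simp) hlam hlam01 hS hB hBs hBf hns
  refine ⟨ms, tendsto_integral_of_dominated_convergence (fun _ => (1 : ℝ))
    (fun k => (measurable_equicorrCountProb_markedIndices hε B γ x y k₁ k₂ k₃ k₄
      _).aestronglyMeasurable) (integrable_const _)
    (fun k => ae_of_all _ fun ω => (Real.norm_eq_abs _).trans_le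
      (abs_equicorrCountProb_le hyx _ _ _ _ _ _ _)) ?_⟩
  filter_upwards [hlim] with ω hω
  refine tendsto_equicorrCountProb hγ hyx h13 h24 (hns.comp hms) ?_ ?_
  · simpa only [card_markedIndices_true] using hω
  · have hc := ((tendsto_average_indicator hB hBs hBf).comp (hns.comp hms)).sub hω
    rw [← one_sub_mul] at hc
    refine hc.congr fun k => ?_
    simp only [card_markedIndices_false, card_markedIndices_true, Function.comp_apply, sub_div]

end RandomMarks

lemma integral_comp_indepFun {Ω α β : Type*} [MeasurableSpace Ω] {P : Measure Ω}
    [IsProbabilityMeasure P] [Finite α] [MeasurableSpace α] [MeasurableSingletonClass α]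
    [Finite β] [MeasurableSpace β] [MeasurableSingletonClass β] {U : Ω → α} {V : Ω → β}
    (hU : Measurable U) (hV : Measurable V) (hUV : IndepFun U V P) (F : α → β → ℝ) :
    ∫ ω, F (U ω) (V ω) ∂P = ∫ ω, ∫ ω', F (U ω') (V ω) ∂P ∂P := by
  have := Measure.isProbabilityMeasure_map (μ := P) hU.aemeasurable
  have := Measure.isProbabilityMeasure_map (μ := P) hV.aemeasurable
  have hF : Measurable fun p : α × β => F p.1 p.2 := Measurable.of_discrete
  have hG : Measurable fun b : β => ∫ a, F a b ∂(P.map U) := Measurable.of_discrete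
  calc ∫ ω, F (U ω) (V ω) ∂P
      = ∫ p, F p.1 p.2 ∂(P.map fun ω => (U ω, V ω)) :=
        (integral_map (hU.prodMk hV).aemeasurable hF.aestronglyMeasurable).symm
    _ = ∫ b, ∫ a, F a b ∂(P.map U) ∂(P.map V) := by
        rw [(indepFun_iff_map_prod_eq_prod_map_map hU.aemeasurable hV.aemeasurable).1 hUV]
        exact integral_prod_symm _ (Integrable.of_finite)
    _ = ∫ ω, ∫ a, F a (V ω) ∂(P.map U) ∂P :=
        integral_map hV.aemeasurable hG.aestronglyMeasurable
    _ = ∫ ω, ∫ ω', F (U ω') (V ω) ∂P ∂P := by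
        refine integral_congr_ae (ae_of_all _ fun ω => ?_)
        exact integral_map hU.aemeasurable
          (Measurable.of_discrete (f := fun a => F a (V ω))).aestronglyMeasurable

/-- The indices `j ≤ n` with `j / n ∈ B` whose mark is `b`, for marks given up to `n`. -/
noncomputable def markedSubindices (B : Set ℝ) (n : ℕ) (e : Finset.Icc 1 n → Bool) (b : Bool) :
    Finset (Finset.Icc 1 n) :=
  Finset.univ.filter fun j : Finset.Icc 1 n => ((j : ℕ) : ℝ) / n ∈ B ∧ e j = b

lemma disjoint_markedSubindices (B : Set ℝ) (n : ℕ) (e : Finset.Icc 1 n → Bool) :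
    Disjoint (markedSubindices B n e true) (markedSubindices B n e false) := by
  rw [Finset.disjoint_left]
  intro j h1 h2
  simp only [markedSubindices, Finset.mem_filter] at h1 h2
  simp [h1.2.2] at h2

lemma card_markedSubindices (B : Set ℝ) (n : ℕ) (e : ℕ → Bool) (b : Bool) :
    (markedSubindices B n (fun j => e j) b).card = (markedIndices B e b n).card := by
  rw [markedSubindices, markedIndices,
    ← card_filter_coe _ fun j : ℕ => (j : ℝ) / n ∈ B ∧ e j = b]

lemma card_filter_markedSubindices (B : Set ℝ) (n : ℕ) (e : ℕ → Bool) (b : Bool) (Q : ℕ → Prop) :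
    ((markedSubindices B n (fun j => e j) b).filter fun j : Finset.Icc 1 n => Q j).card
      = ((Finset.Icc 1 n).filter fun j : ℕ => (j : ℝ) / n ∈ B ∧ Q j ∧ e j = b).card := by
  rw [markedSubindices, Finset.filter_filter,
    ← card_filter_coe _ fun j : ℕ => (j : ℝ) / n ∈ B ∧ Q j ∧ e j = b]
  congr 1
  ext j
  simp only [Finset.mem_filter, Finset.mem_univ, true_and]
  tauto

lemma countIndicator_markedSubindices {y x : ℝ} (hyx : y ≤ x) (B : Set ℝ) (n : ℕ) (e : ℕ → Bool)
    (t : ℕ → ℝ) (k₁ k₂ k₃ k₄ : ℕ) :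
    countIndicator (markedSubindices B n (fun j => e j) true)
        (markedSubindices B n (fun j => e j) false) k₁ k₂ k₃ k₄ (fun j => levelState y x (t j))
      = if ((Finset.Icc 1 n).filter
            (fun j : ℕ => (j : ℝ) / n ∈ B ∧ x < t j ∧ e j = true)).card = k₁ ∧
          ((Finset.Icc 1 n).filter
            (fun j : ℕ => (j : ℝ) / n ∈ B ∧ x < t j ∧ e j = false)).card = k₂ ∧
          ((Finset.Icc 1 n).filter
            (fun j : ℕ => (j : ℝ) / n ∈ B ∧ y < t j ∧ e j = true)).card = k₃ ∧
          ((Finset.Icc 1 n).filter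
            (fun j : ℕ => (j : ℝ) / n ∈ B ∧ y < t j ∧ e j = false)).card = k₄
        then 1 else 0 := by
  simp only [countIndicator, levelState_eq_two_iff, levelState_ne_zero_iff hyx]
  simp only [← card_filter_markedSubindices B n e _ fun j => x < t j,
    ← card_filter_markedSubindices B n e _ fun j => y < t j]

lemma measureReal_counts_eq_integral {Ω : Type*} [MeasurableSpace Ω] {P : Measure Ω}
    [IsProbabilityMeasure P] {X : ℕ → Ω → ℝ} {ε : ℕ → Ω → Bool} (hX : ∀ n, Measurable (X n))
    (hε : ∀ n, Measurable (ε n))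
    (hindep : IndepFun (fun ω => fun n => X n ω) (fun ω => fun n => ε n ω) P)
    (B : Set ℝ) {y x : ℝ} (hyx : y ≤ x) (k₁ k₂ k₃ k₄ n : ℕ) :
    P.real {ω |
          ((Finset.Icc 1 n).filter
            (fun j : ℕ => (j : ℝ) / n ∈ B ∧ x < X j ω ∧ ε j ω = true)).card = k₁ ∧
          ((Finset.Icc 1 n).filter
            (fun j : ℕ => (j : ℝ) / n ∈ B ∧ x < X j ω ∧ ε j ω = false)).card = k₂ ∧
          ((Finset.Icc 1 n).filter
            (fun j : ℕ => (j : ℝ) / n ∈ B ∧ y < X j ω ∧ ε j ω = true)).card = k₃ ∧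
          ((Finset.Icc 1 n).filter
            (fun j : ℕ => (j : ℝ) / n ∈ B ∧ y < X j ω ∧ ε j ω = false)).card = k₄}
      = ∫ ω, ∫ ω', countIndicator (markedSubindices B n (fun j => ε j ω) true)
          (markedSubindices B n (fun j => ε j ω) false) k₁ k₂ k₃ k₄
          (fun j => levelState y x (X j ω')) ∂P ∂P := by
  set U : Ω → Finset.Icc 1 n → Fin 3 := fun ω j => levelState y x (X j ω)
  set V : Ω → Finset.Icc 1 n → Bool := fun ω j => ε j ω
  have hU : Measurable U := measurable_pi_iff.2 fun j => (measurable_levelState y x).comp (hX j)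
  have hV : Measurable V := measurable_pi_iff.2 fun j => hε j
  have hUV : IndepFun U V P :=
    hindep.comp (φ := fun (t : ℕ → ℝ) (j : Finset.Icc 1 n) => levelState y x (t j))
      (ψ := fun (e : ℕ → Bool) (j : Finset.Icc 1 n) => e j)
      (measurable_pi_iff.2 fun j =>
        (measurable_levelState y x).comp (measurable_pi_apply (j : ℕ)))
      (measurable_pi_iff.2 fun j => measurable_pi_apply _)
  set F : (Finset.Icc 1 n → Fin 3) → (Finset.Icc 1 n → Bool) → ℝ := fun s e =>
    countIndicator (markedSubindices B n e true) (markedSubindices B n e false) k₁ k₂ k₃ k₄ s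
  refine Eq.trans ?_ (integral_comp_indepFun hU hV hUV F)
  have hF : ∀ ω, F (U ω) (V ω) = _ := fun ω =>
    countIndicator_markedSubindices hyx B n (fun j => ε j ω) (fun j => X j ω) k₁ k₂ k₃ k₄
  have hset : MeasurableSet {ω | F (U ω) (V ω) = 1} :=
    (Measurable.of_discrete (f := fun p : (Finset.Icc 1 n → Fin 3) × (Finset.Icc 1 n → Bool) =>
      F p.1 p.2)).comp (hU.prodMk hV) (measurableSet_singleton 1)
  have hind : ∀ ω, F (U ω) (V ω) = Set.indicator {ω | F (U ω) (V ω) = 1} (1 : Ω → ℝ) ω := by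
    intro ω
    by_cases h : F (U ω) (V ω) = 1
    · rw [h, Set.indicator_of_mem (show ω ∈ {ω | F (U ω) (V ω) = 1} from h), Pi.one_apply]
    · rw [Set.indicator_of_notMem (show ω ∉ {ω | F (U ω) (V ω) = 1} from h)]
      rw [hF ω] at h ⊢
      exact if_neg fun h' => h (if_pos h')
  rw [integral_congr_ae (ae_of_all P hind), integral_indicator_one hset]
  congr 1
  ext ω
  rw [Set.mem_ofPred_eq, Set.mem_ofPred_eq, hF ω]
  split_ifs with h <;> simpa using h

theorem stmt11
    {Ω : Type} [MeasurableSpace Ω] (P : Measure Ω) [IsProbabilityMeasure P]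
    (X : ℕ → Ω → ℝ) (ε : ℕ → Ω → Bool) (lam : Ω → ℝ) (γ : ℝ)
    (hγ : 0 ≤ γ)
    (hXmeas : ∀ n, Measurable (X n))
    (hεmeas : ∀ n, Measurable (ε n))
    (hlam : Measurable lam)
    -- every finite-dimensional distribution of `X` is centered Gaussian
    (hGauss : ∀ (m : ℕ) (idx : Fin m → ℕ) (c : Fin m → ℝ), ∃ v : ℝ≥0,
      Measure.map (fun ω => ∑ i, c i * X (idx i) ω) P = gaussianReal 0 v)
    -- each `X n` is standard Gaussian
    (hstd : ∀ n, Measure.map (X n) P = gaussianReal 0 1)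
    -- stationarity
    (hstat : ∀ (m k : ℕ),
      Measure.map (fun ω => fun i : Fin m => X (i.1 + 1 + k) ω) P =
        Measure.map (fun ω => fun i : Fin m => X (i.1 + 1) ω) P)
    -- `r_n ln n → γ`
    (hr : Tendsto (fun n : ℕ => (∫ ω, X 1 ω * X (n + 1) ω ∂P) * Real.log n)
      atTop (nhds γ))
    -- independence of the sequences `X` and `ε`
    (hindep : IndepFun (fun ω => fun n => X n ω) (fun ω => fun n => ε n ω) P)
    (hlam01 : ∀ᵐ ω ∂P, lam ω ∈ Set.Icc (0 : ℝ) 1)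
    -- `S_n / n → λ` in probability
    (hS : TendstoInMeasure P
      (fun n ω => (∑ k ∈ Finset.Icc 1 n, (if ε k ω then (1 : ℝ) else 0)) / n)
      atTop lam)
    (B : Set ℝ) (hBmeas : MeasurableSet B) (hBsub : B ⊆ Set.Ioc 0 1)
    (hBfrontier : volume (frontier B) = 0)
    (x y : ℝ) (hxy : y < x)
    (k₁ k₂ k₃ k₄ : ℕ) (h13 : k₁ ≤ k₃) (h24 : k₂ ≤ k₄) :
    Tendsto (fun n : ℕ =>
      (P {ω |
          ((Finset.Icc 1 n).filter
            (fun j : ℕ => (j : ℝ) / n ∈ B ∧ un n x < X j ω ∧ ε j ω = true)).card = k₁ ∧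
          ((Finset.Icc 1 n).filter
            (fun j : ℕ => (j : ℝ) / n ∈ B ∧ un n x < X j ω ∧ ε j ω = false)).card = k₂ ∧
          ((Finset.Icc 1 n).filter
            (fun j : ℕ => (j : ℝ) / n ∈ B ∧ un n y < X j ω ∧ ε j ω = true)).card = k₃ ∧
          ((Finset.Icc 1 n).filter
            (fun j : ℕ => (j : ℝ) / n ∈ B ∧ un n y < X j ω ∧ ε j ω = false)).card = k₄}).toReal)
      atTop
      (nhds (∫ ω, ∫ z,
        (lam ω * (volume B).toReal * g γ x z) ^ k₁ / (Nat.factorial k₁ : ℝ) *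
          ((lam ω * (volume B).toReal * (g γ y z - g γ x z)) ^ (k₃ - k₁) /
            (Nat.factorial (k₃ - k₁) : ℝ)) *
          Real.exp (-(lam ω * (volume B).toReal * g γ y z)) *
        (((1 - lam ω) * (volume B).toReal * g γ x z) ^ k₂ / (Nat.factorial k₂ : ℝ) *
          (((1 - lam ω) * (volume B).toReal * (g γ y z - g γ x z)) ^ (k₄ - k₂) /
            (Nat.factorial (k₄ - k₂) : ℝ)) *
          Real.exp (-((1 - lam ω) * (volume B).toReal * g γ y z)))
        ∂(gaussianReal 0 1) ∂P)) := by
  have hX : IsStationaryGaussian X P := ⟨hXmeas, hGauss, hstd, hstat⟩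
  obtain ⟨err, herr, hcomp⟩ := hX.exists_levelState_comparison hγ hr hxy.le
  have hmix := tendsto_integral_equicorrCountProb (P := P) hγ hxy.le h13 h24 hεmeas hlam hlam01
    hS hBmeas hBsub hBfrontier
  refine tendsto_of_tendsto_of_dist hmix (squeeze_zero' (Eventually.of_forall fun n => dist_nonneg)
    ?_ herr)
  have hρ : Tendsto (fun n : ℕ => γ / log n) atTop (nhds 0) :=
    tendsto_const_nhds.div_atTop tendsto_log_natCast_atTop
  filter_upwards [hcomp, hρ.eventually (gt_mem_nhds one_pos)] with n hn hρn
  have hlevel : un n y ≤ un n x := un_le_un hxy.le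
  set J : Bool → Ω → Finset (Finset.Icc 1 n) := fun b ω =>
    markedSubindices B n (fun j => ε j ω) b
  set R : Ω → ℝ := fun ω => ∫ ω', countIndicator (J true ω) (J false ω) k₁ k₂ k₃ k₄
    (fun j => levelState (un n y) (un n x) (X j ω')) ∂P
  set Q : Ω → ℝ := fun ω => equicorrCountProb γ x y k₁ k₂ k₃ k₄ n
    (markedIndices B (fun j => ε j ω) true n).card (markedIndices B (fun j => ε j ω) false n).card
  have hRQ : ∀ ω, |R ω - Q ω| ≤ err n := fun ω => by
    refine (hn (countIndicator (J true ω) (J false ω) k₁ k₂ k₃ k₄)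
      (abs_countIndicator_le _ _ _ _ _ _)).trans_eq' ?_
    congr 2
    refine integral_congr_ae (ae_of_all _ fun z => ?_)
    simp only [integral_countIndicator_equicorr hρn hlevel z
      (disjoint_markedSubindices B n fun j => ε j ω), J, card_markedSubindices B n fun j => ε j ω]
  have hRm : Measurable R := by
    have hV : Measurable fun ω (j : Finset.Icc 1 n) => ε j ω :=
      measurable_pi_iff.2 fun j => hεmeas j
    exact (Measurable.of_discrete (f := fun e : Finset.Icc 1 n → Bool =>
      ∫ ω', countIndicator (markedSubindices B n e true) (markedSubindices B n e false) k₁ k₂ k₃ k₄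
        (fun j => levelState (un n y) (un n x) (X j ω')) ∂P)).comp hV
  have hQm : Measurable Q :=
    measurable_equicorrCountProb_markedIndices hεmeas B γ x y k₁ k₂ k₃ k₄ n
  have hQi : Integrable Q P := Integrable.of_bound hQm.aestronglyMeasurable 1
    (ae_of_all _ fun ω => (Real.norm_eq_abs _).trans_le (abs_equicorrCountProb_le hxy.le ..))
  have hdi : Integrable (fun ω => R ω - Q ω) P :=
    Integrable.of_bound (hRm.sub hQm).aestronglyMeasurable (err n)
      (ae_of_all _ fun ω => (Real.norm_eq_abs _).trans_le (hRQ ω))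
  have hRi : Integrable R P :=
    (hdi.add hQi).congr (ae_of_all _ fun ω => sub_add_cancel (R ω) (Q ω))
  rw [dist_comm, Real.dist_eq, ← measureReal_def,
    measureReal_counts_eq_integral hXmeas hεmeas hindep B hlevel, ← integral_sub hRi hQi]
  simpa using norm_integral_le_of_norm_le_const (μ := P)
    (ae_of_all _ fun ω => (Real.norm_eq_abs _).trans_le (hRQ ω))
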